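/- Let n ≥ 1 with n ≠ 3, and let P be a second-countable Hausdorff topological n-manifold with boundary (i.e., a space locally modeled on the closed half-space ℝⁿ⁻¹ × [0,∞)). Suppose the manifold interior of P is homeomorphic to ℝⁿ and the manifold boundary of P is homeomorphic to ℝⁿ⁻¹. Then P is homeomorphic to ℝⁿ⁻¹ × [0,∞). -/

import Mathlib

open Set Filter Topology Metric

theorem exists_interpolation_det_one_add {V : Type*} [NormedAddCommGroup V] [NormedSpace ℝ V]
    [FiniteDimensional ℝ V] {δ : ℝ} (hδ : 0 < δ) :
    ∃ (N : ℕ) (t c : Fin N → ℝ), (∀ i, 0 < t i ∧ t i < δ) ∧ ∑ i, c i = 1 ∧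
      ∀ A : V →L[ℝ] V, (1 + A).det = ∑ i, c i * (1 + t i • A).det := by
  let d := Module.finrank ℝ V
  let b := Module.finBasis ℝ V
  let t : Fin (d + 1) → ℝ := fun i => δ * ((i : ℝ) + 1) / (d + 3)
  have ht : ∀ i, 0 < t i ∧ t i < δ := fun i => by
    have hi : (i : ℝ) + 1 ≤ d + 1 := by
      have := i.2
      have : (i : ℕ) ≤ d := by omega
      have : (i : ℝ) ≤ d := by exact_mod_cast this
      linarith
    have h0 : (0 : ℝ) ≤ i := by positivity
    refine ⟨by positivity, ?_⟩
    rw [div_lt_iff₀ (by positivity)]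
    nlinarith
  have hinj : InjOn t (Finset.univ : Finset (Fin (d + 1))) := by
    intro i _ j _ hij
    simp only [t] at hij
    field_simp at hij
    have : (i : ℝ) = j := by linarith
    exact Fin.ext (by exact_mod_cast this)
  have key : ∀ p : Polynomial ℝ, p.natDegree ≤ d →
      p.eval 1 = ∑ i, (Lagrange.basis Finset.univ t i).eval 1 * p.eval (t i) := by
    intro p hp
    have hdeg : p.degree < (Finset.univ : Finset (Fin (d + 1))).card := by
      refine lt_of_le_of_lt Polynomial.degree_le_natDegree ?_
      rw [Finset.card_univ, Fintype.card_fin]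
      exact_mod_cast Nat.lt_succ_of_le hp
    conv_lhs => rw [Lagrange.eq_interpolate hinj hdeg, Lagrange.interpolate_apply]
    rw [Polynomial.eval_finsetSum]
    refine Finset.sum_congr rfl fun i _ => ?_
    rw [Polynomial.eval_mul, Polynomial.eval_C, mul_comm]
  refine ⟨d + 1, t, fun i => (Lagrange.basis Finset.univ t i).eval 1, ht, ?_, fun A => ?_⟩
  · have := key 1 (by simp)
    simpa using this.symm
  · let M := LinearMap.toMatrix b b (A : V →ₗ[ℝ] V)
    let p : Polynomial ℝ := ((Polynomial.X : Polynomial ℝ) • M.map Polynomial.C +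
      (1 : Matrix (Fin d) (Fin d) ℝ).map Polynomial.C).det
    have hev : ∀ s : ℝ, p.eval s = (1 + s • A).det := by
      intro s
      have h1 : (1 + s • A).det = (LinearMap.toMatrix b b (1 + s • (A : V →ₗ[ℝ] V))).det := by
        rw [LinearMap.det_toMatrix]; rfl
      rw [h1, ← Polynomial.coe_evalRingHom, RingHom.map_det]
      congr 1
      ext i j
      by_cases hij : i = j <;> simp [M, LinearMap.toMatrix_one, hij] <;> ring
    have hp : p.natDegree ≤ d := by
      exact (Polynomial.natDegree_det_X_add_C_le M 1).trans (by simp [d])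
    have := key p hp
    simp only [hev] at this
    simpa using this

theorem exists_forall_one_le_sub_norm_det_pos {V : Type*} [NormedAddCommGroup V] [NormedSpace ℝ V]
    [FiniteDimensional ℝ V] :
    ∃ ε > 0, ∀ A : V →L[ℝ] V, ‖A‖ < ε → 0 < (1 + A).det := by
  have hc : Continuous fun A : V →L[ℝ] V => (1 + A).det :=
    ContinuousLinearMap.continuous_det.comp (by fun_prop)
  have h0 : (0 : ℝ) < (1 + (0 : V →L[ℝ] V)).det := by
    simp [ContinuousLinearMap.det]
  have := (hc.tendsto 0).eventually (lt_mem_nhds h0)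
  rw [Metric.eventually_nhds_iff] at this
  obtain ⟨ε, hε, h⟩ := this
  exact ⟨ε, hε, fun A hA => h (by simpa using hA)⟩

theorem bijective_add_of_lipschitz {V : Type*} [NormedAddCommGroup V] [CompleteSpace V]
    {w : V → V} {K : ℝ} (hw : ∀ x y, ‖w x - w y‖ ≤ K * ‖x - y‖) (hK : K < 1) :
    Function.Bijective fun x => x + w x := by
  constructor
  · intro x y hxy
    have h1 : x - y = w y - w x := by
      rw [sub_eq_sub_iff_add_eq_add, add_comm (w y)]; exact hxy
    have h2 := hw y x
    rw [← h1, norm_sub_rev y x] at h2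
    have : ‖x - y‖ = 0 := by nlinarith [norm_nonneg (x - y)]
    exact sub_eq_zero.1 (norm_eq_zero.1 this)
  · intro y
    have hc : ContractingWith K.toNNReal fun x => y - w x :=
      ⟨by simpa using hK, LipschitzWith.of_dist_le_mul fun a b => by
        rw [dist_sub_left, dist_eq_norm, dist_eq_norm]
        exact (hw a b).trans (mul_le_mul_of_nonneg_right (Real.le_coe_toNNReal K)
          (norm_nonneg _))⟩
    have := ContractingWith.fixedPoint_isFixedPt hc
    refine ⟨ContractingWith.fixedPoint _ hc, ?_⟩
    have h2 : y - w _ = _ := this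
    exact eq_sub_iff_add_eq.1 h2.symm

/-- A smooth map cannot be the identity outside a ball and retract the ball onto its boundary. -/
theorem no_smooth_retraction {V : Type*} [NormedAddCommGroup V] [InnerProductSpace ℝ V]
    [FiniteDimensional ℝ V] {R : ℝ} (hR : 0 < R) {G : V → V} (hG : ContDiff ℝ 1 G)
    (hGR : ∀ x, ‖G x‖ = R) (hid : ∀ x, ‖x‖ = R → G x = x) : False := by
  borelize V
  set μ : MeasureTheory.Measure V := MeasureTheory.Measure.addHaar
  -- the derivative of `G` is singular
  have hdet : ∀ x, (fderiv ℝ G x).det = 0 := by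
    intro x
    have hd : HasFDerivAt G (fderiv ℝ G x) x := (hG.differentiable (by norm_num) x).hasFDerivAt
    have h1 : HasFDerivAt (fun y => inner ℝ (G y) (G y)) _ x := hd.inner ℝ hd
    have h2 : (fun y => inner ℝ (G y) (G y)) = fun _ => R ^ 2 := by
      funext y; rw [real_inner_self_eq_norm_sq, hGR]
    rw [h2] at h1
    have h3 := h1.unique (hasFDerivAt_const (R ^ 2) x)
    have h4 : ∀ v, inner ℝ (G x) (fderiv ℝ G x v) = 0 := by
      intro v
      have := DFunLike.congr_fun h3 v
      simp [fderivInnerCLM_apply, real_inner_comm] at this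
      exact this
    by_contra hne
    have hsurj : Function.Surjective (fderiv ℝ G x) := by
      have hu : IsUnit (LinearMap.det (fderiv ℝ G x : V →ₗ[ℝ] V)) := isUnit_iff_ne_zero.2 hne
      intro y
      obtain ⟨z, hz⟩ := (LinearMap.equivOfIsUnitDet hu).surjective y
      exact ⟨z, by simpa using hz⟩
    obtain ⟨v, hv⟩ := hsurj (G x)
    have := h4 v
    rw [hv, real_inner_self_eq_norm_sq, hGR] at this
    exact hR.ne' (by simpa using this)
  obtain ⟨L, hL0, hL⟩ : ∃ L : ℝ, 0 ≤ L ∧ ∀ x ∈ closedBall (0 : V) R, ‖fderiv ℝ G x - 1‖ ≤ L := by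
    have hc : ContinuousOn (fun x => fderiv ℝ G x - 1) (closedBall (0 : V) R) :=
      ((hG.continuous_fderiv (by norm_num)).sub continuous_const).continuousOn
    obtain ⟨L, hL⟩ := (isCompact_closedBall (0 : V) R).exists_bound_of_continuousOn hc
    exact ⟨L, (norm_nonneg _).trans (hL 0 (by simp [hR.le])), hL⟩
  let w : V → V := fun x => if ‖x‖ ≤ R then G x - x else 0
  have hwout : ∀ x, R ≤ ‖x‖ → w x = 0 := by
    intro x hx
    by_cases h : ‖x‖ ≤ R
    · simp [w, h, hid x (le_antisymm h hx)]
    · simp [w, h]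
  have hGd : ∀ x, HasFDerivAt (fun x => G x - x) (fderiv ℝ G x - 1) x := fun x =>
    (hG.differentiable (by norm_num) x).hasFDerivAt.sub (hasFDerivAt_id x)
  have hin : ∀ x y, ‖x‖ ≤ R → ‖y‖ ≤ R → ‖w x - w y‖ ≤ L * ‖x - y‖ := by
    intro x y hx hy
    have := (convex_closedBall (0 : V) R).norm_image_sub_le_of_norm_hasFDerivWithin_le
      (fun z _ => (hGd z).hasFDerivWithinAt) hL (x := y) (y := x) (by simpa using hy)
      (by simpa using hx)
    simpa [w, hx, hy] using this
  have hio : ∀ x y, ‖x‖ ≤ R → R < ‖y‖ → ‖w x - w y‖ ≤ L * ‖x - y‖ := by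
    intro x y hx hy
    have hcont : ContinuousOn (fun t : ℝ => ‖x + t • (y - x)‖) (Icc 0 1) := by fun_prop
    obtain ⟨t, ht, htR⟩ := intermediate_value_Icc zero_le_one hcont
      (show R ∈ Icc _ _ by simpa using ⟨hx, hy.le⟩)
    have h1 := hin x (x + t • (y - x)) hx (le_of_eq htR)
    rw [hwout _ (ge_of_eq htR)] at h1
    rw [hwout y hy.le]
    refine h1.trans (mul_le_mul_of_nonneg_left ?_ hL0)
    have : x - (x + t • (y - x)) = t • (x - y) := by
      rw [smul_sub, smul_sub]; abel
    rw [this, norm_smul, Real.norm_of_nonneg ht.1]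
    exact mul_le_of_le_one_left (norm_nonneg _) ht.2
  have hlip : ∀ x y, ‖w x - w y‖ ≤ L * ‖x - y‖ := by
    intro x y
    rcases le_or_gt ‖x‖ R with hx | hx <;> rcases le_or_gt ‖y‖ R with hy | hy
    · exact hin x y hx hy
    · exact hio x y hx hy
    · rw [norm_sub_rev, norm_sub_rev x]; exact hio y x hy hx
    · rw [hwout x hx.le, hwout y hy.le]; simpa using by positivity
  obtain ⟨ε, hε, hpos⟩ := exists_forall_one_le_sub_norm_det_pos (V := V)
  obtain ⟨N, t, c, ht, hc, hdet1⟩ := exists_interpolation_det_one_add (V := V)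
    (δ := min ε 1 / (L + 1)) (by positivity)
  have hvol : ∀ i, ∫ x in ball (0 : V) R, (1 + t i • (fderiv ℝ G x - 1)).det ∂μ =
      ∫ _ in ball (0 : V) R, (1 : ℝ) ∂μ := by
    intro i
    have ht0 := (ht i).1
    have htL : t i * (L + 1) < min ε 1 := (lt_div_iff₀ (by positivity)).1 (ht i).2
    have htL1 : t i * L < 1 := by nlinarith [min_le_right ε 1]
    have htLε : t i * L < ε := by nlinarith [min_le_left ε 1]
    have hlipT : ∀ x y, ‖t i • w x - t i • w y‖ ≤ t i * L * ‖x - y‖ := fun x y => by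
      rw [← smul_sub, norm_smul, Real.norm_of_nonneg ht0.le, mul_assoc]
      exact mul_le_mul_of_nonneg_left (hlip x y) ht0.le
    have hbij := bijective_add_of_lipschitz hlipT htL1
    set T : V → V := fun x => x + t i • w x
    have hTid : ∀ x, R ≤ ‖x‖ → T x = x := fun x hx => by simp [T, hwout x hx]
    have himg : T '' ball 0 R = ball 0 R := by
      have h1 : T '' (ball (0 : V) R)ᶜ = (ball 0 R)ᶜ := by
        conv_rhs => rw [← image_id (ball (0 : V) R)ᶜ]
        exact image_congr fun x hx => hTid x (by simpa using hx)
      rw [image_compl_eq hbij] at h1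
      exact compl_injective h1
    have := MeasureTheory.integral_image_eq_integral_abs_det_fderiv_smul μ
      (s := ball (0 : V) R) (f := T) (f' := fun x => 1 + t i • (fderiv ℝ G x - 1))
      measurableSet_ball (fun x hx => ?_) hbij.1.injOn (fun _ => (1 : ℝ))
    · rw [himg] at this
      rw [this]
      refine MeasureTheory.setIntegral_congr_fun measurableSet_ball fun x hx => ?_
      have : 0 < (1 + t i • (fderiv ℝ G x - 1)).det := by
        refine hpos _ ?_
        rw [norm_smul, Real.norm_of_nonneg ht0.le]
        exact (mul_le_mul_of_nonneg_left (hL x (ball_subset_closedBall hx)) ht0.le).trans_lt htLε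
      simp [abs_of_pos this]
    · have h2 : HasFDerivAt (fun x => x + t i • (G x - x)) (1 + t i • (fderiv ℝ G x - 1)) x :=
        (hasFDerivAt_id x).add ((hGd x).const_smul (t i))
      refine h2.hasFDerivWithinAt.congr (fun y hy => ?_) ?_
      · have : ‖y‖ ≤ R := by simpa using (mem_ball_zero_iff.1 hy).le
        simp [T, w, this]
      · have : ‖x‖ ≤ R := by simpa using (mem_ball_zero_iff.1 hx).le
        simp [T, w, this]
  have hint : ∀ i, MeasureTheory.IntegrableOn
      (fun x => c i * (1 + t i • (fderiv ℝ G x - 1)).det) (ball (0 : V) R) μ := by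
    intro i
    have hcont : Continuous fun x => c i * (1 + t i • (fderiv ℝ G x - 1)).det :=
      continuous_const.mul (ContinuousLinearMap.continuous_det.comp (continuous_const.add
        (((hG.continuous_fderiv (by norm_num)).sub continuous_const).const_smul (t i))))
    exact (hcont.continuousOn.integrableOn_compact (isCompact_closedBall 0 R)).mono_set
      ball_subset_closedBall
  have hzero : ∫ x in ball (0 : V) R, ∑ i, c i * (1 + t i • (fderiv ℝ G x - 1)).det ∂μ = 0 := by
    have : ∀ x, (1 + (fderiv ℝ G x - 1)).det = 0 := fun x => by
      rw [add_sub_cancel]; exact hdet x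
    simp only [← hdet1, this, MeasureTheory.integral_zero]
  rw [MeasureTheory.integral_finsetSum _ fun i _ => hint i] at hzero
  simp only [MeasureTheory.integral_const_mul, hvol] at hzero
  rw [← Finset.sum_mul, hc, one_mul] at hzero
  have hb : 0 < μ.real (ball (0 : V) R) :=
    ENNReal.toReal_pos (measure_ball_pos μ 0 hR).ne' MeasureTheory.measure_ball_lt_top.ne
  simp at hzero
  rw [hzero] at hb
  exact lt_irrefl _ hb

/-- A continuous self-map of a finite-dimensional space which is the identity outside a ball
has a zero. -/
theorem exists_zero_of_eq_id_outside {V : Type*} [NormedAddCommGroup V] [InnerProductSpace ℝ V]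
    [FiniteDimensional ℝ V] {F : V → V} (hF : Continuous F) {R : ℝ}
    (hid : ∀ x, R ≤ ‖x‖ → F x = x) : ∃ x, F x = 0 := by
  by_contra! hne
  obtain ⟨S, hRS, hS⟩ : ∃ S, R ≤ S ∧ 0 < S := ⟨max R 1, le_max_left _ _, by positivity⟩
  replace hid : ∀ x, S ≤ ‖x‖ → F x = x := fun x hx => hid x (hRS.trans hx)
  obtain ⟨g, hg, hgF, hgs⟩ := (show Continuous fun x => F x - x by fun_prop).exists_contDiff_approx 1
    (ε := fun x => ‖F x‖) hF.norm (fun x => norm_pos_iff.2 (hne x))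
  have hg0 : ∀ x, S ≤ ‖x‖ → g x = 0 := by
    intro x hx
    by_contra h
    have := hgs h
    simp [hid x hx] at this
  have hne' : ∀ x, x + g x ≠ 0 := by
    intro x hx
    have h1 := hgF x
    rw [dist_eq_norm] at h1
    have : g x - (F x - x) = -F x := by
      rw [eq_neg_of_add_eq_zero_right hx]; abel
    rw [this, norm_neg] at h1
    exact lt_irrefl _ h1
  have hsm : ContDiff ℝ 1 fun x => x + g x := contDiff_id.add hg
  refine no_smooth_retraction (V := V) hS (G := fun x => (S * ‖x + g x‖⁻¹) • (x + g x)) ?_ ?_ ?_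
  · exact (contDiff_const.mul ((hsm.norm ℝ hne').inv fun x => norm_ne_zero_iff.2 (hne' x))).smul hsm
  · intro x
    have := norm_pos_iff.2 (hne' x)
    rw [norm_smul, norm_mul, norm_inv, norm_norm, Real.norm_of_nonneg hS.le, mul_assoc,
      inv_mul_cancel₀ this.ne', mul_one]
  · intro x hx
    simp [hg0 x hx.ge, hx, hS.ne']

/-- Radial interpolation between the values of `T` on the sphere of radius `r` about `x`
and the value `e` at the center. -/
theorem continuousOn_cone {V W : Type*} [NormedAddCommGroup V] [NormedSpace ℝ V]
    [FiniteDimensional ℝ V] [NormedAddCommGroup W] [NormedSpace ℝ W] {T : V → W} {r : ℝ}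
    (hr : 0 < r) (hT : ContinuousOn T (sphere 0 r)) (e : W) :
    Continuous (fun u : V => (‖u‖ / r) • T ((r / ‖u‖) • u) + (1 - ‖u‖ / r) • e) := by
  refine Continuous.add ?_ (by fun_prop)
  have hmem : ∀ u : V, u ≠ 0 → (r / ‖u‖) • u ∈ sphere (0 : V) r := by
    intro u hu
    have : 0 < ‖u‖ := norm_pos_iff.2 hu
    rw [mem_sphere_zero_iff_norm, norm_smul, norm_div, norm_norm, Real.norm_of_nonneg hr.le,
      div_mul_cancel₀ _ this.ne']
  rw [continuous_iff_continuousAt]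
  intro u
  by_cases hu : u = 0
  · subst hu
    obtain ⟨C, hC⟩ := (isCompact_sphere (0 : V) r).exists_bound_of_continuousOn hT
    rw [← continuousWithinAt_compl_self]
    have h1 : Tendsto (fun u : V => ‖u‖ / r) (𝓝[{0}ᶜ] 0) (𝓝 0) := by
      have : Continuous fun u : V => ‖u‖ / r := by fun_prop
      have := (this.tendsto 0).mono_left (nhdsWithin_le_nhds (s := {0}ᶜ))
      simpa using this
    have h2 := NormedField.tendsto_zero_smul_of_tendsto_zero_of_bounded h1
      (f := fun u => T ((r / ‖u‖) • u)) (by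
        refine ⟨C, ?_⟩
        rw [eventually_map]
        filter_upwards [self_mem_nhdsWithin] with u hu
        exact hC _ (hmem u hu))
    have h3 : Tendsto (fun u : V => (‖u‖ / r) • T ((r / ‖u‖) • u)) (𝓝[{0}ᶜ] 0) (𝓝 0) := h2
    simpa [ContinuousWithinAt] using h3
  · have hn : ‖u‖ ≠ 0 := norm_ne_zero_iff.2 hu
    have h1 : ContinuousOn (fun u : V => (r / ‖u‖) • u) {0}ᶜ := by
      intro v hv
      have hv' : ‖v‖ ≠ 0 := norm_ne_zero_iff.2 hv
      exact ContinuousAt.continuousWithinAt (by fun_prop (disch := assumption))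
    have h2 := (hT.comp h1 (fun v hv => hmem v hv)).continuousAt (isOpen_compl_singleton.mem_nhds hu)
    exact ContinuousAt.smul (by fun_prop) h2

/-- A homeomorphism between open subsets of a half-space maps interior points to interior
points. -/
theorem OpenPartialHomeomorph.pos_of_euclideanHalfSpace {n : ℕ} [NeZero n]
    (t : OpenPartialHomeomorph (EuclideanHalfSpace n) (EuclideanHalfSpace n))
    {x : EuclideanHalfSpace n} (hx : x ∈ t.source) (hx0 : 0 < x.1 0) : 0 < (t x).1 0 := by
  by_contra hneg
  have htx0 : (t x).1 0 = 0 := le_antisymm (not_lt.1 hneg) (t x).2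
  let J : EuclideanSpace ℝ (Fin n) → EuclideanHalfSpace n :=
    (modelWithCornersEuclideanHalfSpace n).symm
  have hJc : Continuous J := (modelWithCornersEuclideanHalfSpace n).continuous_symm
  have hJ : ∀ y : EuclideanHalfSpace n, J y.1 = y := fun y =>
    (modelWithCornersEuclideanHalfSpace n).left_inv y
  have hJ' : ∀ v : EuclideanSpace ℝ (Fin n), 0 ≤ v 0 → (J v).1 = v := fun v hv =>
    congrArg Subtype.val (hJ ⟨v, hv⟩)
  obtain ⟨s, hs, hst⟩ : ∃ s > 0, ∀ v : EuclideanSpace ℝ (Fin n), dist v (t x).1 < s →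
      J v ∈ t.target := by
    have : J ⁻¹' t.target ∈ 𝓝 (t x).1 :=
      (t.open_target.preimage hJc).mem_nhds (by rw [mem_preimage, hJ]; exact t.map_source hx)
    exact Metric.mem_nhds_iff.1 this
  obtain ⟨r, hr, hrt⟩ : ∃ r > 0, ∀ v : EuclideanSpace ℝ (Fin n), ‖v‖ ≤ r →
      0 < (x.1 + v) 0 ∧ J (x.1 + v) ∈ t.source ∧ dist (t (J (x.1 + v))).1 (t x).1 < s := by
    have h1 : ∀ᶠ v in 𝓝 (0 : EuclideanSpace ℝ (Fin n)), 0 < (x.1 + v) 0 := by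
      have : ContinuousAt (fun v : EuclideanSpace ℝ (Fin n) => (x.1 + v) 0) 0 := by fun_prop
      exact this.eventually (lt_mem_nhds (by simpa using hx0))
    have hJ0 : Tendsto (fun v : EuclideanSpace ℝ (Fin n) => J (x.1 + v)) (𝓝 0) (𝓝 x) := by
      have : Continuous fun v : EuclideanSpace ℝ (Fin n) => J (x.1 + v) := by fun_prop
      simpa [hJ] using this.tendsto 0
    have h2 : ∀ᶠ v in 𝓝 (0 : EuclideanSpace ℝ (Fin n)), J (x.1 + v) ∈ t.source :=
      hJ0.eventually (t.open_source.mem_nhds hx)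
    have h3 : ∀ᶠ v in 𝓝 (0 : EuclideanSpace ℝ (Fin n)), dist (t (J (x.1 + v))).1 (t x).1 < s := by
      have : Tendsto (fun v => (t (J (x.1 + v))).1) (𝓝 0) (𝓝 (t x).1) :=
        (continuous_subtype_val.tendsto _).comp ((t.continuousAt hx).tendsto.comp hJ0)
      exact this.eventually (Metric.ball_mem_nhds _ hs)
    obtain ⟨r, hr, h⟩ := Metric.nhds_basis_closedBall.eventually_iff.1 (h1.and (h2.and h3))
    exact ⟨r, hr, fun v hv => h (by simpa using hv)⟩
  let T : EuclideanSpace ℝ (Fin n) → EuclideanSpace ℝ (Fin n) := fun v => (t (J (x.1 + v))).1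
  have hTc : ContinuousOn T (closedBall 0 r) := by
    intro v hv
    have h := hrt v (by simpa using hv)
    have : ContinuousAt (fun v => J (x.1 + v)) v := by fun_prop
    exact (continuous_subtype_val.continuousAt.comp (ContinuousAt.comp
      (f := fun v => J (x.1 + v)) (t.continuousAt h.2.1) this)).continuousWithinAt
  let e : EuclideanSpace ℝ (Fin n) := (t x).1 + EuclideanSpace.single 0 (s / 2)
  have he0 : 0 < e 0 := by simp [e, htx0, hs]
  have hes : dist e (t x).1 < s := by simp [e, abs_of_pos hs, hs]
  let m : EuclideanSpace ℝ (Fin n) → EuclideanSpace ℝ (Fin n) := fun u =>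
    (‖u‖ / r) • T ((r / ‖u‖) • u) + (1 - ‖u‖ / r) • e
  have hmc : Continuous m := continuousOn_cone hr (hTc.mono sphere_subset_closedBall) e
  have hrad : ∀ u : EuclideanSpace ℝ (Fin n), ‖(r / ‖u‖) • u‖ ≤ r := by
    intro u
    rw [norm_smul, norm_div, norm_norm, Real.norm_of_nonneg hr.le]
    rcases eq_or_ne ‖u‖ 0 with h | h
    · simp [h, hr.le]
    · rw [div_mul_cancel₀ _ h]
  have hT0 : ∀ v, 0 ≤ T v 0 := fun v => (t (J (x.1 + v))).2
  have hm : ∀ u, ‖u‖ ≤ r → 0 ≤ m u 0 ∧ J (m u) ∈ t.target ∧ (m u 0 = 0 → ‖u‖ = r) := by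
    intro u hu
    have h1 : ‖u‖ / r ≤ 1 := (div_le_one hr).2 hu
    have h0 : 0 ≤ ‖u‖ / r := by positivity
    have hm0 : m u 0 = (‖u‖ / r) * T ((r / ‖u‖) • u) 0 + (1 - ‖u‖ / r) * e 0 := by simp [m]
    have hTT := hT0 ((r / ‖u‖) • u)
    refine ⟨?_, hst _ ?_, fun h => ?_⟩
    · rw [hm0]
      have := mul_nonneg h0 hTT
      nlinarith
    · have := (convex_ball (t x).1 s) (mem_ball.2 (hrt _ (hrad u)).2.2) (mem_ball.2 hes) h0
        (sub_nonneg.2 h1) (by ring)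
      exact mem_ball.1 this
    · rw [hm0] at h
      have h2 := mul_nonneg h0 hTT
      have : (1 - ‖u‖ / r) * e 0 = 0 := le_antisymm (by linarith) (by nlinarith)
      have : 1 - ‖u‖ / r = 0 := by
        rcases mul_eq_zero.1 this with h | h
        · exact h
        · exact absurd h he0.ne'
      field_simp at this
      linarith
  let F : EuclideanSpace ℝ (Fin n) → EuclideanSpace ℝ (Fin n) := fun u =>
    if ‖u‖ ≤ r then (t.symm (J (m u))).1 - x.1 else u
  have hmr : ∀ u, ‖u‖ = r → m u = T u := by
    intro u hu
    simp [m, hu, hr.ne']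
  have hFc : Continuous F := by
    refine continuous_if_le (f := fun u : EuclideanSpace ℝ (Fin n) => ‖u‖) (g := fun _ => r)
      (by fun_prop) (by fun_prop) ?_ continuousOn_id ?_
    · intro u hu
      have h := (hm u hu).2.1
      have h1 : ContinuousAt (fun u => J (m u)) u := (hJc.comp hmc).continuousAt
      exact ((continuous_subtype_val.continuousAt.comp
        (ContinuousAt.comp (f := fun u => J (m u)) (t.symm.continuousAt h) h1)).sub continuousAt_const).continuousWithinAt
    · intro u hu
      have h := hrt u hu.le
      rw [hmr u hu]
      simp only [T, hJ, t.left_inv h.2.1, hJ' _ h.1.le]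
      simp
  obtain ⟨u, hu⟩ := exists_zero_of_eq_id_outside hFc (R := 2 * r) (fun u hu => by
    have : ¬ ‖u‖ ≤ r := by linarith
    simp [F, this])
  by_cases hur : ‖u‖ ≤ r
  · have h := hm u hur
    simp only [F, hur, if_true] at hu
    have h1 : t.symm (J (m u)) = x := Subtype.ext (sub_eq_zero.1 hu)
    have h2 : J (m u) = t x := by rw [← h1, t.right_inv h.2.1]
    have h3 : m u = (t x).1 := by rw [← h2, hJ' _ h.1]
    have h4 := h.2.2 (by rw [h3, htx0])
    rw [hmr u h4] at h3
    have h5 := hrt u hur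
    have h6 : J (x.1 + u) = x := t.injOn h5.2.1 hx (Subtype.ext h3)
    have h7 : x.1 + u = x.1 := by rw [← hJ' _ h5.1.le, h6]
    have : u = 0 := by simpa using h7
    rw [this, norm_zero] at h4
    exact hr.ne h4
  · simp only [F, hur, if_false] at hu
    rw [hu, norm_zero] at hur
    exact hur hr.le

/-- Splitting off the first coordinate of a Euclidean space. -/
def euclideanSplit (m : ℕ) :
    EuclideanSpace ℝ (Fin (m + 1)) ≃ₜ EuclideanSpace ℝ (Fin m) × ℝ where
  toFun x := (WithLp.toLp 2 fun i => x i.succ, x 0)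
  invFun p := WithLp.toLp 2 (Fin.cons p.2 p.1.ofLp : Fin (m + 1) → ℝ)
  left_inv x := by
    ext i
    refine Fin.cases ?_ (fun j => ?_) i <;> simp
  right_inv p := by
    ext i <;> simp
  continuous_toFun := by fun_prop
  continuous_invFun := by
    refine (PiLp.continuous_toLp 2 _).comp (continuous_pi fun i => ?_)
    refine Fin.cases ?_ (fun j => ?_) i
    · simpa using continuous_snd
    · simp only [Fin.cons_succ]
      fun_prop

/-- The Euclidean half-space as a product. -/
def euclideanHalfSplit (m : ℕ) :
    EuclideanHalfSpace (m + 1) ≃ₜ EuclideanSpace ℝ (Fin m) × Ici (0 : ℝ) where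
  toFun x := ((euclideanSplit m x.1).1, ⟨x.1 0, x.2⟩)
  invFun p := ⟨(euclideanSplit m).symm (p.1, p.2.1), p.2.2⟩
  left_inv x := Subtype.ext ((euclideanSplit m).symm_apply_apply x.1)
  right_inv p := by
    have := (euclideanSplit m).apply_symm_apply (p.1, p.2.1)
    have h1 := congrArg Prod.fst this
    have h2 := congrArg Prod.snd this
    exact Prod.ext h1 (Subtype.ext h2)
  continuous_toFun := by fun_prop
  continuous_invFun := by fun_prop

theorem isInteriorPoint_iff_of_mem_chart {n : ℕ} [NeZero n] {P : Type*} [TopologicalSpace P]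
    [ChartedSpace (EuclideanHalfSpace n) P] (q p : P)
    (hp : p ∈ (chartAt (EuclideanHalfSpace n) q).source) :
    (modelWithCornersEuclideanHalfSpace n).IsInteriorPoint p ↔
      0 < (chartAt (EuclideanHalfSpace n) q p).1 0 := by
  have h0 : (modelWithCornersEuclideanHalfSpace n).IsInteriorPoint p ↔
      0 < (chartAt (EuclideanHalfSpace n) p p).1 0 := by
    rw [ModelWithCorners.IsInteriorPoint, interior_range_modelWithCornersEuclideanHalfSpace]
    rfl
  rw [h0]
  have hpp : p ∈ (chartAt (EuclideanHalfSpace n) p).source := mem_chart_source _ p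
  constructor
  · intro h
    have := OpenPartialHomeomorph.pos_of_euclideanHalfSpace
      ((chartAt (EuclideanHalfSpace n) p).symm.trans (chartAt (EuclideanHalfSpace n) q))
      (x := chartAt (EuclideanHalfSpace n) p p) (by simp [hp]) h
    simpa using this
  · intro h
    have := OpenPartialHomeomorph.pos_of_euclideanHalfSpace
      ((chartAt (EuclideanHalfSpace n) q).symm.trans (chartAt (EuclideanHalfSpace n) p))
      (x := chartAt (EuclideanHalfSpace n) q p) (by simp [hp]) h
    simpa [hp] using this

theorem exists_chart_boundary {m : ℕ} {P : Type*} [TopologicalSpace P]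
    [ChartedSpace (EuclideanHalfSpace (m + 1)) P] (p : P) :
    ∃ e : OpenPartialHomeomorph P (EuclideanSpace ℝ (Fin m) × Ici (0 : ℝ)), p ∈ e.source ∧
      ∀ q ∈ e.source,
        (q ∈ (modelWithCornersEuclideanHalfSpace (m + 1)).boundary P ↔ (e q).2.1 = 0) := by
  refine ⟨(chartAt (EuclideanHalfSpace (m + 1)) p).trans
    (euclideanHalfSplit m).toOpenPartialHomeomorph, by simp, fun q hq => ?_⟩
  have hq' : q ∈ (chartAt (EuclideanHalfSpace (m + 1)) p).source := by simpa using hq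
  have h := isInteriorPoint_iff_of_mem_chart p q hq'
  rw [← ModelWithCorners.compl_interior, mem_compl_iff, ModelWithCorners.interior, mem_ofPred, h]
  have := (chartAt (EuclideanHalfSpace (m + 1)) p q).2
  exact ⟨fun h => le_antisymm (not_lt.1 h) this, fun h => not_lt.2 h.le⟩

theorem isClosed_of_exists_chart {E P : Type*} [TopologicalSpace E] [TopologicalSpace P]
    {D : Set P} (hD : ∀ p, ∃ e : OpenPartialHomeomorph P (E × Ici (0 : ℝ)), p ∈ e.source ∧
      ∀ q ∈ e.source, (q ∈ D ↔ (e q).2.1 = 0)) : IsClosed D := by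
  rw [← isOpen_compl_iff, isOpen_iff_mem_nhds]
  intro p hp
  obtain ⟨e, hpe, he⟩ := hD p
  have h1 : ContinuousAt (fun q => (e q).2.1) p :=
    ContinuousAt.comp (f := e) (g := fun x : E × Ici (0 : ℝ) => x.2.1)
      (by fun_prop) (e.continuousAt hpe)
  have h2 : (e p).2.1 ≠ 0 := fun h => hp ((he p hpe).2 h)
  filter_upwards [h1.eventually_ne h2, e.open_source.mem_nhds hpe] with q hq hqe
  exact fun h => hq ((he q hqe).1 h)

section Extension
variable {X P : Type*} [TopologicalSpace X] [TopologicalSpace P]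

open Classical in
/-- Transport a self-map `g` of `X`, supported in `Q`, through a partial homeomorphism. -/
noncomputable def OpenPartialHomeomorph.extendMap (φ : OpenPartialHomeomorph X P) (Q : Set X)
    (g : X → X) : P → P :=
  fun p => if p ∈ φ '' Q then φ (g (φ.symm p)) else p

variable (φ : OpenPartialHomeomorph X P) {Q : Set X} {g g' : X → X}

theorem OpenPartialHomeomorph.extendMap_apply (hg : ∀ x, x ∉ Q → g x = x)
    {x : X} (hx : x ∈ φ.source) : φ.extendMap Q g (φ x) = φ (g x) := by
  unfold OpenPartialHomeomorph.extendMap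
  split_ifs with h
  · rw [φ.left_inv hx]
  · rw [hg x fun hxQ => h (mem_image_of_mem _ hxQ)]

theorem OpenPartialHomeomorph.extendMap_of_notMem {p : P} (hp : p ∉ φ '' Q) :
    φ.extendMap Q g p = p := if_neg hp

theorem OpenPartialHomeomorph.continuous_extendMap [T2Space P] (hQ : Q ⊆ φ.source)
    (hQc : IsCompact Q) (hg : ∀ x, x ∉ Q → g x = x) (hgQ : MapsTo g Q Q) (hgc : Continuous g) :
    Continuous (φ.extendMap Q g) := by
  rw [continuous_iff_continuousAt]
  intro p
  by_cases hp : p ∈ φ '' Q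
  · obtain ⟨x, hxQ, rfl⟩ := hp
    have hx := hQ hxQ
    have h1 : ContinuousAt (fun p => φ (g (φ.symm p))) (φ x) := by
      have h2 : ContinuousAt φ (g (φ.symm (φ x))) := by
        rw [φ.left_inv hx]; exact φ.continuousAt (hQ (hgQ hxQ))
      have h3 : ContinuousAt (fun p => g (φ.symm p)) (φ x) :=
        hgc.continuousAt.comp (φ.symm.continuousAt (φ.map_source hx))
      exact ContinuousAt.comp (f := fun p => g (φ.symm p)) h2 h3
    refine h1.congr ?_
    filter_upwards [φ.open_target.mem_nhds (φ.map_source hx)] with p hp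
    conv_rhs => rw [← φ.right_inv hp]
    rw [φ.extendMap_apply hg (φ.map_target hp)]
  · have hcl : IsClosed (φ '' Q) :=
      (hQc.image_of_continuousOn (φ.continuousOn.mono hQ)).isClosed
    refine continuousAt_id.congr ?_
    filter_upwards [hcl.isOpen_compl.mem_nhds hp] with q hq
    exact (φ.extendMap_of_notMem hq).symm

theorem OpenPartialHomeomorph.extendMap_leftInverse (hQ : Q ⊆ φ.source)
    (hg : ∀ x, x ∉ Q → g x = x) (hg' : ∀ x, x ∉ Q → g' x = x) (hgQ : MapsTo g Q Q)
    (hinv : ∀ x, g' (g x) = x) (p : P) : φ.extendMap Q g' (φ.extendMap Q g p) = p := by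
  by_cases hp : p ∈ φ '' Q
  · obtain ⟨x, hxQ, rfl⟩ := hp
    rw [φ.extendMap_apply hg (hQ hxQ), φ.extendMap_apply hg' (hQ (hgQ hxQ)), hinv]
  · rw [φ.extendMap_of_notMem hp, φ.extendMap_of_notMem hp]

theorem Homeomorph.mapsTo_of_support {Q : Set X} (g : X ≃ₜ X) (hg : ∀ x, x ∉ Q → g x = x) :
    MapsTo g Q Q := by
  intro x hx
  by_contra h
  have := g.injective (hg _ h)
  exact h (this.symm ▸ hx)

theorem Homeomorph.symm_support {Q : Set X} (g : X ≃ₜ X) (hg : ∀ x, x ∉ Q → g x = x) :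
    ∀ x, x ∉ Q → g.symm x = x := fun x hx => by
  rw [g.symm_apply_eq, hg x hx]

/-- Transport a homeomorphism with compact support through a partial homeomorphism. -/
noncomputable def OpenPartialHomeomorph.extendHomeomorph [T2Space P] (hQ : Q ⊆ φ.source)
    (hQc : IsCompact Q) (g : X ≃ₜ X) (hg : ∀ x, x ∉ Q → g x = x) : P ≃ₜ P where
  toFun := φ.extendMap Q g
  invFun := φ.extendMap Q g.symm
  left_inv := φ.extendMap_leftInverse hQ hg (g.symm_support hg) (g.mapsTo_of_support hg)
    g.symm_apply_apply
  right_inv := φ.extendMap_leftInverse hQ (g.symm_support hg) hg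
    (g.symm.mapsTo_of_support (g.symm_support hg)) g.apply_symm_apply
  continuous_toFun := φ.continuous_extendMap hQ hQc hg (g.mapsTo_of_support hg) g.continuous
  continuous_invFun := φ.continuous_extendMap hQ hQc (g.symm_support hg)
    (g.symm.mapsTo_of_support (g.symm_support hg)) g.symm.continuous

/-- Transport a homeomorphism with compact support through an open embedding. -/
theorem Topology.IsOpenEmbedding.exists_extend [T2Space P] {φ : X → P} (hφ : IsOpenEmbedding φ)
    (hQc : IsCompact Q) (g : X ≃ₜ X) (hg : ∀ x, x ∉ Q → g x = x) :
    ∃ G : P ≃ₜ P, (∀ x, G (φ x) = φ (g x)) ∧ ∀ p, p ∉ φ '' Q → G p = p := by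
  rcases isEmpty_or_nonempty X with hX | hX
  · exact ⟨Homeomorph.refl P, fun x => isEmptyElim x, fun p _ => rfl⟩
  · refine ⟨(hφ.toOpenPartialHomeomorph φ).extendHomeomorph (by simp) hQc g hg, fun x => ?_,
      fun p hp => ?_⟩
    · exact (hφ.toOpenPartialHomeomorph φ).extendMap_apply hg (by simp)
    · exact (hφ.toOpenPartialHomeomorph φ).extendMap_of_notMem (by simpa using hp)

end Extension

section Radial

/-- Rescaling vectors so that their norms change from `t` to `θ t`. -/
noncomputable def radialMap {V : Type*} [NormedAddCommGroup V] [NormedSpace ℝ V] (θ : ℝ → ℝ)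
    (x : V) : V := (θ ‖x‖ / ‖x‖) • x

variable {V : Type*} [NormedAddCommGroup V] [NormedSpace ℝ V]

theorem norm_radialMap {θ : ℝ → ℝ} (h0 : θ 0 = 0) {x : V} (h : 0 ≤ θ ‖x‖) :
    ‖radialMap θ x‖ = θ ‖x‖ := by
  rcases eq_or_ne x 0 with rfl | hx
  · simp [radialMap, h0]
  · have := norm_pos_iff.2 hx
    rw [radialMap, norm_smul, norm_div, norm_norm, Real.norm_of_nonneg h,
      div_mul_cancel₀ _ this.ne']

theorem radialMap_of_eq {θ : ℝ → ℝ} {x : V} (h : θ ‖x‖ = ‖x‖) : radialMap θ x = x := by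
  rcases eq_or_ne x 0 with rfl | hx
  · simp [radialMap]
  · rw [radialMap, h, div_self (norm_ne_zero_iff.2 hx), one_smul]

theorem radialMap_radialMap {θ θ' : ℝ → ℝ} (h0 : θ 0 = 0) (h0' : θ' 0 = 0)
    (hθ : ∀ t, 0 ≤ t → 0 ≤ θ t)
    (hinv : ∀ t, 0 ≤ t → θ' (θ t) = t) (x : V) : radialMap θ' (radialMap θ x) = x := by
  rcases eq_or_ne x 0 with rfl | hx
  · simp [radialMap]
  · have hx' := norm_pos_iff.2 hx
    rw [radialMap, norm_radialMap h0 (hθ _ hx'.le), hinv _ hx'.le, radialMap, smul_smul]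
    have : θ ‖x‖ ≠ 0 := fun h => by
      have := hinv _ hx'.le
      rw [h, h0'] at this
      exact hx'.ne this
    rw [div_mul_div_cancel₀ this, div_self hx'.ne', one_smul]

theorem continuous_radialMap {S : Type*} [TopologicalSpace S] {θ : S → ℝ → ℝ}
    (hθ : Continuous fun p : S × ℝ => θ p.1 p.2) (h0 : ∀ s, θ s 0 = 0) :
    Continuous fun p : S × V => radialMap (θ p.1) p.2 := by
  rw [continuous_iff_continuousAt]
  rintro ⟨s, x⟩
  have hc : Continuous fun p : S × V => θ p.1 ‖p.2‖ := 
    hθ.comp (continuous_fst.prodMk continuous_snd.norm)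
  rcases eq_or_ne x 0 with rfl | hx
  · have h1 : Tendsto (fun p : S × V => |θ p.1 ‖p.2‖|) (𝓝 (s, 0)) (𝓝 0) := by
      have := (hc.abs.tendsto (s, (0 : V)))
      simpa [h0] using this
    rw [ContinuousAt, show radialMap (θ s) (0 : V) = 0 by simp [radialMap]]
    refine squeeze_zero_norm (fun p => ?_) h1
    rw [radialMap, norm_smul, norm_div, norm_norm, Real.norm_eq_abs]
    rcases eq_or_ne ‖p.2‖ 0 with h | h
    · rw [h]; simp
    · rw [div_mul_cancel₀ _ h]
  · have : ContinuousAt (fun p : S × V => ‖p.2‖) (s, x) := by fun_prop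
    exact (hc.continuousAt.div this (norm_ne_zero_iff.2 hx)).smul continuousAt_snd

/-- The piecewise linear function fixing `a` and `c`, moving `b` to `b'`, and equal to the
identity outside `[a, c]`. -/
noncomputable def plMap (a b b' c t : ℝ) : ℝ :=
  if t ≤ a then t else if t ≤ b then a + (t - a) * ((b' - a) / (b - a))
    else if t ≤ c then c - (c - t) * ((c - b') / (c - b)) else t

variable {a b b' c : ℝ}

theorem plMap_of_le {t : ℝ} (h : t ≤ a) : plMap a b b' c t = t := by simp [plMap, h]

theorem plMap_of_ge (hab : a < b) (hbc : b < c) {t : ℝ} (h : c ≤ t) : plMap a b b' c t = t := by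
  have h1 : ¬ t ≤ a := by linarith
  have h2 : ¬ t ≤ b := by linarith
  simp only [plMap, h1, h2, if_false]
  split_ifs with h3
  · have : t = c := le_antisymm h3 h
    subst this; simp
  · rfl

theorem plMap_mem_lower {t : ℝ} (h1 : a ≤ t) (h2 : t ≤ b) :
    plMap a b b' c t = a + (t - a) * ((b' - a) / (b - a)) := by
  rcases h1.eq_or_lt with rfl | h1
  · simp [plMap]
  · simp [plMap, not_le.2 h1, h2]

theorem plMap_mem_upper (hab : a < b) (hbc : b < c) {t : ℝ} (h1 : b ≤ t) (h2 : t ≤ c) :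
    plMap a b b' c t = c - (c - t) * ((c - b') / (c - b)) := by
  have : ¬ t ≤ a := by linarith
  rcases h1.eq_or_lt with rfl | h1
  · have h3 : b - a ≠ 0 := by linarith
    have h4 : c - b ≠ 0 := by linarith
    simp only [plMap, this, if_false, le_refl, if_true]
    field_simp; ring
  · simp [plMap, this, not_le.2 h1, h2]

theorem plMap_self (hab : a < b) : plMap a b b' c b = b' := by
  rw [plMap_mem_lower hab.le le_rfl]
  have : b - a ≠ 0 := by linarith
  field_simp; ring

theorem plMap_inv (hab : a < b) (hbc : b < c) (hab' : a < b') (hbc' : b' < c) (t : ℝ) :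
    plMap a b' b c (plMap a b b' c t) = t := by
  rcases le_total t a with h | h
  · rw [plMap_of_le h, plMap_of_le h]
  rcases le_total c t with h' | h'
  · rw [plMap_of_ge hab hbc h', plMap_of_ge hab' hbc' h']
  rcases le_total t b with h'' | h''
  · rw [plMap_mem_lower h h'']
    have e1 : 0 < b - a := by linarith
    have e2 : 0 < b' - a := by linarith
    rw [plMap_mem_lower]
    · field_simp; ring
    · have : 0 ≤ (t - a) * ((b' - a) / (b - a)) := by
        have : 0 ≤ t - a := by linarith
        positivity
      linarith
    · have : (t - a) * ((b' - a) / (b - a)) ≤ b' - a := by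
        rw [mul_div_assoc', div_le_iff₀ e1]; nlinarith
      linarith
  · rw [plMap_mem_upper hab hbc h'' h']
    have e1 : 0 < c - b := by linarith
    have e2 : 0 < c - b' := by linarith
    rw [plMap_mem_upper hab' hbc']
    · field_simp; ring
    · have : (c - t) * ((c - b') / (c - b)) ≤ c - b' := by
        rw [mul_div_assoc', div_le_iff₀ e1]; nlinarith
      linarith
    · have : 0 ≤ (c - t) * ((c - b') / (c - b)) := by
        have : 0 ≤ c - t := by linarith
        positivity
      linarith

theorem plMap_mono (hab : a < b) (hbc : b < c) (hab' : a < b') (hbc' : b' < c) {s t : ℝ}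
    (hst : s ≤ t) : plMap a b b' c s ≤ plMap a b b' c t := by
  have e1 : 0 < b - a := by linarith
  have e2 : 0 < b' - a := by linarith
  have e3 : 0 < c - b := by linarith
  have e4 : 0 < c - b' := by linarith
  have k1 : 0 < (b' - a) / (b - a) := by positivity
  have k2 : 0 < (c - b') / (c - b) := by positivity
  have m1 : (b - a) * ((b' - a) / (b - a)) = b' - a := by field_simp
  have m2 : (c - b) * ((c - b') / (c - b)) = c - b' := by field_simp
  unfold plMap
  split_ifs <;> nlinarith

theorem plMap_le_iff (hab : a < b) (hbc : b < c) (hab' : a < b') (hbc' : b' < c) {s t : ℝ} :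
    plMap a b b' c s ≤ plMap a b b' c t ↔ s ≤ t := by
  refine ⟨fun h => ?_, plMap_mono hab hbc hab' hbc'⟩
  have := plMap_mono hab' hbc' hab hbc h
  rwa [plMap_inv hab hbc hab' hbc', plMap_inv hab hbc hab' hbc'] at this

theorem continuous_plMap {S : Type*} [TopologicalSpace S] {β β' : S → ℝ} (hβ : Continuous β)
    (hβ' : Continuous β') (hab : ∀ s, a < β s) (hbc : ∀ s, β s < c) :
    Continuous fun p : S × ℝ => plMap a (β p.1) (β' p.1) c p.2 := by
  have e1 : ∀ s, β s - a ≠ 0 := fun s => by linarith [hab s]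
  have e3 : ∀ s, c - β s ≠ 0 := fun s => by linarith [hbc s]
  have k1 : Continuous fun p : S × ℝ => (β' p.1 - a) / (β p.1 - a) :=
    Continuous.div (by fun_prop) (by fun_prop) fun p => e1 _
  have k2 : Continuous fun p : S × ℝ => (c - β' p.1) / (c - β p.1) :=
    Continuous.div (by fun_prop) (by fun_prop) fun p => e3 _
  unfold plMap
  refine Continuous.if_le (by fun_prop) (Continuous.if_le (by fun_prop)
    (Continuous.if_le (by fun_prop) (by fun_prop) (by fun_prop) (by fun_prop) ?_)
    (by fun_prop) (by fun_prop) ?_) (by fun_prop) (by fun_prop) ?_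
  · rintro p h; simp [h]
  · rintro p h
    have := e1 p.1
    have := e3 p.1
    rw [h, if_pos (hbc _).le]; field_simp; ring
  · rintro p h
    rw [h, if_pos (hab _).le]; ring

/-- A fibrewise piecewise linear homeomorphism of `S × ℝ`. -/
noncomputable def plHomeomorph {S : Type*} [TopologicalSpace S] (a c : ℝ) {β β' : S → ℝ}
    (hβ : Continuous β) (hβ' : Continuous β') (hab : ∀ s, a < β s) (hbc : ∀ s, β s < c)
    (hab' : ∀ s, a < β' s) (hbc' : ∀ s, β' s < c) : S × ℝ ≃ₜ S × ℝ where
  toFun p := (p.1, plMap a (β p.1) (β' p.1) c p.2)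
  invFun p := (p.1, plMap a (β' p.1) (β p.1) c p.2)
  left_inv p := by simp [plMap_inv (hab _) (hbc _) (hab' _) (hbc' _)]
  right_inv p := by simp [plMap_inv (hab' _) (hbc' _) (hab _) (hbc _)]
  continuous_toFun := continuous_fst.prodMk (continuous_plMap hβ hβ' hab hbc)
  continuous_invFun := continuous_fst.prodMk (continuous_plMap hβ' hβ hab' hbc')

theorem plMap_eq_self (hab : a < b) (hbc : b < c) (t : ℝ) : plMap a b b c t = t := by
  have e1 : b - a ≠ 0 := by linarith
  have e3 : c - b ≠ 0 := by linarith
  unfold plMap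
  split_ifs <;> field_simp <;> ring

end Radial

section Collar
variable {E P : Type*} [TopologicalSpace E] [TopologicalSpace P]

theorem Topology.IsEmbedding.continuousOn_invFun [Nonempty E] {b : E → P} (hb : IsEmbedding b) :
    ContinuousOn (Function.invFun b) (range b) := by
  rw [hb.isInducing.continuousOn_iff]
  refine continuousOn_id.congr ?_
  rintro _ ⟨y, rfl⟩
  rw [Function.comp_apply, Function.leftInverse_invFun hb.injective y]; rfl

/-- A boundary chart can be rectified along a given parametrization `b` of the boundary. -/
theorem exists_aligned_collar {b : E → P} (hb : IsEmbedding b)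
    (e : OpenPartialHomeomorph P (E × Ici (0 : ℝ)))
    (he : ∀ q ∈ e.source, (q ∈ range b ↔ (e q).2.1 = 0)) (y₀ : E) (hy₀ : b y₀ ∈ e.source) :
    ∃ φ : OpenPartialHomeomorph (E × Ici (0 : ℝ)) P, (y₀, ⟨0, self_mem_Ici⟩) ∈ φ.source ∧
      (∀ y, (y, ⟨0, self_mem_Ici⟩) ∈ φ.source → φ (y, ⟨0, self_mem_Ici⟩) = b y) ∧
      ∀ x ∈ φ.source, (φ x ∈ range b ↔ x.2.1 = 0) := by
  have : Nonempty E := ⟨y₀⟩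
  have hbinv : ∀ y, Function.invFun b (b y) = y :=
    fun y => Function.leftInverse_invFun hb.injective y
  have hbc := hb.continuousOn_invFun
  have he0 : ∀ y, b y ∈ e.source → e (b y) = ((e (b y)).1, ⟨0, self_mem_Ici⟩) := fun y hy =>
    Prod.ext rfl (Subtype.ext ((he _ hy).1 (mem_range_self y)))
  have hzr : ∀ z, (z, (⟨0, self_mem_Ici⟩ : Ici (0 : ℝ))) ∈ e.target →
      e.symm (z, ⟨0, self_mem_Ici⟩) ∈ range b := fun z hz => by
    rw [he _ (e.map_target hz), e.right_inv hz]
  have hzb : ∀ z, (z, (⟨0, self_mem_Ici⟩ : Ici (0 : ℝ))) ∈ e.target →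
      b (Function.invFun b (e.symm (z, ⟨0, self_mem_Ici⟩))) = e.symm (z, ⟨0, self_mem_Ici⟩) := fun z hz => by
    obtain ⟨y, hy⟩ := hzr z hz
    rw [← hy, hbinv]
  refine ⟨{ toFun := fun x => e.symm ((e (b x.1)).1, x.2)
            invFun := fun p => (Function.invFun b (e.symm ((e p).1, ⟨0, self_mem_Ici⟩)), (e p).2)
            source := {x | b x.1 ∈ e.source ∧ ((e (b x.1)).1, x.2) ∈ e.target}
            target := {p | p ∈ e.source ∧ ((e p).1, (⟨0, self_mem_Ici⟩ : Ici (0 : ℝ))) ∈ e.target}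
            map_source' := ?_, map_target' := ?_, left_inv' := ?_, right_inv' := ?_
            open_source := ?_, open_target := ?_, continuousOn_toFun := ?_
            continuousOn_invFun := ?_ }, ?_, ?_, ?_⟩
  · rintro x ⟨h1, h2⟩
    refine ⟨e.map_target h2, ?_⟩
    rw [e.right_inv h2, ← he0 _ h1]
    exact e.map_source h1
  · rintro p ⟨h1, h2⟩
    refine ⟨?_, ?_⟩
    · change b (Function.invFun b _) ∈ _
      rw [hzb _ h2]; exact e.map_target h2
    · change ((e (b (Function.invFun b _))).1, _) ∈ _
      rw [hzb _ h2, e.right_inv h2]; exact e.map_source h1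
  · rintro x ⟨h1, h2⟩
    rw [e.right_inv h2, ← he0 _ h1, e.left_inv h1, hbinv]
  · rintro p ⟨h1, h2⟩
    change e.symm ((e (b (Function.invFun b _))).1, _) = _
    rw [hzb _ h2, e.right_inv h2]; exact e.left_inv h1
  · refine e.symm.continuousOn.comp (ContinuousOn.prodMk ?_ continuousOn_snd) fun x hx => hx.2
    exact continuousOn_fst.comp (e.continuousOn.comp
      (hb.continuous.comp continuous_fst).continuousOn fun x hx => hx.1) fun x _ => mem_univ _
  · refine ContinuousOn.prodMk ?_ (continuousOn_snd.comp
      (e.continuousOn.mono fun p hp => hp.1) fun x _ => mem_univ _)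
    refine hbc.comp (e.symm.continuousOn.comp (ContinuousOn.prodMk ?_ continuousOn_const)
      fun p hp => hp.2) fun p hp => hzr _ hp.2
    exact continuousOn_fst.comp (e.continuousOn.mono fun p hp => hp.1) fun x _ => mem_univ _
  · have h1 : IsOpen {x : E × Ici (0 : ℝ) | b x.1 ∈ e.source} :=
      e.open_source.preimage (hb.continuous.comp continuous_fst)
    refine ContinuousOn.isOpen_inter_preimage (f := fun x : E × Ici (0 : ℝ) =>
      ((e (b x.1)).1, x.2)) ?_ h1 e.open_target
    refine ContinuousOn.prodMk ?_ continuousOn_snd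
    exact continuousOn_fst.comp (e.continuousOn.comp
      (hb.continuous.comp continuous_fst).continuousOn fun x hx => hx) fun x _ => mem_univ _
  · refine ContinuousOn.isOpen_inter_preimage (f := fun p =>
      ((e p).1, (⟨0, self_mem_Ici⟩ : Ici (0 : ℝ)))) ?_ e.open_source e.open_target
    exact (continuousOn_fst.comp e.continuousOn fun x _ => mem_univ _).prodMk continuousOn_const
  · refine ⟨hy₀, ?_⟩
    change ((e (b y₀)).1, _) ∈ _
    rw [← he0 _ hy₀]; exact e.map_source hy₀
  · rintro y ⟨h1, h2⟩
    change e.symm ((e (b y)).1, _) = _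
    rw [← he0 _ h1, e.left_inv h1]
  · rintro x ⟨h1, h2⟩
    change e.symm _ ∈ _ ↔ _
    rw [he _ (e.map_target h2), e.right_inv h2]

/-- The space `P` with the external collar `range b × (-∞, 0]` attached. -/
abbrev ExternalCollar (b : E → P) : Type _ :=
  {q : P × ℝ // q.2 = 0 ∨ (q.1 ∈ range b ∧ q.2 ≤ 0)}

theorem exists_externalCollar_chart {b : E → P}
    (φ : OpenPartialHomeomorph (E × Ici (0 : ℝ)) P)
    (h0 : ∀ y, (y, ⟨0, self_mem_Ici⟩) ∈ φ.source → φ (y, ⟨0, self_mem_Ici⟩) = b y)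
    (hr : ∀ x ∈ φ.source, (φ x ∈ range b ↔ x.2.1 = 0)) :
    ∃ Φ : OpenPartialHomeomorph (E × ℝ) (ExternalCollar b),
      (∀ y s, (y, s) ∈ Φ.source ↔ (y, (⟨max s 0, mem_Ici.2 (le_max_right _ _)⟩ : Ici (0 : ℝ))) ∈ φ.source) ∧
      (∀ y s, s ≤ 0 → (Φ (y, s)).1 = (b y, s)) ∧ ∀ y s, (y, s) ∈ Φ.source → 0 < s →
        (Φ (y, s)).1.1 ∉ range b := by
  classical
  let F : E × ℝ → ExternalCollar b := fun x =>
    ⟨(if x.2 ≤ 0 then b x.1 else φ (x.1, ⟨max x.2 0, mem_Ici.2 (le_max_right _ _)⟩), min x.2 0), by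
      by_cases h : x.2 ≤ 0
      · right; simp [h]
      · left; simpa using (not_le.1 h).le⟩
  have hF : ∀ x : E × ℝ, (x.1, (⟨max x.2 0, mem_Ici.2 (le_max_right _ _)⟩ : Ici (0 : ℝ))) ∈ φ.source →
      (F x).1 = (φ (x.1, ⟨max x.2 0, mem_Ici.2 (le_max_right _ _)⟩), min x.2 0) := by
    intro x hx
    by_cases h : x.2 ≤ 0
    · have e1 : (⟨max x.2 0, mem_Ici.2 (le_max_right _ _)⟩ : Ici (0 : ℝ)) = ⟨0, self_mem_Ici⟩ := by simp [h]
      rw [e1] at hx ⊢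
      simp only [F, h, if_true, h0 _ hx]
    · simp only [F, h, if_false]
  have hcases : ∀ q : ExternalCollar b, q.1.1 ∈ φ.target →
      q.1.2 = 0 ∨ (q.1.2 < 0 ∧ (φ.symm q.1.1).2 = ⟨0, self_mem_Ici⟩ ∧ b (φ.symm q.1.1).1 = q.1.1) := by
    intro q hq
    rcases q.2 with h | ⟨h1, h2⟩
    · exact Or.inl h
    · rcases h2.eq_or_lt with h | h
      · exact Or.inl h
      · refine Or.inr ⟨h, ?_⟩
        have h3 : (φ.symm q.1.1).2 = ⟨0, self_mem_Ici⟩ := by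
          apply Subtype.ext
          rw [← φ.right_inv hq, hr _ (φ.map_target hq)] at h1
          exact h1
        refine ⟨h3, ?_⟩
        rw [← h0, ← h3]
        · exact φ.right_inv hq
        · rw [← h3]; exact φ.map_target hq
  have hcφ : ContinuousOn (fun x : E × ℝ => (x.1, (⟨max x.2 0, mem_Ici.2 (le_max_right _ _)⟩ : Ici (0 : ℝ))))
      univ := Continuous.continuousOn (by fun_prop)
  have hsrc : IsOpen {x : E × ℝ | (x.1, (⟨max x.2 0, mem_Ici.2 (le_max_right _ _)⟩ : Ici (0 : ℝ))) ∈ φ.source} :=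
    φ.open_source.preimage (by fun_prop)
  have hq1 : Continuous fun q : ExternalCollar b => q.1.1 := by fun_prop
  refine ⟨{ toFun := F
            invFun := fun q => ((φ.symm q.1.1).1, (φ.symm q.1.1).2.1 + q.1.2)
            source := {x | (x.1, (⟨max x.2 0, mem_Ici.2 (le_max_right _ _)⟩ : Ici (0 : ℝ))) ∈ φ.source}
            target := {q | q.1.1 ∈ φ.target}
            map_source' := ?_, map_target' := ?_, left_inv' := ?_, right_inv' := ?_
            open_source := hsrc, open_target := φ.open_target.preimage hq1
            continuousOn_toFun := ?_
            continuousOn_invFun := ?_ }, fun y s => Iff.rfl, ?_, ?_⟩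
  · intro x hx
    change (F x).1.1 ∈ φ.target
    rw [hF x hx]; exact φ.map_source hx
  · intro q hq
    change (_, (⟨max _ 0, _⟩ : Ici (0 : ℝ))) ∈ φ.source
    have key : (⟨max ((φ.symm q.1.1).2.1 + q.1.2) 0, mem_Ici.2 (le_max_right _ _)⟩ : Ici (0 : ℝ))
        = (φ.symm q.1.1).2 := by
      apply Subtype.ext
      rcases hcases q hq with h | ⟨h, h2, -⟩
      · simp only [h, add_zero]; exact max_eq_left (φ.symm q.1.1).2.2
      · simp only [h2, zero_add]; exact max_eq_right h.le
    simp only [key]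
    exact φ.map_target hq
  · intro x hx
    have h1 : φ.symm (F x).1.1 = (x.1, ⟨max x.2 0, mem_Ici.2 (le_max_right _ _)⟩) := by
      rw [hF x hx]; exact φ.left_inv hx
    change ((φ.symm (F x).1.1).1, (φ.symm (F x).1.1).2.1 + (F x).1.2) = x
    rw [h1]
    exact Prod.ext rfl (max_add_min x.2 0 |>.trans (add_zero _))
  · intro q hq
    apply Subtype.ext
    rcases hcases q hq with h | ⟨h, h2, h3⟩
    · have hs := (φ.symm q.1.1).2.2
      have e1 : (⟨max ((φ.symm q.1.1).2.1 + q.1.2) 0, mem_Ici.2 (le_max_right _ _)⟩ : Ici (0 : ℝ))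
        = (φ.symm q.1.1).2 := by
        apply Subtype.ext
        simp only [h, add_zero]; exact max_eq_left (φ.symm q.1.1).2.2
      rw [hF]
      · simp only [e1]
        refine Prod.ext (φ.right_inv hq) ?_
        simp only [h, add_zero]; exact min_eq_right hs
      · simp only [e1]; exact φ.map_target hq
    · simp only [F, h2, zero_add, h.le, if_true, h3]
      exact Prod.ext rfl (min_eq_left h.le)
  · refine (IsInducing.continuousOn_iff (g := Subtype.val) ⟨rfl⟩).2 ?_
    refine ContinuousOn.congr ?_ fun x hx => hF x hx
    refine ContinuousOn.prodMk (φ.continuousOn.comp (hcφ.mono (subset_univ _)) fun x hx => hx)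
      (by fun_prop)
  · have h1 := φ.symm.continuousOn.comp hq1.continuousOn (s := {q : ExternalCollar b |
      q.1.1 ∈ φ.target}) fun x hx => hx
    have h2 : Continuous fun x : E × Ici (0 : ℝ) => x.1 := continuous_fst
    have h3 : Continuous fun x : E × Ici (0 : ℝ) => x.2.1 := by fun_prop
    exact (h2.comp_continuousOn h1).prodMk ((h3.comp_continuousOn h1).add (by fun_prop))
  · intro y s hs
    change (F (y, s)).1 = _
    simp [F, hs]
  · intro y s hx hs
    change (F (y, s)).1.1 ∉ _
    rw [hF _ hx, hr _ hx]
    simpa using hs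

end Collar

section CollarHeight
variable {E P : Type*} [TopologicalSpace P]

/-- `f` is a collar height if the external collar of height `f` can be absorbed into `P`. -/
def IsCollarHeight [TopologicalSpace E] (b : E → P) (f : E → ℝ) : Prop :=
  Continuous f ∧ (∀ y, 0 ≤ f y) ∧ (∃ M, ∀ y, f y ≤ M) ∧
    ∃ G : ExternalCollar b ≃ₜ ExternalCollar b,
      (∀ q, (∀ y, (G q).1.1 = b y → -f y ≤ (G q).1.2) ↔ q.1.2 = 0) ∧
      ∀ y, (G ⟨(b y, 0), Or.inl rfl⟩).1 = (b y, -f y)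

theorem IsCollarHeight.zero [TopologicalSpace E] (b : E → P) : IsCollarHeight b fun _ => 0 := by
  refine ⟨continuous_const, fun y => le_rfl, ⟨0, fun y => le_rfl⟩, Homeomorph.refl _,
    fun q => ⟨fun h => ?_, fun h y _ => ?_⟩, fun y => by simp⟩
  · rcases q.2 with h1 | ⟨⟨y, hy⟩, h2⟩
    · exact h1
    · have := h y hy.symm
      exact le_antisymm h2 (by simpa using this)
  · exact (neg_zero.trans h.symm).le

theorem IsCollarHeight.add [TopologicalSpace E] [T2Space P] {b : E → P} (hb : IsEmbedding b)
    (φ : OpenPartialHomeomorph (E × Ici (0 : ℝ)) P)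
    (h0 : ∀ y, (y, ⟨0, self_mem_Ici⟩) ∈ φ.source → φ (y, ⟨0, self_mem_Ici⟩) = b y)
    (hr : ∀ x ∈ φ.source, (φ x ∈ range b ↔ x.2.1 = 0)) {f k : E → ℝ} (hf : IsCollarHeight b f)
    (hk : Continuous k) (hk0 : ∀ y, 0 ≤ k y) {N : ℝ} (hkN : ∀ y, k y ≤ N) {K : Set E}
    (hK : IsCompact K) (hkK : ∀ y, y ∉ K → k y = 0) {η : ℝ} (hη : 0 < η)
    (hKη : ∀ x : E × Ici (0 : ℝ), x.1 ∈ K → x.2.1 ≤ η → x ∈ φ.source) [T2Space E] :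
    IsCollarHeight b fun y => f y + k y := by
  obtain ⟨hfc, hf0, ⟨M, hM⟩, G, hG, hGb⟩ := hf
  refine ⟨hfc.add hk, fun y => add_nonneg (hf0 y) (hk0 y), ⟨M + N, fun y => add_le_add (hM y)
    (hkN y)⟩, ?_⟩
  obtain ⟨Φ, hsrc, hle, hgt⟩ := exists_externalCollar_chart φ h0 hr
  set a : ℝ := -(M + N) - 1
  have b1 : ∀ y, a < -f y := fun y => by linarith [hM y, hkN y, hk0 y]
  have b2 : ∀ y, -f y < η := fun y => by linarith [hf0 y]
  have b1' : ∀ y, a < -(f y + k y) := fun y => by linarith [hM y, hkN y]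
  have b2' : ∀ y, -(f y + k y) < η := fun y => by linarith [hf0 y, hk0 y]
  let g := plHomeomorph a η hfc.neg (hfc.add hk).neg b1 b2 b1' b2'
  have hgx : ∀ y s, g (y, s) = (y, plMap a (-f y) (-(f y + k y)) η s) := fun y s => rfl
  have hgQ : ∀ x, x ∉ K ×ˢ Icc a η → g x = x := by
    rintro ⟨y, s⟩ hx
    rw [hgx]
    by_cases hy : y ∈ K
    · have : ¬ (a ≤ s ∧ s ≤ η) := fun h => hx ⟨hy, h⟩
      rcases le_or_gt s a with h | h
      · rw [plMap_of_le h]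
      · rw [plMap_of_ge (b1 y) (b2 y) (not_le.1 fun h' => this ⟨h.le, h'⟩).le]
    · rw [hkK y hy, add_zero, plMap_eq_self (b1 y) (b2 y)]
  have hQs : K ×ˢ Icc a η ⊆ Φ.source := by
    rintro ⟨y, s⟩ ⟨h1, h2⟩
    rw [hsrc]
    exact hKη _ h1 (max_le h2.2 hη.le)
  have hQc : IsCompact (K ×ˢ Icc a η) := hK.prod isCompact_Icc
  let T := Φ.extendHomeomorph hQs hQc g hgQ
  have hT : ∀ x ∈ Φ.source, T (Φ x) = Φ (g x) := fun x hx => Φ.extendMap_apply hgQ hx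
  have hT' : ∀ q, q ∉ Φ '' (K ×ˢ Icc a η) → T q = q := fun q hq => Φ.extendMap_of_notMem hq
  have hR : ∀ h : E → ℝ, (∀ y, 0 ≤ h y) → ∀ x ∈ Φ.source,
      ((∀ y, (Φ x).1.1 = b y → -h y ≤ (Φ x).1.2) ↔ -h x.1 ≤ x.2) := by
    rintro h hh ⟨y, s⟩ hx
    rcases le_or_gt s 0 with hs | hs
    · rw [hle _ _ hs]
      refine ⟨fun H => H y rfl, fun H y' hy' => ?_⟩
      rw [← hb.injective hy']; exact H
    · refine ⟨fun _ => ?_, fun _ y' hy' => ?_⟩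
      · change -h y ≤ s
        linarith [hh y]
      · exact (hgt _ _ hx hs ⟨y', hy'.symm⟩).elim
  have hqΦ : ∀ (q : ExternalCollar b) y, q.1.1 = b y → q = Φ (y, q.1.2) := fun q y hy => by
    have h2 : q.1.2 ≤ 0 := by
      rcases q.2 with h | h
      · exact h.le
      · exact h.2
    apply Subtype.ext
    rw [hle _ _ h2]
    exact Prod.ext hy rfl
  refine ⟨G.trans T, fun q => ?_, fun y => ?_⟩
  · rw [← hG q, Homeomorph.trans_apply]
    generalize G q = q
    by_cases hq : q ∈ Φ '' (K ×ˢ Icc a η)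
    · obtain ⟨x, hxQ, rfl⟩ := hq
      rw [hT x (hQs hxQ), hR _ (fun y => add_nonneg (hf0 y) (hk0 y)) _
        (hQs (g.mapsTo_of_support hgQ hxQ)), hR f hf0 x (hQs hxQ)]
      obtain ⟨y, s⟩ := x
      rw [hgx]
      have := plMap_le_iff (b1 y) (b2 y) (b1' y) (b2' y) (s := -f y) (t := s)
      rwa [plMap_self (b1 y)] at this
    · rw [hT' q hq]
      refine forall_congr' fun y => imp_congr_right fun hy => ?_
      by_cases hyK : y ∈ K
      · have h2 : q.1.2 ≤ 0 := by
          rcases q.2 with h | h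
          · exact h.le
          · exact h.2
        have : ¬ a ≤ q.1.2 := fun h => hq ⟨(y, q.1.2), ⟨hyK, h, h2.trans hη.le⟩, (hqΦ q y hy).symm⟩
        constructor
        · intro h; linarith [b1' y]
        · intro h; linarith [b1 y]
      · simp only [hkK y hyK, add_zero]
  · rw [Homeomorph.trans_apply]
    have h1 := hGb y
    generalize G ⟨(b y, 0), Or.inl rfl⟩ = q at h1 ⊢
    have h2 := hqΦ q y (by rw [h1])
    rw [h1] at h2
    change q = Φ (y, -f y) at h2
    by_cases hyK : y ∈ K
    · rw [h2, hT _ (hQs ⟨hyK, (b1 y).le, (b2 y).le⟩), hgx, plMap_self (b1 y), hle]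
      linarith [hf0 y, hk0 y]
    · rw [hT' q, h1]
      · simp only [hkK y hyK, add_zero]
      rintro ⟨⟨y', s'⟩, hx, hxq⟩
      rcases le_or_gt s' 0 with hs | hs
      · have := hle y' s' hs
        rw [hxq, h1] at this
        exact hyK (hb.injective (Prod.ext_iff.1 this).1 ▸ hx.1)
      · have := hgt y' s' (hQs hx) hs
        rw [hxq, h1] at this
        exact this ⟨y, rfl⟩

theorem exists_isCollarHeight [MetricSpace E] [ProperSpace E] [T2Space P] {b : E → P}
    (hb : IsEmbedding b)
    (hD : ∀ p ∈ range b, ∃ e : OpenPartialHomeomorph P (E × Ici (0 : ℝ)), p ∈ e.source ∧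
      ∀ q ∈ e.source, (q ∈ range b ↔ (e q).2.1 = 0)) {A : Set E} (hA : IsCompact A) :
    ∃ f, IsCollarHeight b f ∧ ∀ y ∈ A, 0 < f y := by
  suffices H : ∀ f, IsCollarHeight b f → ∃ f', IsCollarHeight b f' ∧ f ≤ f' ∧ ∀ y ∈ A, 0 < f' y by
    obtain ⟨f, h1, -, h2⟩ := H _ (IsCollarHeight.zero b)
    exact ⟨f, h1, h2⟩
  refine hA.induction_on (p := fun A => ∀ f, IsCollarHeight b f → ∃ f', IsCollarHeight b f' ∧
    f ≤ f' ∧ ∀ y ∈ A, 0 < f' y) ?_ ?_ ?_ ?_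
  · exact fun f hf => ⟨f, hf, le_rfl, by simp⟩
  · intro s t hst ht f hf
    obtain ⟨f', h1, h2, h3⟩ := ht f hf
    exact ⟨f', h1, h2, fun y hy => h3 y (hst hy)⟩
  · intro s t hs ht f hf
    obtain ⟨f₁, h1, h2, h3⟩ := hs f hf
    obtain ⟨f₂, h4, h5, h6⟩ := ht f₁ h1
    exact ⟨f₂, h4, h2.trans h5, fun y hy => hy.elim (fun h => (h3 y h).trans_le (h5 y)) (h6 y)⟩
  · intro y₀ _
    obtain ⟨e, he1, he2⟩ := hD (b y₀) (mem_range_self y₀)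
    obtain ⟨φ, hφ0, hφb, hφr⟩ := exists_aligned_collar hb e he2 y₀ he1
    obtain ⟨ε, hε, hball⟩ := Metric.isOpen_iff.1 φ.open_source _ hφ0
    refine ⟨ball y₀ (ε / 2), mem_nhdsWithin_of_mem_nhds (ball_mem_nhds _ (by linarith)),
      fun f hf => ⟨fun y => f y + max 0 (ε / 2 - dist y y₀), ?_, fun y => ?_, fun y hy => ?_⟩⟩
    · refine hf.add hb φ hφb hφr (by fun_prop) (fun y => le_max_left _ _) (N := ε / 2)
        (fun y => max_le (by linarith) (by linarith [dist_nonneg (x := y) (y := y₀)]))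
        (isCompact_closedBall y₀ (ε / 2)) (fun y hy => max_eq_left ?_) (η := ε / 2) (by linarith)
        fun x hx1 hx2 => hball ?_
      · rw [mem_closedBall, not_le] at hy; linarith
      · rw [mem_ball, Prod.dist_eq, max_lt_iff]
        rw [mem_closedBall] at hx1
        refine ⟨by linarith, ?_⟩
        rw [Subtype.dist_eq, Real.dist_eq, sub_zero, abs_of_nonneg x.2.2]
        linarith
    · exact le_add_of_nonneg_right (le_max_left _ _)
    · rw [mem_ball] at hy
      exact add_pos_of_nonneg_of_pos (hf.2.1 y) (lt_max_of_lt_right (by linarith))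

end CollarHeight

/-- Every compact part of the boundary lies in a half-space patch. -/
theorem exists_halfSpace_patch {E P : Type*} [NormedAddCommGroup E] [InnerProductSpace ℝ E]
    [FiniteDimensional ℝ E] [TopologicalSpace P] [T2Space P] {b : E → P} (hb : IsEmbedding b)
    (hD : ∀ p ∈ range b, ∃ e : OpenPartialHomeomorph P (E × Ici (0 : ℝ)), p ∈ e.source ∧
      ∀ q ∈ e.source, (q ∈ range b ↔ (e q).2.1 = 0)) {A : Set E} (hA : IsCompact A) :
    ∃ φ : E × Ici (0 : ℝ) → P, IsOpenEmbedding φ ∧ (∀ x, φ x ∈ range b ↔ x.2.1 = 0) ∧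
      b '' A ⊆ range φ := by
  have : ProperSpace E := FiniteDimensional.proper ℝ E
  obtain ⟨r, hr0, hAr⟩ := hA.isBounded.subset_ball_lt 0 0
  obtain ⟨f, ⟨hfc, -, -, G, hG, hGb⟩, hfpos⟩ := exists_isCollarHeight hb hD
    (isCompact_closedBall (0 : E) r)
  let β := OpenPartialHomeomorph.univBall (0 : E) r
  have hβ : ∀ y, β y ∈ ball (0 : E) r := fun y => by
    have := β.map_source (x := y) (by simp [β])
    rwa [OpenPartialHomeomorph.univBall_target _ hr0] at this
  have hβf : ∀ y, 0 < f (β y) := fun y => hfpos _ (ball_subset_closedBall (hβ y))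
  have hβc : Continuous β := OpenPartialHomeomorph.continuous_univBall _ _
  have hβsymm : ∀ y, β.symm (β y) = y := fun y => β.left_inv (by simp [β])
  have hβsymm' : ∀ z ∈ ball (0 : E) r, β (β.symm z) = z := fun z hz => β.right_inv (by
    rwa [OpenPartialHomeomorph.univBall_target _ hr0])
  have hinv : ∀ y, Function.invFun b (b y) = y := Function.leftInverse_invFun hb.injective
  have hden : ∀ s : Ici (0 : ℝ), 0 < 1 + s.1 := fun s => by linarith [mem_Ici.1 s.2]
  let ψ : E × Ici (0 : ℝ) → ExternalCollar b := fun x =>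
    ⟨(b (β x.1), -f (β x.1) / (1 + x.2.1)), Or.inr ⟨mem_range_self _, by
      have := hβf x.1
      have := hden x.2
      rw [neg_div, neg_nonpos]; positivity⟩⟩
  have hψneg : ∀ x, (ψ x).1.2 < 0 := fun x => by
    have := hβf x.1
    have := hden x.2
    change -f (β x.1) / (1 + x.2.1) < 0
    rw [neg_div, neg_lt_zero]; positivity
  have hψc : Continuous ψ := by
    refine Continuous.subtype_mk (Continuous.prodMk (hb.continuous.comp (hβc.comp continuous_fst))
      (Continuous.div (hfc.comp (hβc.comp continuous_fst)).neg (by fun_prop)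
        fun x => (hden x.2).ne')) _
  have hψR : ∀ x, (G.symm (ψ x)).1.2 = 0 := fun x => by
    rw [← hG, G.apply_symm_apply]
    intro y hy
    have hy' : β x.1 = y := hb.injective hy
    subst hy'
    change -f (β x.1) ≤ -f (β x.1) / (1 + x.2.1)
    rw [le_div_iff₀ (hden _)]
    nlinarith [hβf x.1, mem_Ici.1 x.2.2]
  let inc : P → ExternalCollar b := fun p => ⟨(p, 0), Or.inl rfl⟩
  have hinc : Continuous inc := by fun_prop
  let z : P → E := fun p => Function.invFun b (G (inc p)).1.1
  have hGincψ : ∀ x, G (inc (G.symm (ψ x)).1.1) = ψ x := fun x => by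
    have : inc (G.symm (ψ x)).1.1 = G.symm (ψ x) := Subtype.ext (Prod.ext rfl (hψR x).symm)
    rw [this, G.apply_symm_apply]
  have hneg : ∀ q : ExternalCollar b, q.1.2 < 0 → q.1.1 ∈ range b := fun q hq =>
    q.2.elim (fun h => absurd h hq.ne) fun h => h.1
  have hbz : ∀ p, (G (inc p)).1.2 < 0 → (G (inc p)).1.1 = b (z p) := fun p hp => by
    obtain ⟨y, hy⟩ := hneg _ hp
    simp only [z, ← hy, hinv]
  have hs : ∀ p, (G (inc p)).1.2 < 0 → -f (z p) ≤ (G (inc p)).1.2 := fun p hp =>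
    (hG (inc p)).2 rfl _ (hbz p hp)
  have hzc : ContinuousOn z {p | (G (inc p)).1.2 < 0} :=
    hb.continuousOn_invFun.comp (f := fun p => (G (inc p)).1.1)
      (Continuous.continuousOn (by fun_prop)) fun p hp => hneg _ hp
  have hopen : IsOpen {p | (G (inc p)).1.2 < 0} := isOpen_lt (by fun_prop) continuous_const
  let θ : OpenPartialHomeomorph (E × Ici (0 : ℝ)) P :=
    { toFun := fun x => (G.symm (ψ x)).1.1
      invFun := fun p => (β.symm (z p), ⟨max (-f (z p) / (G (inc p)).1.2 - 1) 0,
        mem_Ici.2 (le_max_right _ _)⟩)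
      source := univ
      target := {p | (G (inc p)).1.2 < 0} ∩ z ⁻¹' ball 0 r
      map_source' := fun x _ => by
        refine ⟨?_, ?_⟩
        · rw [mem_ofPred, hGincψ]; exact hψneg x
        · simp only [mem_preimage, z, hGincψ]
          change Function.invFun b (b (β x.1)) ∈ _
          rw [hinv]; exact hβ _
      map_target' := fun _ _ => mem_univ _
      left_inv' := fun x _ => by
        have h1 : z (G.symm (ψ x)).1.1 = β x.1 := by
          simp only [z, hGincψ]; exact hinv _
        simp only [h1, hβsymm, hGincψ]
        refine Prod.ext rfl (Subtype.ext ?_)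
        change max (-f (β x.1) / (-f (β x.1) / (1 + x.2.1)) - 1) 0 = x.2.1
        have h2 := hβf x.1
        have h3 := hden x.2
        have : -f (β x.1) / (-f (β x.1) / (1 + x.2.1)) - 1 = x.2.1 := by
          field_simp; ring
        rw [this]; exact max_eq_left x.2.2
      right_inv' := fun p hp => by
        obtain ⟨hp1, hp2⟩ := hp
        have h1 : ψ (β.symm (z p), ⟨max (-f (z p) / (G (inc p)).1.2 - 1) 0,
            mem_Ici.2 (le_max_right _ _)⟩) = G (inc p) := by
          apply Subtype.ext
          refine Prod.ext ?_ ?_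
          · change b (β (β.symm (z p))) = _
            rw [hβsymm' _ hp2, hbz p hp1]
          · change -f (β (β.symm (z p))) / (1 + max (-f (z p) / (G (inc p)).1.2 - 1) 0) = _
            rw [hβsymm' _ hp2]
            have h2 : 0 < f (z p) := hfpos _ (ball_subset_closedBall hp2)
            have h3 := hs p hp1
            rw [mem_ofPred] at hp1
            rw [max_eq_left]
            · have : (G (inc p)).1.2 ≠ 0 := hp1.ne
              field_simp
              ring_nf
              field_simp
            · rw [sub_nonneg, le_div_iff_of_neg hp1]; linarith
        simp only [h1, G.symm_apply_apply]; rfl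
      open_source := isOpen_univ
      open_target := hzc.isOpen_inter_preimage hopen isOpen_ball
      continuousOn_toFun := Continuous.continuousOn (by fun_prop)
      continuousOn_invFun := by
        refine ContinuousOn.prodMk ?_ ?_
        · have := β.symm.continuousOn
          rw [OpenPartialHomeomorph.symm_source, OpenPartialHomeomorph.univBall_target _ hr0] at this
          exact this.comp (hzc.mono inter_subset_left) fun p hp => hp.2
        · refine (IsInducing.continuousOn_iff (g := Subtype.val) ⟨rfl⟩).2 ?_
          refine ContinuousOn.sup (ContinuousOn.sub (ContinuousOn.div ?_ ?_ ?_) continuousOn_const)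
            continuousOn_const
          · exact (hfc.comp_continuousOn (hzc.mono inter_subset_left)).neg
          · exact Continuous.continuousOn (by fun_prop)
          · exact fun p hp => ne_of_lt hp.1 }
  refine ⟨θ, θ.isOpenEmbedding rfl, fun x => ⟨?_, fun hx => ?_⟩, ?_⟩
  · rintro ⟨y, hy⟩
    have h1 : inc (b y) = G.symm (ψ x) := Subtype.ext (Prod.ext hy (hψR x).symm)
    have h2 : (ψ x).1 = (b y, -f y) := by
      rw [← hGb y]; change _ = (G (inc (b y))).1
      rw [h1, G.apply_symm_apply]
    have h3 : β x.1 = y := hb.injective (Prod.ext_iff.1 h2).1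
    have h4 : -f (β x.1) / (1 + x.2.1) = -f y := (Prod.ext_iff.1 h2).2
    rw [← h3, div_eq_iff (hden _).ne'] at h4
    have := hβf x.1
    nlinarith
  · refine ⟨β x.1, ?_⟩
    change _ = (G.symm (ψ x)).1.1
    have : ψ x = G (inc (b (β x.1))) := by
      apply Subtype.ext
      change _ = (G ⟨(b (β x.1), 0), Or.inl rfl⟩).1
      rw [hGb]
      refine Prod.ext rfl ?_
      change -f (β x.1) / (1 + x.2.1) = _
      rw [hx, add_zero, div_one]
    rw [this, G.symm_apply_apply]
  · rintro _ ⟨y, hy, rfl⟩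
    refine ⟨(β.symm y, ⟨0, self_mem_Ici⟩), ?_⟩
    change (G.symm (ψ _)).1.1 = _
    have : ψ (β.symm y, ⟨0, self_mem_Ici⟩) = G (inc (b y)) := by
      apply Subtype.ext
      change _ = (G ⟨(b y, 0), Or.inl rfl⟩).1
      rw [hGb]
      change (b (β (β.symm y)), -f (β (β.symm y)) / (1 + 0)) = _
      rw [hβsymm' _ (hAr hy), add_zero, div_one]
    rw [this, G.symm_apply_apply]

section HalfSpace
variable {E : Type*} [NormedAddCommGroup E]

/-- The sup norm on the half-space `E × [0, ∞)`. -/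
def halfNorm (x : E × Ici (0 : ℝ)) : ℝ := ‖(x.1, x.2.1)‖

theorem halfNorm_def (x : E × Ici (0 : ℝ)) : halfNorm x = ‖(x.1, x.2.1)‖ := rfl

@[fun_prop]
theorem continuous_halfNorm : Continuous (halfNorm : E × Ici (0 : ℝ) → ℝ) := by
  unfold halfNorm; fun_prop

theorem isClosedEmbedding_halfSpace :
    IsClosedEmbedding fun x : E × Ici (0 : ℝ) => (x.1, x.2.1) :=
  IsClosedEmbedding.id.prodMap isClosed_Ici.isClosedEmbedding_subtypeVal

variable [NormedSpace ℝ E]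

theorem isCompact_halfNorm_le [FiniteDimensional ℝ E] (r : ℝ) :
    IsCompact {x : E × Ici (0 : ℝ) | halfNorm x ≤ r} := by
  have : ProperSpace (E × ℝ) := FiniteDimensional.proper ℝ _
  have := isClosedEmbedding_halfSpace.isCompact_preimage (isCompact_closedBall (0 : E × ℝ) r)
  convert this using 1
  ext x; simp [halfNorm]

/-- A half-space version of the rescaling by a piecewise linear function. -/
theorem exists_halfSpace_radial {a b b' c : ℝ} (ha : 0 ≤ a) (hab : a < b) (hbc : b < c)
    (hab' : a < b') (hbc' : b' < c) :
    ∃ g : E × Ici (0 : ℝ) ≃ₜ E × Ici (0 : ℝ), (∀ x, halfNorm x ≤ a → g x = x) ∧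
      (∀ x, c ≤ halfNorm x → g x = x) ∧ ∀ x, halfNorm (g x) ≤ b' ↔ halfNorm x ≤ b := by
  have hnn : ∀ {b b' : ℝ}, a < b → b < c → a < b' → b' < c → ∀ t, 0 ≤ t →
      0 ≤ plMap a b b' c t := by
    intro b b' h1 h2 h3 h4 t ht
    have := plMap_mono h1 h2 h3 h4 ht
    rwa [plMap_of_le ha] at this
  have h0 : ∀ b b' : ℝ, plMap a b b' c 0 = 0 := fun b b' => plMap_of_le ha
  let G : (b b' : ℝ) → (a < b ∧ b < c ∧ a < b' ∧ b' < c) → E × Ici (0 : ℝ) → E × Ici (0 : ℝ) :=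
    fun b b' h x => ((radialMap (plMap a b b' c) (x.1, x.2.1)).1,
      ⟨(radialMap (plMap a b b' c) (x.1, x.2.1)).2, mul_nonneg (div_nonneg
        (hnn h.1 h.2.1 h.2.2.1 h.2.2.2 _ (norm_nonneg _)) (norm_nonneg _)) x.2.2⟩)
  have hG : ∀ b b' h x, ((G b b' h x).1, (G b b' h x).2.1) =
      radialMap (plMap a b b' c) (x.1, x.2.1) := fun b b' h x => rfl
  have hinv : ∀ b b' h h' x, G b' b h' (G b b' h x) = x := by
    intro b b' h h' x
    apply isClosedEmbedding_halfSpace.injective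
    simp only [hG]
    exact radialMap_radialMap (h0 _ _) (h0 _ _) (hnn h.1 h.2.1 h.2.2.1 h.2.2.2)
      (fun t _ => plMap_inv h.1 h.2.1 h.2.2.1 h.2.2.2 t) _
  have hcont : ∀ b b' h, Continuous (G b b' h) := by
    intro b b' h
    rw [isClosedEmbedding_halfSpace.isEmbedding.isInducing.continuous_iff]
    have h1 := continuous_radialMap (V := E × ℝ) (S := Unit) (θ := fun _ => plMap a b b' c)
      (continuous_plMap (β := fun _ => b) (β' := fun _ => b') continuous_const continuous_const
        (fun _ => h.1) fun _ => h.2.1) fun _ => h0 _ _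
    exact h1.comp ((continuous_const (y := ())).prodMk isClosedEmbedding_halfSpace.continuous)
  have hN : ∀ b b' h x, halfNorm (G b b' h x) = plMap a b b' c (halfNorm x) := by
    intro b b' h x
    rw [halfNorm_def, hG b b' h x, norm_radialMap (h0 _ _), halfNorm_def]
    exact hnn h.1 h.2.1 h.2.2.1 h.2.2.2 _ (norm_nonneg _)
  have h1 : a < b ∧ b < c ∧ a < b' ∧ b' < c := ⟨hab, hbc, hab', hbc'⟩
  have h2 : a < b' ∧ b' < c ∧ a < b ∧ b < c := ⟨hab', hbc', hab, hbc⟩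
  refine ⟨⟨⟨G b b' h1, G b' b h2, hinv _ _ h1 h2, hinv _ _ h2 h1⟩, hcont _ _ h1,
    hcont _ _ h2⟩,
    fun x hx => ?_, fun x hx => ?_, fun x => ?_⟩
  · apply isClosedEmbedding_halfSpace.injective
    change ((G b b' h1 x).1, (G b b' h1 x).2.1) = _
    rw [hG b b' h1 x, radialMap_of_eq (plMap_of_le hx)]
  · apply isClosedEmbedding_halfSpace.injective
    change ((G b b' h1 x).1, (G b b' h1 x).2.1) = _
    rw [hG b b' h1 x, radialMap_of_eq (plMap_of_ge hab hbc hx)]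
  · change halfNorm (G b b' h1 x) ≤ b' ↔ _
    rw [hN b b' h1 x]
    have := plMap_le_iff hab hbc hab' hbc' (s := halfNorm x) (t := b)
    rwa [plMap_self hab] at this

theorem exists_halfNorm_lt_subset [FiniteDimensional ℝ E] {U : Set (E × Ici (0 : ℝ))}
    (hU : IsOpen U) (h0 : ((0 : E), (⟨0, self_mem_Ici⟩ : Ici (0 : ℝ))) ∈ U) :
    ∃ ε > 0, ∀ x, halfNorm x ≤ ε → x ∈ U := by
  obtain ⟨ε, hε, h⟩ := Metric.isOpen_iff.1 hU _ h0
  refine ⟨ε / 2, by linarith, fun x hx => h ?_⟩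
  rw [halfNorm_def, Prod.norm_def, max_le_iff, Real.norm_eq_abs] at hx
  rw [mem_ball, Prod.dist_eq, max_lt_iff, dist_zero_right, Subtype.dist_eq, Real.dist_eq, sub_zero]
  exact ⟨by linarith [hx.1], by linarith [hx.2]⟩

variable [FiniteDimensional ℝ E] {P : Type*} [TopologicalSpace P] [T2Space P]

theorem exists_patch_step {D : Set P}
    (hcov : ∀ K : Set P, IsCompact K → ∃ φ : E × Ici (0 : ℝ) → P, IsOpenEmbedding φ ∧
      (∀ x, φ x ∈ D ↔ x.2.1 = 0) ∧ K ⊆ range φ)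
    {φ : E × Ici (0 : ℝ) → P} (hφ : IsOpenEmbedding φ) (hφ0 : φ (0, ⟨0, self_mem_Ici⟩) ∈ D)
    {R : ℝ} (hR : 0 < R) {K : Set P} (hK : IsCompact K) :
    ∃ φ' : E × Ici (0 : ℝ) → P, IsOpenEmbedding φ' ∧ (∀ x, halfNorm x ≤ R → φ' x = φ x) ∧
      K ⊆ image φ' {x | halfNorm x ≤ R + 1} := by
  obtain ⟨ψ₀, hψ₀, hψD, hψK⟩ := hcov (K ∪ φ '' {x | halfNorm x ≤ R + 1})
    (hK.union ((isCompact_halfNorm_le _).image hφ.continuous))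
  have hmem0 : halfNorm ((0 : E), (⟨0, self_mem_Ici⟩ : Ici (0 : ℝ))) = 0 := by simp [halfNorm]
  obtain ⟨⟨y₀, s₀⟩, hy₀⟩ : φ (0, ⟨0, self_mem_Ici⟩) ∈ range ψ₀ :=
    hψK (Or.inr ⟨_, by rw [mem_ofPred, hmem0]; linarith, rfl⟩)
  have hs₀ : s₀ = ⟨0, self_mem_Ici⟩ := by
    apply Subtype.ext
    rw [← hy₀, hψD] at hφ0; exact hφ0
  subst hs₀
  let tr : E × Ici (0 : ℝ) ≃ₜ E × Ici (0 : ℝ) :=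
    (Homeomorph.addLeft y₀).prodCongr (Homeomorph.refl _)
  let ψ := ψ₀ ∘ tr
  have hψ : IsOpenEmbedding ψ := hψ₀.comp tr.isOpenEmbedding
  have hψr : range ψ = range ψ₀ := by
    simp only [ψ]; rw [tr.surjective.range_comp]
  have hψ0 : ψ (0, ⟨0, self_mem_Ici⟩) = φ (0, ⟨0, self_mem_Ici⟩) := by
    rw [← hy₀]; simp [ψ, tr]
  rw [← hψr] at hψK
  obtain ⟨ε, hε, hεφ⟩ := exists_halfNorm_lt_subset (U := ψ ⁻¹' (φ '' {x | halfNorm x < R + 1}))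
    ((hφ.isOpenMap _ (isOpen_lt (by fun_prop) continuous_const)).preimage hψ.continuous)
    ⟨_, by rw [mem_ofPred, hmem0]; linarith, hψ0.symm⟩
  obtain ⟨η₀, hη₀, hηψ⟩ := exists_halfNorm_lt_subset (U := φ ⁻¹' (ψ '' {x | halfNorm x < ε / 2}))
    ((hψ.isOpenMap _ (isOpen_lt (by fun_prop) continuous_const)).preimage hφ.continuous)
    ⟨_, by rw [mem_ofPred, hmem0]; linarith, hψ0⟩
  obtain ⟨η, hη, hηη₀, hηR⟩ : ∃ η > 0, η ≤ η₀ ∧ η < R + 1 :=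
    ⟨min η₀ R, lt_min hη₀ hR, min_le_left _ _, (min_le_right _ _).trans_lt (by linarith)⟩
  obtain ⟨f₀, -, hf₀c, hf₀b⟩ := exists_halfSpace_radial (E := E) le_rfl hR
    (show R < R + 1 by linarith) hη hηR
  obtain ⟨f, hfφ, hfs⟩ := hφ.exists_extend (isCompact_halfNorm_le (R + 1)) f₀
    fun x hx => hf₀c x (not_le.1 hx).le
  have hC : IsCompact (K ∪ φ '' {x | halfNorm x ≤ R + 1}) :=
    hK.union ((isCompact_halfNorm_le _).image hφ.continuous)
  obtain ⟨R', hR', hRK⟩ : ∃ R' > ε, ∀ x, ψ x ∈ K ∪ φ '' {x | halfNorm x ≤ R + 1} →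
      halfNorm x ≤ R' := by
    have h1 : IsCompact (ψ ⁻¹' (K ∪ φ '' {x | halfNorm x ≤ R + 1})) :=
      hψ.isInducing.isCompact_preimage' hC hψK
    obtain ⟨M, hM⟩ := h1.bddAbove_image (f := halfNorm) continuous_halfNorm.continuousOn
    exact ⟨max M (ε + 1), lt_max_of_lt_right (by linarith), fun x hx =>
      (hM (mem_image_of_mem _ hx)).trans (le_max_left _ _)⟩
  obtain ⟨g₀, hg₀a, hg₀c, hg₀b⟩ := exists_halfSpace_radial (E := E) (a := ε / 2) (b := ε)
    (b' := R') (c := R' + 1) (by linarith) (by linarith) (by linarith) (by linarith) (by linarith)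
  obtain ⟨g, hgψ, -⟩ := hψ.exists_extend (isCompact_halfNorm_le (R' + 1)) g₀
    fun x hx => hg₀c x (not_le.1 hx).le
  refine ⟨fun x => f.symm (g (f (φ x))), ?_, fun x hx => ?_, fun p hp => ?_⟩
  · exact f.symm.isOpenEmbedding.comp (g.isOpenEmbedding.comp (f.isOpenEmbedding.comp hφ))
  · obtain ⟨z, hz, hzx⟩ := hηψ (f₀ x) (((hf₀b x).2 hx).trans hηη₀)
    simp only
    rw [f.symm_apply_eq, hfφ, ← hzx, hgψ, hg₀a z (le_of_lt hz)]
  · have hfp : f p ∈ K ∪ φ '' {x | halfNorm x ≤ R + 1} := by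
      by_cases h : p ∈ φ '' {x | halfNorm x ≤ R + 1}
      · obtain ⟨x, hx, rfl⟩ := h
        rw [hfφ]
        exact Or.inr ⟨_, f₀.mapsTo_of_support (Q := {x | halfNorm x ≤ R + 1})
          (fun x hx => hf₀c x (not_le.1 hx).le) hx, rfl⟩
      · rw [hfs p h]; exact Or.inl hp
    obtain ⟨z, hz⟩ := hψK hfp
    have h1 : halfNorm z ≤ R' := hRK z (hz ▸ hfp)
    have h2 : halfNorm (g₀.symm z) ≤ ε := by
      rw [← hg₀b, g₀.apply_symm_apply]; exact h1
    obtain ⟨x, hx, hxz⟩ := hεφ _ h2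
    refine ⟨f₀.symm x, ?_, ?_⟩
    · exact f₀.symm.mapsTo_of_support (Q := {x | halfNorm x ≤ R + 1})
        (f₀.symm_support fun x hx => hf₀c x (not_le.1 hx).le) (le_of_lt (show halfNorm x < R + 1 from hx))
    · simp only
      rw [hfφ, f₀.apply_symm_apply, f.symm_apply_eq, hxz, hgψ, g₀.apply_symm_apply, hz]

/-- A space in which every compact set lies in a half-space patch is a half-space. -/
theorem nonempty_homeomorph_halfSpace [SigmaCompactSpace P] [Nonempty P]
    [WeaklyLocallyCompactSpace P] {D : Set P}
    (hcov : ∀ K : Set P, IsCompact K → ∃ φ : E × Ici (0 : ℝ) → P, IsOpenEmbedding φ ∧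
      (∀ x, φ x ∈ D ↔ x.2.1 = 0) ∧ K ⊆ range φ) :
    Nonempty (P ≃ₜ E × Ici (0 : ℝ)) := by
  let K : CompactExhaustion P := default
  let T := {φ : E × Ici (0 : ℝ) → P // IsOpenEmbedding φ ∧ φ (0, ⟨0, self_mem_Ici⟩) ∈ D}
  have hstep : ∀ (φ : T) (k : ℕ), ∃ φ' : T, (∀ x, halfNorm x ≤ (k : ℝ) + 1 → φ'.1 x = φ.1 x) ∧
      K k ⊆ range φ'.1 ∧ ∀ p ∈ K k, ∃ x, halfNorm x ≤ (k : ℝ) + 2 ∧ φ'.1 x = p := by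
    intro φ k
    obtain ⟨φ', h1, h2, h3⟩ := exists_patch_step hcov φ.2.1 φ.2.2 (R := k + 1) (by positivity)
      (K.isCompact k)
    refine ⟨⟨φ', h1, ?_⟩, h2, h3.trans (image_subset_range _ _), fun p hp => ?_⟩
    · rw [h2 _ (by simp [halfNorm]; positivity)]; exact φ.2.2
    · obtain ⟨x, hx, hxp⟩ := h3 hp
      exact ⟨x, by rw [mem_ofPred] at hx; linarith, hxp⟩
  choose next hnext using hstep
  obtain ⟨φ₀, h₀, h₀D, -⟩ := hcov ∅ isCompact_empty
  let Φ : ℕ → T := fun k => Nat.rec ⟨φ₀, h₀, (h₀D _).2 rfl⟩ (fun k φ => next φ k) k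
  have hΦ : ∀ k, Φ (k + 1) = next (Φ k) k := fun k => rfl
  have hstab : ∀ k l : ℕ, k ≤ l → ∀ x, halfNorm x ≤ (k : ℝ) + 1 → (Φ l).1 x = (Φ k).1 x := by
    intro k l hkl x hx
    induction l, hkl using Nat.le_induction with
    | base => rfl
    | succ l hl ih =>
      rw [hΦ, (hnext (Φ l) l).1 x, ih]
      have : (k : ℝ) ≤ l := by exact_mod_cast hl
      linarith
  let F : E × Ici (0 : ℝ) → P := fun x => (Φ ⌈halfNorm x⌉₊).1 x
  have hF : ∀ (k : ℕ) x, halfNorm x ≤ (k : ℝ) + 1 → F x = (Φ k).1 x := by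
    intro k x hx
    have h1 := Nat.le_ceil (halfNorm x)
    rw [← hstab k (max k ⌈halfNorm x⌉₊) (le_max_left _ _) x hx,
      hstab ⌈halfNorm x⌉₊ _ (le_max_right k _) x (by linarith)]
  have hFe : ∀ x, ∃ k, F =ᶠ[𝓝 x] (Φ k).1 := by
    intro x
    refine ⟨⌈halfNorm x⌉₊, ?_⟩
    have h1 := Nat.le_ceil (halfNorm x)
    filter_upwards [(isOpen_lt continuous_halfNorm (continuous_const
      (y := (⌈halfNorm x⌉₊ : ℝ) + 1))).mem_nhds (show halfNorm x < _ by linarith)] with z hz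
    exact hF _ z (le_of_lt hz)
  have hFinj : Function.Injective F := by
    intro x y hxy
    have h1 := Nat.le_ceil (max (halfNorm x) (halfNorm y))
    have h2 := le_max_left (halfNorm x) (halfNorm y)
    have h3 := le_max_right (halfNorm x) (halfNorm y)
    rw [hF ⌈max (halfNorm x) (halfNorm y)⌉₊ x (by linarith),
      hF ⌈max (halfNorm x) (halfNorm y)⌉₊ y (by linarith)] at hxy
    exact (Φ _).2.1.injective hxy
  have hFsurj : Function.Surjective F := by
    intro p
    obtain ⟨k, hk⟩ := K.exists_mem p
    obtain ⟨x, hx, hxp⟩ := (hnext (Φ k) k).2.2 p hk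
    refine ⟨x, ?_⟩
    rw [hF (k + 1) x (by push_cast; linarith), hΦ, hxp]
  have hFc : Continuous F := continuous_iff_continuousAt.2 fun x => by
    obtain ⟨k, hk⟩ := hFe x
    exact (Φ k).2.1.continuous.continuousAt.congr hk.symm
  have hFo : IsOpenMap F := isOpenMap_iff_nhds_le.2 fun x => by
    obtain ⟨k, hk⟩ := hFe x
    rw [Filter.map_congr hk, hk.eq_of_nhds]
    exact isOpenMap_iff_nhds_le.1 (Φ k).2.1.isOpenMap x
  exact ⟨((Equiv.ofBijective F ⟨hFinj, hFsurj⟩).toHomeomorphOfContinuousOpen hFc hFo).symm⟩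

end HalfSpace

/-- An open embedding of `E × ℝ` whose bounded pieces leave every compact set as the last
coordinate tends to `-∞`. -/
structure IsProperTube {E F : Type*} [NormedAddCommGroup E] [TopologicalSpace F]
    (τ : E × ℝ → F) : Prop where
  isOpenEmbedding : IsOpenEmbedding τ
  exists_notMem : ∀ K, IsCompact K → ∀ ρ : ℝ, ∃ a : ℝ, ∀ x, ‖x.1‖ ≤ ρ → x.2 ≤ a → τ x ∉ K

/-- Every compact set and every bounded initial piece of a proper tube in `E × ℝ` can be engulfed
by the tube. -/
def EngulfsTubes (E : Type*) [NormedAddCommGroup E] : Prop :=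
  ∀ τ : E × ℝ → E × ℝ, IsProperTube τ → ∀ B, IsCompact B → ∀ ρ : ℝ,
    ∃ g : E × ℝ ≃ₜ E × ℝ, (∃ Q, IsCompact Q ∧ ∀ x, x ∉ Q → g x = x) ∧ B ⊆ g '' range τ ∧
      ∀ x, ‖x.1‖ ≤ ρ → x.2 ≤ ρ → τ x ∈ g '' range τ

/-- A fibrewise radial homeomorphism of `E × S`. -/
theorem exists_homeomorph_fibre_radial {E S : Type*} [NormedAddCommGroup E] [NormedSpace ℝ E]
    [TopologicalSpace S] {b c : ℝ} (hb : 0 < b) (hbc : b < c) {β : S → ℝ} (hβ : Continuous β)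
    (hβ0 : ∀ s, 0 < β s) (hβc : ∀ s, β s < c) :
    ∃ q : E × S ≃ₜ E × S, (∀ x, (q x).2 = x.2) ∧ (∀ x, c ≤ ‖x.1‖ → q x = x) ∧
      (∀ x, β x.2 = b → q x = x) ∧ ∀ x, ‖(q x).1‖ ≤ β x.2 ↔ ‖x.1‖ ≤ b := by
  have hnn : ∀ {b b' : ℝ}, 0 < b → b < c → 0 < b' → b' < c → ∀ t, 0 ≤ t →
      0 ≤ plMap 0 b b' c t := by
    intro b b' h1 h2 h3 h4 t ht
    have := plMap_mono h1 h2 h3 h4 ht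
    rwa [plMap_of_le le_rfl] at this
  have h0 : ∀ b b' : ℝ, plMap 0 b b' c 0 = 0 := fun b b' => plMap_of_le le_rfl
  refine ⟨{ toFun := fun x => (radialMap (plMap 0 b (β x.2) c) x.1, x.2)
            invFun := fun x => (radialMap (plMap 0 (β x.2) b c) x.1, x.2)
            left_inv := fun x => Prod.ext (radialMap_radialMap (h0 _ _) (h0 _ _)
              (hnn hb hbc (hβ0 _) (hβc _)) (fun t _ => plMap_inv hb hbc (hβ0 _) (hβc _) t) _) rfl
            right_inv := fun x => Prod.ext (radialMap_radialMap (h0 _ _) (h0 _ _)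
              (hnn (hβ0 _) (hβc _) hb hbc) (fun t _ => plMap_inv (hβ0 _) (hβc _) hb hbc t) _) rfl
            continuous_toFun := ?_
            continuous_invFun := ?_ }, fun x => rfl, fun x hx => ?_, fun x hx => ?_, fun x => ?_⟩
  · exact ((continuous_radialMap (V := E) (S := S) (θ := fun s => plMap 0 b (β s) c)
      (continuous_plMap (β := fun _ => b) continuous_const hβ (fun _ => hb) fun _ => hbc)
      fun _ => h0 _ _).comp (continuous_snd.prodMk continuous_fst)).prodMk continuous_snd
  · exact ((continuous_radialMap (V := E) (S := S) (θ := fun s => plMap 0 (β s) b c)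
      (continuous_plMap (β' := fun _ => b) hβ continuous_const hβ0 hβc)
      fun _ => h0 _ _).comp (continuous_snd.prodMk continuous_fst)).prodMk continuous_snd
  · exact Prod.ext (radialMap_of_eq (plMap_of_ge hb hbc hx)) rfl
  · refine Prod.ext (radialMap_of_eq ?_) rfl
    rw [hx, plMap_eq_self hb hbc]
  · change ‖radialMap (plMap 0 b (β x.2) c) x.1‖ ≤ _ ↔ _
    rw [norm_radialMap (h0 _ _) (hnn hb hbc (hβ0 _) (hβc _) _ (norm_nonneg _))]
    have := plMap_le_iff hb hbc (hβ0 x.2) (hβc x.2) (s := ‖x.1‖) (t := b)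
    rwa [plMap_self hb] at this

section
variable {E P : Type*} [NormedAddCommGroup E] [InnerProductSpace ℝ E] [FiniteDimensional ℝ E]
  [TopologicalSpace P] [T2Space P]

theorem exists_notMem_of_disjoint {D C : Set P} {φ : E × Ici (0 : ℝ) → P} (hφ : Continuous φ)
    (hφD : ∀ x, φ x ∈ D ↔ x.2.1 = 0) (hC : IsCompact C) (hCD : Disjoint C D) (r : ℝ) :
    ∃ a > 0, ∀ x, ‖x.1‖ ≤ r → x.2.1 ≤ a → φ x ∉ C := by
  have : ProperSpace E := FiniteDimensional.proper ℝ E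
  have h1 : closedBall (0 : E) r ×ˢ {(⟨0, self_mem_Ici⟩ : Ici (0 : ℝ))} ⊆ φ ⁻¹' Cᶜ := by
    rintro ⟨y, s⟩ ⟨-, rfl⟩ h
    exact disjoint_left.1 hCD h ((hφD _).2 rfl)
  obtain ⟨u, v, -, hv, hu', hv', huv⟩ := generalized_tube_lemma (isCompact_closedBall (0 : E) r)
    isCompact_singleton (hC.isClosed.isOpen_compl.preimage hφ) h1
  obtain ⟨ε, hε, hεv⟩ := Metric.isOpen_iff.1 hv _ (hv' rfl)
  refine ⟨ε / 2, by linarith, fun x hx1 hx2 => huv (a := x) ⟨hu' ?_, hεv ?_⟩⟩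
  · simpa using hx1
  · rw [mem_ball, Subtype.dist_eq, Real.dist_eq, sub_zero, abs_of_nonneg x.2.2]; linarith

/-- If tubes engulf, then every compact set lies in a half-space patch. -/
theorem exists_patch_of_engulfsTubes (hE : EngulfsTubes E) {b : E → P} (hb : IsClosedEmbedding b)
    (hD : ∀ p ∈ range b, ∃ e : OpenPartialHomeomorph P (E × Ici (0 : ℝ)), p ∈ e.source ∧
      ∀ q ∈ e.source, (q ∈ range b ↔ (e q).2.1 = 0)) {ι : E × ℝ → P} (hι : IsOpenEmbedding ι)
    (hιr : range ι = (range b)ᶜ) {K : Set P} (hK : IsCompact K) :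
    ∃ φ : E × Ici (0 : ℝ) → P, IsOpenEmbedding φ ∧
      (∀ x, φ x ∈ range b ↔ x.2.1 = 0) ∧ K ⊆ range φ := by
  have : ProperSpace E := FiniteDimensional.proper ℝ E
  obtain ⟨φ, hφ, hφD, hφK⟩ := exists_halfSpace_patch hb.isEmbedding hD (hb.isCompact_preimage hK)
  have hcpt : ∀ {C : Set P}, IsCompact C → Disjoint C (range b) → IsCompact (ι ⁻¹' C) := by
    intro C hC hCD
    refine hι.isInducing.isCompact_preimage' hC ?_
    rw [hιr]; exact hCD.subset_compl_right
  -- the ball of the boundary which matters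
  obtain ⟨ρ, hρ, hρK⟩ : ∃ ρ > 0, ∀ x, φ x ∈ K ∩ range b → ‖x.1‖ < ρ := by
    have h1 : IsCompact (φ ⁻¹' (K ∩ range b)) :=
      hφ.isInducing.isCompact_preimage' (hK.inter_right hb.isClosed_range) fun p hp => by
        obtain ⟨hp1, y, rfl⟩ := hp
        exact hφK ⟨y, hp1, rfl⟩
    obtain ⟨M, hM⟩ := h1.bddAbove_image (f := fun x => ‖x.1‖) (by fun_prop)
    exact ⟨max M 0 + 1, by positivity, fun x hx =>
      ((hM (mem_image_of_mem _ hx)).trans (le_max_left _ _)).trans_lt (lt_add_one _)⟩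
  have hU : IsOpen (φ '' {x | ‖x.1‖ < ρ ∧ x.2.1 < 1}) := hφ.isOpenMap _
    ((isOpen_lt (f := fun x : E × Ici (0 : ℝ) => ‖x.1‖) (by fun_prop) continuous_const).inter
      (isOpen_lt (f := fun x : E × Ici (0 : ℝ) => x.2.1) (by fun_prop) continuous_const))
  set K₁ := K \ φ '' {x | ‖x.1‖ < ρ ∧ x.2.1 < 1} with hK₁def
  have hK₁ : IsCompact K₁ := hK.diff hU
  have hK₁D : Disjoint K₁ (range b) := by
    rw [disjoint_left]
    rintro _ ⟨h1, h2⟩ ⟨y, rfl⟩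
    obtain ⟨x, hx⟩ := hφK ⟨y, h1, rfl⟩
    have h3 : φ x ∈ range b := hx ▸ mem_range_self y
    refine h2 ⟨x, ⟨hρK x ⟨hx ▸ h1, h3⟩, ?_⟩, hx⟩
    rw [(hφD x).1 h3]; exact one_pos
  -- the tube
  let up : E × ℝ → E × Ici (0 : ℝ) := fun x => (x.1, ⟨Real.exp x.2, (Real.exp_pos _).le⟩)
  have hup : IsOpenEmbedding up := by
    refine .of_continuous_injective_isOpenMap (by fun_prop) ?_ ?_
    · rintro ⟨x, s⟩ ⟨y, t⟩ h
      simp only [up, Prod.mk.injEq] at h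
      exact Prod.ext h.1 (Real.exp_injective (congrArg Subtype.val h.2))
    · have h1 : IsOpenMap fun t : ℝ => (⟨Real.exp t, (Real.exp_pos _).le⟩ : Ici (0 : ℝ)) := by
        intro U hU
        refine ⟨Real.exp '' U, Real.isOpenEmbedding_exp.isOpenMap U hU, ?_⟩
        ext ⟨s, hs⟩
        simp [Subtype.ext_iff]
      exact IsOpenMap.id.prodMap h1
  have hτex : ∀ x, ∃ y, ι y = φ (up x) := by
    intro x
    have : φ (up x) ∈ range ι := by
      rw [hιr, mem_compl_iff, hφD]
      exact (Real.exp_pos _).ne'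
    exact this
  choose τ hτ using hτex
  have hτemb : IsOpenEmbedding τ := by
    refine .of_comp τ hι ?_
    rw [show ι ∘ τ = φ ∘ up from funext hτ]
    exact hφ.comp hup
  have hτp : IsProperTube τ := by
    refine ⟨hτemb, fun C hC r => ?_⟩
    have hd : Disjoint (ι '' C) (range b) :=
      disjoint_left.2 fun p hp => by
        have := image_subset_range _ _ hp
        rwa [hιr] at this
    obtain ⟨a, ha, haC⟩ := exists_notMem_of_disjoint hφ.continuous hφD (hC.image hι.continuous)
      hd r
    refine ⟨Real.log a, fun x hx1 hx2 hx => haC (up x) hx1 ?_ (hτ x ▸ mem_image_of_mem _ hx)⟩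
    exact (Real.exp_le_exp.2 hx2).trans_eq (Real.exp_log ha)
  obtain ⟨g, ⟨Q, hQ, hgQ⟩, hgB, hgt⟩ := hE τ hτp _ (hcpt hK₁ hK₁D) ρ
  obtain ⟨G, hGι, hGQ⟩ := hι.exists_extend hQ g hgQ
  have hGD : ∀ p ∈ range b, G p = p := fun p hp => hGQ p fun h => by
    have := image_subset_range _ _ h
    rw [hιr] at this; exact this hp
  have hmem : ∀ z, z ∈ g '' range τ → ι z ∈ range (G ∘ φ) := by
    rintro _ ⟨_, ⟨x, rfl⟩, rfl⟩
    exact ⟨up x, by rw [Function.comp_apply, ← hτ, hGι]⟩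
  refine ⟨G ∘ φ, G.isOpenEmbedding.comp hφ, fun x => ?_, fun p hp => ?_⟩
  · rw [← hφD x]
    refine ⟨fun h => ?_, fun h => ?_⟩
    · have h2 : G (φ x) = φ x := G.injective (hGD _ h)
      rwa [Function.comp_apply, h2] at h
    · rwa [Function.comp_apply, hGD _ h]
  · by_cases h : p ∈ φ '' {x | ‖x.1‖ < ρ ∧ x.2.1 < 1}
    · obtain ⟨⟨y, s, hs⟩, ⟨h1, h2⟩, rfl⟩ := h
      rcases (mem_Ici.1 hs).eq_or_lt with h0 | h0
      · exact ⟨_, hGD _ ((hφD _).2 h0.symm)⟩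
      · have h3 := hmem _ (hgt (y, Real.log s) h1.le ((Real.log_nonpos hs (le_of_lt h2)).trans hρ.le))
        rw [hτ] at h3
        simpa [up, Real.exp_log h0] using h3
    · have h2 : p ∈ range ι := by
        rw [hιr]; exact disjoint_left.1 hK₁D ⟨hp, h⟩
      obtain ⟨z, rfl⟩ := h2
      exact hmem _ (hgB (show z ∈ ι ⁻¹' K₁ from ⟨hp, h⟩))
end

/-- To engulf a tube it suffices to engulf its core. -/
theorem IsProperTube.exists_engulf_of_core {E F : Type*} [NormedAddCommGroup E] [NormedSpace ℝ E]
    [FiniteDimensional ℝ E] [TopologicalSpace F] [T2Space F] {τ : E × ℝ → F} (hτ : IsProperTube τ)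
    (hcore : ∀ B, IsCompact B → ∀ M : ℝ, ∃ g : F ≃ₜ F,
      (∃ Q, IsCompact Q ∧ ∀ x, x ∉ Q → g x = x) ∧ B ⊆ g '' range τ ∧
      ∀ t ≤ M, τ (0, t) ∈ g '' range τ) {B : Set F} (hB : IsCompact B) {ρ M : ℝ} (hρ : 0 < ρ) :
    ∃ g : F ≃ₜ F, (∃ Q, IsCompact Q ∧ ∀ x, x ∉ Q → g x = x) ∧ B ⊆ g '' range τ ∧
      ∀ x, ‖x.1‖ ≤ ρ → x.2 ≤ M → τ x ∈ g '' range τ := by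
  have : ProperSpace E := FiniteDimensional.proper ℝ E
  obtain ⟨a₁, ha₁⟩ := hτ.exists_notMem B hB (ρ + 1)
  have hbox : ∀ r s t : ℝ, IsCompact (τ '' (closedBall (0 : E) r ×ˢ Icc s t)) := fun r s t =>
    ((isCompact_closedBall _ _).prod isCompact_Icc).image hτ.isOpenEmbedding.continuous
  obtain ⟨g, ⟨Q, hQ, hgQ⟩, hgB, hgM⟩ := hcore (B ∪ τ '' (closedBall (0 : E) (ρ + 1) ×ˢ
    Icc a₁ (M + 1))) (hB.union (hbox _ _ _)) M
  obtain ⟨a₂, ha₂⟩ := hτ.exists_notMem Q hQ (ρ + 1)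
  have hopen : IsOpen (g '' range τ) := g.isOpenMap _ hτ.isOpenEmbedding.isOpen_range
  obtain ⟨δ, hδ, hδρ, hδτ⟩ : ∃ δ > 0, δ ≤ ρ ∧ ∀ x : E × ℝ, ‖x.1‖ ≤ δ → x.2 ∈ Icc a₂ M →
      τ x ∈ g '' range τ := by
    obtain ⟨u, v, hu, -, hu', hv', huv⟩ := generalized_tube_lemma
      (isCompact_singleton (x := (0 : E))) (isCompact_Icc (a := a₂) (b := M))
      (hopen.preimage hτ.isOpenEmbedding.continuous) (by
        rintro ⟨y, t⟩ ⟨rfl, ht⟩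
        exact hgM t ht.2)
    obtain ⟨ε, hε, hεu⟩ := Metric.isOpen_iff.1 hu _ (hu' rfl)
    refine ⟨min (ε / 2) ρ, by positivity, min_le_right _ _,
      fun x hx1 hx2 => huv (a := x) ⟨hεu ?_, hv' hx2⟩⟩
    rw [mem_ball_zero_iff]
    linarith [hx1.trans (min_le_left _ _)]
  let d : ℝ → ℝ := fun t => infDist t (Icc (min a₂ M) M)
  have hne : (Icc (min a₂ M) M).Nonempty := nonempty_Icc.2 (min_le_right _ _)
  have hd : Continuous d := continuous_infDist_pt _
  have hd0 : ∀ t, 0 ≤ min 1 (d t) := fun t => le_min zero_le_one infDist_nonneg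
  let β : ℝ → ℝ := fun t => δ + (ρ - δ) * min 1 (d t)
  have hβ : Continuous β := by fun_prop
  have hβδ : ∀ t, δ ≤ β t := fun t => by
    have := mul_nonneg (sub_nonneg.2 hδρ) (hd0 t)
    simp only [β]; linarith
  have hβρ : ∀ t, β t ≤ ρ := fun t => by
    have := mul_le_mul_of_nonneg_left (min_le_left 1 (d t)) (sub_nonneg.2 hδρ)
    simp only [β]; linarith
  obtain ⟨q₀, hq2, hqc, hqb, hqβ⟩ := exists_homeomorph_fibre_radial (E := E) hρ (lt_add_one ρ) hβ
    (fun t => hδ.trans_le (hβδ t)) (fun t => (hβρ t).trans_lt (lt_add_one ρ))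
  have hqs : ∀ x, x ∉ closedBall (0 : E) (ρ + 1) ×ˢ Icc (min a₂ M - 1) (M + 1) → q₀ x = x := by
    intro x hx
    by_cases h1 : ‖x.1‖ ≤ ρ + 1
    · refine hqb x ?_
      have h2 : 1 ≤ d x.2 := by
        refine (le_infDist hne).2 fun t ht => ?_
        by_contra! h3
        rw [Real.dist_eq, abs_lt] at h3
        exact hx ⟨by simpa using h1, by linarith [ht.1], by linarith [ht.2]⟩
      simp only [β]; rw [min_eq_left h2]; ring
    · exact hqc x (not_le.1 h1).le
  obtain ⟨q, hqτ, hqQ⟩ := hτ.isOpenEmbedding.exists_extend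
    ((isCompact_closedBall (0 : E) (ρ + 1)).prod isCompact_Icc) q₀ hqs
  have hmem : ∀ p, q p ∈ g '' range τ → p ∈ (g.trans q.symm) '' range τ := by
    rintro p ⟨x, hx, hxp⟩
    exact ⟨x, hx, by rw [Homeomorph.trans_apply, hxp, q.symm_apply_apply]⟩
  have hlow : ∀ x : E × ℝ, ‖x.1‖ ≤ ρ + 1 → x.2 ≤ a₂ → τ x ∈ g '' range τ := fun x h1 h2 =>
    ⟨τ x, mem_range_self _, hgQ _ (ha₂ x h1 h2)⟩
  have hq1 : ∀ x, ‖x.1‖ ≤ ρ + 1 → ‖(q₀ x).1‖ ≤ ρ + 1 := by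
    intro x hx
    by_contra! h
    have h3 := q₀.injective (hqc _ h.le)
    rw [h3] at h; linarith
  refine ⟨g.trans q.symm, ⟨Q ∪ τ '' (closedBall (0 : E) (ρ + 1) ×ˢ Icc (min a₂ M - 1) (M + 1)),
    hQ.union (hbox _ _ _), fun x hx => ?_⟩, fun p hp => hmem p ?_, fun x hx1 hx2 => hmem _ ?_⟩
  · rw [mem_union, not_or] at hx
    rw [Homeomorph.trans_apply, hgQ x hx.1, q.symm_apply_eq, hqQ x hx.2]
  · by_cases h : p ∈ τ '' (closedBall (0 : E) (ρ + 1) ×ˢ Icc (min a₂ M - 1) (M + 1))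
    · obtain ⟨x, ⟨hx1, hx2⟩, rfl⟩ := h
      rw [mem_closedBall_zero_iff] at hx1
      have h4 : a₁ ≤ x.2 := by
        by_contra! h
        exact ha₁ x hx1 h.le hp
      rw [hqτ]
      exact hgB (Or.inr ⟨_, ⟨by simpa using hq1 x hx1, by rw [hq2]; exact h4,
        by rw [hq2]; exact hx2.2⟩, rfl⟩)
    · rw [hqQ p h]; exact hgB (Or.inl hp)
  · rw [hqτ]
    rcases le_total x.2 a₂ with h | h
    · exact hlow _ (hq1 _ (by linarith)) (by rwa [hq2])
    · refine hδτ _ ?_ (by rw [hq2]; exact ⟨h, hx2⟩)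
      have h0 : β x.2 = δ := by
        have h1 : d x.2 = 0 := infDist_zero_of_mem ⟨(min_le_left _ _).trans h, hx2⟩
        simp [β, h1]
      rw [← h0]; exact (hqβ x).2 hx1

/-- Some compactly supported homeomorphism makes `T` swallow `A`. -/
def CanEngulf {F : Type*} [TopologicalSpace F] (T A : Set F) : Prop :=
  ∃ g : F ≃ₜ F, (∃ Q, IsCompact Q ∧ ∀ x, x ∉ Q → g x = x) ∧ A ⊆ g '' T

theorem CanEngulf.of_conj {F F' : Type*} [TopologicalSpace F] [TopologicalSpace F'] {T A : Set F}
    (N : F ≃ₜ F') (h : CanEngulf (N '' T) (N '' A)) : CanEngulf T A := by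
  obtain ⟨g, ⟨Q, hQ, hgQ⟩, hA⟩ := h
  refine ⟨(N.trans g).trans N.symm, ⟨N.symm '' Q, hQ.image N.symm.continuous, fun x hx => ?_⟩,
    fun x hx => ?_⟩
  · rw [Homeomorph.trans_apply, Homeomorph.trans_apply, hgQ, N.symm_apply_apply]
    exact fun h => hx ⟨_, h, N.symm_apply_apply x⟩
  · obtain ⟨_, ⟨y, hy, rfl⟩, hyx⟩ := hA (mem_image_of_mem N hx)
    refine ⟨y, hy, ?_⟩
    rw [Homeomorph.trans_apply, Homeomorph.trans_apply, hyx, N.symm_apply_apply]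

theorem CanEngulf.mono {F : Type*} [TopologicalSpace F] {T A A' : Set F} (h : CanEngulf T A)
    (hA : A' ⊆ A) : CanEngulf T A' := by
  obtain ⟨g, hg, hgA⟩ := h
  exact ⟨g, hg, hA.trans hgA⟩

theorem canEngulf_of_Ici_subset {E : Type*} [TopologicalSpace E] [CompactSpace E]
    {T A : Set (E × ℝ)} {b M : ℝ} (hT : ∀ x, b ≤ x.2 → x ∈ T) (hA : ∀ x ∈ A, M ≤ x.2) :
    CanEngulf T A := by
  set b' := min M b
  have h1 : b' - 1 < b := by linarith [min_le_right M b]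
  have h2 : b < b + 1 := by linarith
  have h3 : b' - 1 < b' := by linarith
  have h4 : b' < b + 1 := by linarith [min_le_right M b]
  refine ⟨plHomeomorph (S := E) (b' - 1) (b + 1) (β := fun _ => b) (β' := fun _ => b')
    continuous_const continuous_const (fun _ => h1) (fun _ => h2) (fun _ => h3) (fun _ => h4),
    ⟨univ ×ˢ Icc (b' - 1) (b + 1), isCompact_univ.prod isCompact_Icc, fun x hx => ?_⟩,
    fun x hx => ?_⟩
  · refine Prod.ext rfl ?_
    rcases lt_or_ge x.2 (b' - 1) with h | h
    · exact plMap_of_le h.le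
    · refine plMap_of_ge h1 h2 ?_
      by_contra! h5
      exact hx ⟨mem_univ _, h, h5.le⟩
  · refine ⟨(x.1, plMap (b' - 1) b' b (b + 1) x.2), hT _ ?_, Prod.ext rfl
      (plMap_inv h3 h4 h1 h2 _)⟩
    have := (plMap_le_iff h3 h4 h1 h2 (s := b') (t := x.2)).2 ((min_le_left M b).trans (hA x hx))
    rwa [plMap_self h3] at this

theorem engulfsTubes_of_subsingleton {E : Type*} [NormedAddCommGroup E] [Subsingleton E] :
    EngulfsTubes E := by
  intro τ hτ B hB ρ
  let A := B ∪ τ '' {x | x.2 ≤ ρ}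
  suffices CanEngulf (range τ) A by
    obtain ⟨g, hg, hA⟩ := this
    exact ⟨g, hg, fun x hx => hA (Or.inl hx), fun x _ hx => hA (Or.inr ⟨x, hx, rfl⟩)⟩
  have : CompactSpace E := Finite.compactSpace
  have hE : ∀ x : E × ℝ, x = (0, x.2) := fun x => Prod.ext (Subsingleton.elim _ _) rfl
  have key : ∀ N : E × ℝ ≃ₜ E × ℝ, (∃ a, ∀ t ≤ a, 0 < (N (τ (0, t))).2) →
      CanEngulf (range τ) A := by
    rintro N ⟨a, ha⟩
    have hr : Continuous fun t : ℝ => (N (τ (0, t))).2 := continuous_snd.comp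
      (N.continuous.comp (hτ.isOpenEmbedding.continuous.comp (by fun_prop)))
    refine CanEngulf.of_conj N ?_
    obtain ⟨m, hm⟩ := ((hB.union ((isCompact_Icc (a := a) (b := ρ)).image
      (hτ.isOpenEmbedding.continuous.comp (by fun_prop : Continuous fun t : ℝ =>
        ((0 : E), t))))).image (continuous_snd.comp N.continuous)).bddBelow
    refine canEngulf_of_Ici_subset (b := (N (τ (0, a))).2) (M := min m 0) (fun x hx => ?_) ?_
    · obtain ⟨c, hc⟩ := hτ.exists_notMem (N.symm '' (univ ×ˢ Icc 0 x.2))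
        ((isCompact_univ.prod isCompact_Icc).image N.symm.continuous) 0
      have h1 : x.2 < (N (τ (0, min a c))).2 := by
        by_contra! h
        refine hc (0, min a c) (by simp) (min_le_right _ _) ⟨_, ⟨mem_univ _, ?_, h⟩,
          N.symm_apply_apply _⟩
        exact (ha _ (min_le_left _ _)).le
      obtain ⟨t, -, ht⟩ := intermediate_value_uIcc (a := a) (b := min a c) hr.continuousOn
        (Icc_subset_uIcc ⟨hx, h1.le⟩)
      refine ⟨τ (0, t), mem_range_self _, ?_⟩
      rw [hE (N _), hE x]; exact Prod.ext rfl ht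
    · rintro _ ⟨x, hx, rfl⟩
      rcases hx with hx | ⟨x, hx, rfl⟩
      · exact (min_le_left _ _).trans (hm ⟨x, Or.inl hx, rfl⟩)
      · rw [hE x]
        rcases le_total x.2 a with h | h
        · exact (min_le_right _ _).trans (ha _ h).le
        · exact (min_le_left _ _).trans (hm ⟨_, Or.inr ⟨x.2, ⟨h, hx⟩, rfl⟩, rfl⟩)
  obtain ⟨a, ha⟩ := hτ.exists_notMem (univ ×ˢ {0}) (isCompact_univ.prod isCompact_singleton) 0
  have hr : Continuous fun t : ℝ => (τ (0, t)).2 := continuous_snd.comp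
    (hτ.isOpenEmbedding.continuous.comp (by fun_prop))
  have hne : ∀ t ≤ a, (τ (0, t)).2 ≠ 0 := fun t ht h =>
    ha (0, t) (by simp) ht ⟨mem_univ _, h⟩
  have hsame : ∀ t ≤ a, ∀ s ≤ a, (τ (0, t)).2 < 0 → (τ (0, s)).2 < 0 := by
    intro t ht s hs h1
    by_contra! h2
    obtain ⟨u, hu, hu0⟩ := intermediate_value_uIcc (a := t) (b := s) hr.continuousOn
      (Icc_subset_uIcc ⟨h1.le, h2⟩)
    exact hne u (hu.2.trans (max_le ht hs)) hu0
  rcases lt_or_ge (τ (0, a)).2 0 with h | h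
  · refine key ((Homeomorph.refl E).prodCongr (Homeomorph.neg ℝ)) ⟨a, fun t ht => ?_⟩
    exact neg_pos.2 (hsame a le_rfl t ht h)
  · refine key (Homeomorph.refl _) ⟨a, fun t ht => ?_⟩
    refine lt_of_le_of_ne ?_ (hne t ht).symm
    by_contra! h1
    exact absurd (hsame t ht a le_rfl h1) (not_lt.2 h)

section
variable {V : Type*} [NormedAddCommGroup V] [NormedSpace ℝ V] [FiniteDimensional ℝ V]

theorem exists_injective_add_smul (hV : 2 < Module.finrank ℝ V) {p : ℝ → V}
    (hp : ContDiff ℝ 1 p) {ε : ℝ} (hε : 0 < ε) :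
    ∃ v : V, ‖v‖ < ε ∧ Function.Injective fun t => p t + t • v := by
  have h1 : ContDiffOn ℝ 1 (fun x : ℝ × ℝ => (x.2 - x.1)⁻¹ • (p x.1 - p x.2))
      {x | x.1 < x.2} := by
    refine ContDiffOn.smul (ContDiffOn.inv (by fun_prop) fun x hx => ?_) (by fun_prop)
    exact (sub_pos.2 hx).ne'
  have h2 : Convex ℝ {x : ℝ × ℝ | x.1 < x.2} := by
    intro x hx y hy a b ha hb hab
    have hx' : x.1 < x.2 := hx
    have hy' : y.1 < y.2 := hy
    change a * x.1 + b * y.1 < a * x.2 + b * y.2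
    rcases ha.eq_or_lt with rfl | ha
    · obtain rfl : b = 1 := by linarith
      linarith
    · nlinarith [mul_lt_mul_of_pos_left hx' ha, mul_le_mul_of_nonneg_left hy'.le hb]
  have h3 := h1.dense_compl_image_of_dimH_lt_finrank h2 subset_rfl (by
    refine (dimH_mono (subset_univ _)).trans_lt ?_
    rw [Real.dimH_univ_eq_finrank]
    simpa using hV)
  obtain ⟨v, hv, hvε⟩ := h3.exists_dist_lt 0 hε
  rw [dist_zero_left] at hvε
  refine ⟨v, hvε, ?_⟩
  have key : ∀ s t : ℝ, s < t → p s + s • v ≠ p t + t • v := by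
    intro s t hst h
    refine hv ⟨(s, t), hst, ?_⟩
    have h4 : t - s ≠ 0 := (sub_pos.2 hst).ne'
    have h5 : p s - p t = (t - s) • v := by
      rw [sub_smul, sub_eq_sub_iff_add_eq_add, h, add_comm]
    simp only [h5, smul_smul, inv_mul_cancel₀ h4, one_smul]
  intro s t h
  rcases lt_trichotomy s t with hst | hst | hst
  · exact absurd h (key s t hst)
  · exact hst
  · exact absurd h.symm (key t s hst)

/-- In dimension at least three, every path can be approximated by paths which are injective and
avoid the origin. -/
theorem exists_injective_approx (hV : 2 < Module.finrank ℝ V) {p : ℝ → V} (hp : Continuous p)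
    (a d : ℝ) {ε : ℝ} (hε : 0 < ε) :
    ∃ q : ℝ → V, Continuous q ∧ Function.Injective q ∧ (∀ t, q t ≠ 0) ∧
      ∀ t ∈ Icc a d, ‖q t - p t‖ < ε := by
  obtain ⟨q₀, hq₀, hq₀p⟩ : ∃ q₀ : ℝ → V, ContDiff ℝ 1 q₀ ∧ ∀ t, ‖q₀ t - p t‖ < ε / 3 := by
    obtain ⟨g, hg⟩ := hp.exists_contDiff_approx 1 (ε := fun _ => ε / 3) continuous_const
      (fun _ => by positivity)
    exact ⟨g, hg.1, fun t => by simpa [dist_eq_norm] using hg.2.1 t⟩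
  obtain ⟨C, hC, hCt⟩ : ∃ C > 0, ∀ t ∈ Icc a d, |t| ≤ C :=
    ⟨max |a| |d| + 1, by positivity, fun t ht => (abs_le_max_abs_abs ht.1 ht.2).trans
      (lt_add_one _).le⟩
  obtain ⟨v, hv, hvi⟩ := exists_injective_add_smul hV hq₀ (ε := ε / (3 * C)) (by positivity)
  have h1 : ContDiff ℝ 1 fun t => -(q₀ t + t • v) := by fun_prop
  obtain ⟨w, hw, hwε⟩ := (h1.dense_compl_range_of_finrank_lt_finrank (by simp; omega)).exists_dist_lt
    0 (show 0 < ε / 3 by positivity)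
  rw [dist_zero_left] at hwε
  refine ⟨fun t => q₀ t + t • v + w, by have := hq₀.continuous; fun_prop,
    fun s t h => hvi (add_right_cancel h), fun t h => hw ⟨t, ?_⟩, fun t ht => ?_⟩
  · exact neg_eq_of_add_eq_zero_right h
  · have h2 : ‖t • v‖ ≤ ε / 3 := by
      rw [norm_smul, Real.norm_eq_abs]
      calc |t| * ‖v‖ ≤ C * (ε / (3 * C)) := mul_le_mul (hCt t ht) hv.le (norm_nonneg _) hC.le
        _ = ε / 3 := by field_simp
    calc ‖q₀ t + t • v + w - p t‖ = ‖(q₀ t - p t) + t • v + w‖ := by congr 1; abel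
      _ ≤ ‖q₀ t - p t‖ + ‖t • v‖ + ‖w‖ := norm_add₃_le
      _ < ε := by linarith [hq₀p t]
end

theorem Topology.IsOpenEmbedding.exists_forall_dist_lt {X Y : Type*} [MetricSpace X] [MetricSpace Y]
    {θ : X → Y} (hθ : IsOpenEmbedding θ) {K : Set X} (hK : IsCompact K) {η : ℝ} (hη : 0 < η) :
    ∃ δ > 0, ∀ y ∈ K, ∀ z, dist z (θ y) < δ → ∃ x, θ x = z ∧ dist x y < η := by
  obtain ⟨δ, hδ, h⟩ := lebesgue_number_lemma_of_metric (hK.image hθ.continuous)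
    (c := fun y : X => θ '' ball y (η / 2)) (fun y => hθ.isOpenMap _ isOpen_ball) (by
      rintro _ ⟨y, hy, rfl⟩
      exact mem_iUnion.2 ⟨y, y, mem_ball_self (by positivity), rfl⟩)
  refine ⟨δ, hδ, fun y hy z hz => ?_⟩
  obtain ⟨w, hw⟩ := h _ (mem_image_of_mem θ hy)
  obtain ⟨x, hx, rfl⟩ := hw hz
  obtain ⟨y', hy', h1⟩ := hw (mem_ball_self hδ)
  rw [hθ.injective h1] at hy'
  refine ⟨x, rfl, ?_⟩
  have := dist_triangle_right x y w
  rw [mem_ball] at hx hy'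
  linarith

section
variable {E : Type*} [NormedAddCommGroup E] [NormedSpace ℝ E]

/-- The vertical line of `E × ℝ`, perturbed by a function decaying at infinity. -/
noncomputable def perturbedLine (u : BoundedContinuousFunction ℝ (E × ℝ)) (t : ℝ) : E × ℝ :=
  (0, t) + (1 + t ^ 2)⁻¹ • u t

theorem continuous_perturbedLine :
    Continuous fun x : BoundedContinuousFunction ℝ (E × ℝ) × ℝ => perturbedLine x.1 x.2 := by
  have h : Continuous fun x : BoundedContinuousFunction ℝ (E × ℝ) × ℝ => x.1 x.2 :=
    continuous_eval
  have h2 : Continuous fun x : BoundedContinuousFunction ℝ (E × ℝ) × ℝ => (1 + x.2 ^ 2)⁻¹ :=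
    Continuous.inv₀ (by fun_prop) fun x => by positivity
  exact Continuous.add (by fun_prop) (h2.smul h)

theorem isOpen_setOf_forall_ne {X Y Z : Type*} [TopologicalSpace X] [TopologicalSpace Y]
    [TopologicalSpace Z] [T2Space Z] {K : Set Y} (hK : IsCompact K) {f g : X × Y → Z}
    (hf : Continuous f) (hg : Continuous g) : IsOpen {x | ∀ y ∈ K, f (x, y) ≠ g (x, y)} := by
  rw [isOpen_iff_mem_nhds]
  intro x hx
  obtain ⟨u, v, hu, hv, hxu, hKv, huv⟩ := generalized_tube_lemma (isCompact_singleton (x := x)) hK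
    (isOpen_ne_fun hf hg) (by
      rintro ⟨a, y⟩ ⟨rfl, hy⟩
      exact hx y hy)
  refine mem_of_superset (hu.mem_nhds (hxu rfl)) fun a ha y hy => huv (a := (a, y)) ⟨ha, hKv hy⟩

variable [FiniteDimensional ℝ E]

theorem dense_setOf_perturbedLine (hE : 2 < Module.finrank ℝ E) {θ : E × ℝ → E × ℝ}
    (hθ : IsOpenEmbedding θ) {a d : ℝ} (had : a ≤ d) :
    Dense {u : BoundedContinuousFunction ℝ (E × ℝ) |
      InjOn (fun t => (θ (perturbedLine u t)).1) (Icc a d) ∧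
      ∀ t ∈ Icc a d, (θ (perturbedLine u t)).1 ≠ 0} := by
  rw [Metric.dense_iff]
  intro u ε hε
  have hy : Continuous (perturbedLine u) :=
    continuous_perturbedLine.comp (continuous_const.prodMk continuous_id)
  obtain ⟨C, hC, hCt⟩ : ∃ C > 0, ∀ t ∈ Icc a d, 1 + t ^ 2 ≤ C := by
    obtain ⟨C, hC⟩ := ((isCompact_Icc (a := a) (b := d)).image
      (by fun_prop : Continuous fun t : ℝ => 1 + t ^ 2)).bddAbove
    exact ⟨C, by have := hC ⟨a, ⟨le_rfl, had⟩, rfl⟩; simp only at this; nlinarith [sq_nonneg a],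
      fun t ht => hC ⟨t, ht, rfl⟩⟩
  obtain ⟨δ, hδ, hδx⟩ := hθ.exists_forall_dist_lt
    ((isCompact_Icc (a := a) (b := d)).image hy) (η := ε / (2 * C)) (by positivity)
  have hp : Continuous fun t => (θ (perturbedLine u t)).1 :=
    continuous_fst.comp (hθ.continuous.comp hy)
  obtain ⟨q, hq, hqi, hq0, hqp⟩ := exists_injective_approx hE hp a d hδ
  have h1 : ∀ t : Icc a d, ∃ x, θ x = (q t, (θ (perturbedLine u t)).2) ∧
      dist x (perturbedLine u t) < ε / (2 * C) := fun t => by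
    refine hδx _ (mem_image_of_mem _ t.2) _ ?_
    rw [Prod.dist_eq, dist_self, max_eq_left dist_nonneg, dist_eq_norm]
    exact hqp t t.2
  choose x hx hxd using h1
  have hxc : Continuous x := by
    rw [hθ.isInducing.continuous_iff]
    have : θ ∘ x = fun t : Icc a d => (q t, (θ (perturbedLine u t)).2) := funext hx
    rw [this]
    exact (hq.comp continuous_subtype_val).prodMk (continuous_snd.comp
      (hθ.continuous.comp (hy.comp continuous_subtype_val)))
  let h0 : C(Icc a d, E × ℝ) := ⟨fun t => (1 + (t : ℝ) ^ 2) • (x t - perturbedLine u t), by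
    have := hy.comp (continuous_subtype_val (p := (· ∈ Icc a d)))
    exact Continuous.smul (f := fun t : Icc a d => 1 + (t : ℝ) ^ 2) (by fun_prop) (hxc.sub this)⟩
  let h : BoundedContinuousFunction ℝ (E × ℝ) :=
    (BoundedContinuousFunction.mkOfCompact h0).compContinuous ⟨projIcc a d had, continuous_projIcc⟩
  have hval : ∀ t : Icc a d, perturbedLine (u + h) t = x t := by
    intro t
    have h2 : h t = (1 + (t : ℝ) ^ 2) • (x t - perturbedLine u t) := by
      change h0 (projIcc a d had t) = _
      rw [projIcc_val]; rfl
    have h3 : (1 + (t : ℝ) ^ 2) ≠ 0 := by positivity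
    have h4 : perturbedLine (u + h) t = perturbedLine u t + (1 + (t : ℝ) ^ 2)⁻¹ • h t := by
      simp only [perturbedLine, BoundedContinuousFunction.add_apply, smul_add, add_assoc]
    rw [h4, h2, smul_smul, inv_mul_cancel₀ h3, one_smul, add_sub_cancel]
  refine ⟨u + h, ?_, fun s hs t ht hst => ?_, fun t ht => ?_⟩
  · rw [mem_ball, dist_eq_norm, add_sub_cancel_left]
    refine lt_of_le_of_lt ((BoundedContinuousFunction.norm_le (by positivity : 0 ≤ ε / 2)).2
      fun t => ?_) (half_lt_self hε)
    change ‖h0 (projIcc a d had t)‖ ≤ _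
    generalize projIcc a d had t = s
    have h3 : 0 < (1 + (s : ℝ) ^ 2) := by positivity
    change ‖(1 + (s : ℝ) ^ 2) • (x s - perturbedLine u s)‖ ≤ _
    rw [norm_smul, Real.norm_of_nonneg h3.le, ← dist_eq_norm]
    calc (1 + (s : ℝ) ^ 2) * dist (x s) (perturbedLine u s) ≤ C * (ε / (2 * C)) :=
          mul_le_mul (hCt _ s.2) (hxd s).le dist_nonneg hC.le
      _ = ε / 2 := by field_simp
  · have h2 := hval ⟨s, hs⟩
    have h3 := hval ⟨t, ht⟩
    simp only at h2 h3 hst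
    rw [h2, h3, hx, hx] at hst
    exact hqi hst
  · have h3 := hval ⟨t, ht⟩
    simp only at h3
    rw [h3, hx]
    exact hq0 t

theorem exists_perturbedLine (hE : 2 < Module.finrank ℝ E) {ι : Type*} [Countable ι]
    {θ : ι → E × ℝ → E × ℝ} (hθ : ∀ i, IsOpenEmbedding (θ i)) :
    ∃ u : BoundedContinuousFunction ℝ (E × ℝ), ∀ i,
      Function.Injective (fun t => (θ i (perturbedLine u t)).1) ∧
      ∀ t, (θ i (perturbedLine u t)).1 ≠ 0 := by
  let S : ι × ℚ × ℚ × ℚ × ℚ → Set (BoundedContinuousFunction ℝ (E × ℝ)) := fun j =>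
    {u | j.2.1 < j.2.2.1 → j.2.2.1 < j.2.2.2.1 → j.2.2.2.1 < j.2.2.2.2 →
      (∀ y ∈ Icc (j.2.1 : ℝ) j.2.2.1 ×ˢ Icc (j.2.2.2.1 : ℝ) j.2.2.2.2,
        (θ j.1 (perturbedLine u y.1)).1 ≠ (θ j.1 (perturbedLine u y.2)).1) ∧
      ∀ y ∈ Icc (j.2.1 : ℝ) j.2.2.1, (θ j.1 (perturbedLine u y)).1 ≠ 0}
  have hcont : ∀ i, Continuous fun x : BoundedContinuousFunction ℝ (E × ℝ) × ℝ =>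
      (θ i (perturbedLine x.1 x.2)).1 := fun i =>
    continuous_fst.comp ((hθ i).continuous.comp continuous_perturbedLine)
  have hopen : ∀ j, IsOpen (S j) := by
    rintro ⟨i, a, b, c, d⟩
    by_cases h : a < b ∧ b < c ∧ c < d
    · have : S (i, a, b, c, d) = {u | ∀ y ∈ Icc (a : ℝ) b ×ˢ Icc (c : ℝ) d,
        (θ i (perturbedLine u y.1)).1 ≠ (θ i (perturbedLine u y.2)).1} ∩
          {u | ∀ y ∈ Icc (a : ℝ) b, (θ i (perturbedLine u y)).1 ≠ 0} := by
        ext u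
        exact ⟨fun hu => hu h.1 h.2.1 h.2.2, fun hu _ _ _ => hu⟩
      rw [this]
      refine (isOpen_setOf_forall_ne (isCompact_Icc.prod isCompact_Icc)
        (f := fun x => (θ i (perturbedLine x.1 x.2.1)).1)
        (g := fun x => (θ i (perturbedLine x.1 x.2.2)).1)
        ((hcont i).comp (f := fun x : BoundedContinuousFunction ℝ (E × ℝ) × ℝ × ℝ => (x.1, x.2.1))
          (by fun_prop))
        ((hcont i).comp (f := fun x : BoundedContinuousFunction ℝ (E × ℝ) × ℝ × ℝ => (x.1, x.2.2))
          (by fun_prop))).inter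
        (isOpen_setOf_forall_ne isCompact_Icc (hcont i) continuous_const)
    · convert isOpen_univ
      exact eq_univ_of_forall fun u h1 h2 h3 => absurd ⟨h1, h2, h3⟩ h
  have hdense : ∀ j, Dense (S j) := by
    rintro ⟨i, a, b, c, d⟩
    by_cases h : a < b ∧ b < c ∧ c < d
    · have h1 : (a : ℝ) < b := Rat.cast_lt.2 h.1
      have h2 : (b : ℝ) < c := Rat.cast_lt.2 h.2.1
      have h3 : (c : ℝ) < d := Rat.cast_lt.2 h.2.2
      refine (dense_setOf_perturbedLine hE (hθ i) (a := a) (d := d) (by linarith)).mono ?_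
      rintro u ⟨hu, hu0⟩ - - -
      refine ⟨?_, fun y hy => hu0 y ⟨hy.1, by linarith [hy.2]⟩⟩
      rintro ⟨s, t⟩ ⟨hs, ht⟩ hst
      have := hu ⟨hs.1, by linarith [hs.2]⟩ ⟨by linarith [ht.1], ht.2⟩ hst
      simp only at hs ht this
      linarith [hs.2, ht.1]
    · convert dense_univ
      exact eq_univ_of_forall fun u h1 h2 h3 => absurd ⟨h1, h2, h3⟩ h
  have : CompleteSpace E := FiniteDimensional.complete ℝ E
  obtain ⟨u, hu⟩ := (dense_iInter_of_isOpen hopen hdense).nonempty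
  rw [mem_iInter] at hu
  have key : ∀ i (s t : ℝ), s < t → (θ i (perturbedLine u s)).1 ≠ (θ i (perturbedLine u t)).1 ∧
      (θ i (perturbedLine u s)).1 ≠ 0 := by
    intro i s t hst
    obtain ⟨a, -, ha⟩ := exists_rat_btwn (sub_one_lt s)
    obtain ⟨b, hb, hb'⟩ := exists_rat_btwn hst
    obtain ⟨c, hc, hc'⟩ := exists_rat_btwn hb'
    obtain ⟨d, hd, -⟩ := exists_rat_btwn (lt_add_one t)
    have := hu (i, a, b, c, d) (Rat.cast_lt.1 (ha.trans hb)) (Rat.cast_lt.1 hc)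
      (Rat.cast_lt.1 (hc'.trans hd))
    exact ⟨this.1 (s, t) ⟨⟨ha.le, hb.le⟩, ⟨hc'.le, hd.le⟩⟩, this.2 s ⟨ha.le, hb.le⟩⟩
  refine ⟨u, fun i => ⟨fun s t hst => ?_, fun t => (key i t (t + 1) (lt_add_one t)).2⟩⟩
  rcases lt_trichotomy s t with h | h | h
  · exact absurd hst (key i s t h).1
  · exact h
  · exact absurd hst.symm (key i t s h).1
end

theorem exists_continuous_extension_of_tendsto_zero {E X Y : Type} [NormedAddCommGroup E]
    [TopologicalSpace X] [T2Space X] [LocallyCompactSpace X] [TopologicalSpace Y] [Zero Y]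
    [TietzeExtension.{0, 0} Y] {w : X → E} (hw : Continuous w) (hwi : Function.Injective w)
    (hw0 : ∀ x, w x ≠ 0) (hwt : Tendsto w (coclosedCompact X) (𝓝 0)) {δ : X → Y}
    (hδ : Continuous δ) (hδt : Tendsto δ (coclosedCompact X) (𝓝 0)) :
    ∃ φ : E → Y, Continuous φ ∧ φ 0 = 0 ∧ ∀ x, φ (w x) = δ x := by
  let W := OnePoint.continuousMapMk ⟨w, hw⟩ 0 hwt
  let D := OnePoint.continuousMapMk ⟨δ, hδ⟩ 0 hδt
  have hW : IsClosedEmbedding W := by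
    refine W.continuous.isClosedEmbedding ?_
    intro x y h
    induction x using OnePoint.rec <;> induction y using OnePoint.rec
    · rfl
    · exact absurd h.symm (hw0 _)
    · exact absurd h (hw0 _)
    · exact congrArg _ (hwi h)
  obtain ⟨φ, hφ⟩ := D.exists_extension hW
  exact ⟨φ, φ.continuous, DFunLike.congr_fun hφ OnePoint.infty,
    fun x => DFunLike.congr_fun hφ (x : OnePoint X)⟩

/-- The shear `(x, y) ↦ (x + p y, y)` followed by the shear `(x, y) ↦ (x, y + φ x)`. -/
def shearHomeomorph {E : Type*} [NormedAddCommGroup E] {p : ℝ → E} (hp : Continuous p)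
    {φ : E → ℝ} (hφ : Continuous φ) : E × ℝ ≃ₜ E × ℝ where
  toFun x := (x.1 + p x.2, x.2 + φ (x.1 + p x.2))
  invFun x := (x.1 - p (x.2 - φ x.1), x.2 - φ x.1)
  left_inv x := by simp
  right_inv x := by simp
  continuous_toFun := by fun_prop
  continuous_invFun := by fun_prop

/-- The inversion in the unit sphere, fixing the origin. -/
noncomputable def inversion₀ {V : Type*} [NormedAddCommGroup V] [NormedSpace ℝ V] (x : V) : V :=
  (‖x‖ ^ 2)⁻¹ • x

section
variable {V : Type*} [NormedAddCommGroup V] [NormedSpace ℝ V]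

theorem inversion₀_zero : inversion₀ (0 : V) = 0 := smul_zero _

theorem norm_inversion₀ (x : V) : ‖inversion₀ x‖ = ‖x‖⁻¹ := by
  rcases eq_or_ne x 0 with rfl | hx
  · simp [inversion₀]
  · have := norm_ne_zero_iff.2 hx
    rw [inversion₀, norm_smul, norm_inv, norm_pow, norm_norm]
    field_simp

theorem inversion₀_inversion₀ (x : V) : inversion₀ (inversion₀ x) = x := by
  rcases eq_or_ne x 0 with rfl | hx
  · simp [inversion₀]
  · have := norm_ne_zero_iff.2 hx
    rw [inversion₀, norm_inversion₀, inversion₀, smul_smul]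
    have h : ((‖x‖⁻¹) ^ 2)⁻¹ * (‖x‖ ^ 2)⁻¹ = 1 := by field_simp
    rw [h, one_smul]

theorem inversion₀_ne_zero {x : V} (hx : x ≠ 0) : inversion₀ x ≠ 0 := fun h =>
  hx (by rw [← inversion₀_inversion₀ x, h, inversion₀_zero])

theorem continuousAt_inversion₀ {x : V} (hx : x ≠ 0) : ContinuousAt inversion₀ x := by
  have : ‖x‖ ^ 2 ≠ 0 := pow_ne_zero _ (norm_ne_zero_iff.2 hx)
  exact ContinuousAt.smul (f := fun x : V => (‖x‖ ^ 2)⁻¹)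
    (ContinuousAt.inv₀ (by fun_prop) this) continuousAt_id

theorem tendsto_inversion₀_cobounded :
    Tendsto (inversion₀ : V → V) (Bornology.cobounded V) (𝓝 0) := by
  rw [tendsto_zero_iff_norm_tendsto_zero]
  simp only [norm_inversion₀]
  exact tendsto_inv_atTop_zero.comp tendsto_norm_cobounded_atTop

theorem tendsto_inversion₀_nhdsNE :
    Tendsto (inversion₀ : V → V) (𝓝[≠] 0) (Bornology.cobounded V) := by
  rw [← tendsto_norm_atTop_iff_cobounded]
  simp only [norm_inversion₀]
  exact tendsto_inv_nhdsGT_zero.comp tendsto_norm_nhdsNE_zero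

theorem Topology.IsOpenEmbedding.inversion₀_comp {X : Type*} [TopologicalSpace X] {θ : X → V}
    (hθ : IsOpenEmbedding θ) (h0 : ∀ x, θ x ≠ 0) :
    IsOpenEmbedding fun x => inversion₀ (θ x) := by
  refine .of_continuous_injective_isOpenMap ?_ ?_ ?_
  · exact continuous_iff_continuousAt.2 fun x =>
      (continuousAt_inversion₀ (h0 x)).comp hθ.continuous.continuousAt
  · exact (Function.LeftInverse.injective inversion₀_inversion₀).comp hθ.injective
  · intro U hU
    have : (fun x => inversion₀ (θ x)) '' U = inversion₀ ⁻¹' (θ '' U) := by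
      ext y
      constructor
      · rintro ⟨x, hx, rfl⟩
        exact ⟨x, hx, (inversion₀_inversion₀ _).symm⟩
      · rintro ⟨x, hx, h⟩
        exact ⟨x, hx, by simp only [h, inversion₀_inversion₀]⟩
    rw [this, isOpen_iff_mem_nhds]
    rintro y ⟨x, hx, h⟩
    refine (continuousAt_inversion₀ (fun hy => h0 x ?_)).preimage_mem_nhds
      ((hθ.isOpenMap _ hU).mem_nhds ⟨x, hx, h⟩)
    rw [h, hy, inversion₀_zero]

/-- Conjugating by the inversion a homeomorphism fixing the origin. -/
theorem exists_homeomorph_inversion₀ [ProperSpace V] (H : V ≃ₜ V) (h0 : H 0 = 0) :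
    ∃ Ψ : V ≃ₜ V, ∀ x, Ψ x = inversion₀ (H (inversion₀ x)) := by
  have key : ∀ H : V ≃ₜ V, H 0 = 0 → Continuous fun x => inversion₀ (H (inversion₀ x)) := by
    intro H h0
    refine continuous_iff_continuousAt.2 fun x => ?_
    rcases eq_or_ne x 0 with rfl | hx
    · rw [← continuousWithinAt_compl_self, ContinuousWithinAt, inversion₀_zero, h0, inversion₀_zero]
      refine tendsto_inversion₀_cobounded.comp (Tendsto.comp ?_ tendsto_inversion₀_nhdsNE)
      rw [cobounded_eq_cocompact]
      exact H.isClosedEmbedding.tendsto_cocompact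
    · have h1 := inversion₀_ne_zero hx
      have h2 : H (inversion₀ x) ≠ 0 := fun h => h1 (H.injective (h.trans h0.symm))
      exact ContinuousAt.comp (f := fun x => H (inversion₀ x)) (continuousAt_inversion₀ h2)
        (H.continuous.continuousAt.comp (continuousAt_inversion₀ hx))
  refine ⟨{ toFun := fun x => inversion₀ (H (inversion₀ x))
            invFun := fun x => inversion₀ (H.symm (inversion₀ x))
            left_inv := fun x => by simp [inversion₀_inversion₀]
            right_inv := fun x => by simp [inversion₀_inversion₀]
            continuous_toFun := key H h0
            continuous_invFun := key H.symm (by rw [H.symm_apply_eq, h0]) }, fun x => rfl⟩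
end

theorem canEngulf_of_ray {V : Type*} [NormedAddCommGroup V] [NormedSpace ℝ V] [ProperSpace V]
    {T A B : Set V} (hT : IsOpen T) {c v : V} (hc : ∀ s : ℝ, 0 ≤ s → c + s • v ∈ T)
    (hB : IsCompact B) (hA : ∀ x ∈ A, x ∈ B ∨ ∃ s : ℝ, 0 ≤ s ∧ x = c + s • v) :
    CanEngulf T A := by
  obtain ⟨ε, hε, hεT⟩ := Metric.isOpen_iff.1 hT c (by simpa using hc 0 le_rfl)
  obtain ⟨R, hR⟩ := hB.isBounded.subset_closedBall c
  set δ := ε / 2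
  set R' := max R δ
  have hδ : 0 < δ := half_pos hε
  have hδ' : δ < R' + 1 := lt_of_le_of_lt (le_max_right _ _) (lt_add_one _)
  have hR' : 0 < R' := hδ.trans_le (le_max_right _ _)
  have hR'' : R' < R' + 1 := lt_add_one _
  have h0 : ∀ b b' : ℝ, plMap 0 b b' (R' + 1) 0 = 0 := fun b b' => plMap_of_le le_rfl
  have hnn : ∀ {b b' : ℝ}, 0 < b → b < R' + 1 → 0 < b' → b' < R' + 1 → ∀ t, 0 ≤ t →
      0 ≤ plMap 0 b b' (R' + 1) t := by
    intro b b' h1 h2 h3 h4 t ht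
    have := plMap_mono h1 h2 h3 h4 ht
    rwa [plMap_of_le le_rfl] at this
  have hcont : ∀ b b' : ℝ, 0 < b → b < R' + 1 →
      Continuous (radialMap (V := V) (plMap 0 b b' (R' + 1))) := fun b b' hb hb' =>
    (continuous_radialMap (V := V) (S := Unit) (θ := fun _ => plMap 0 b b' (R' + 1))
      (continuous_plMap (β := fun _ => b) (β' := fun _ => b') continuous_const continuous_const
        (fun _ => hb) fun _ => hb') fun _ => h0 _ _).comp
      ((continuous_const (y := ())).prodMk continuous_id)
  let g : V ≃ₜ V :=
    { toFun := radialMap (plMap 0 δ R' (R' + 1))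
      invFun := radialMap (plMap 0 R' δ (R' + 1))
      left_inv := radialMap_radialMap (h0 _ _) (h0 _ _) (hnn hδ hδ' hR' hR'')
        fun t _ => plMap_inv hδ hδ' hR' hR'' t
      right_inv := radialMap_radialMap (h0 _ _) (h0 _ _) (hnn hR' hR'' hδ hδ')
        fun t _ => plMap_inv hR' hR'' hδ hδ' t
      continuous_toFun := hcont _ _ hδ hδ'
      continuous_invFun := hcont _ _ hR' hR'' }
  refine CanEngulf.of_conj (Homeomorph.addRight (-c)) ⟨g, ⟨closedBall 0 (R' + 1),
    isCompact_closedBall _ _, fun x hx => radialMap_of_eq (plMap_of_ge hδ hδ' ?_)⟩, ?_⟩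
  · rw [mem_closedBall_zero_iff, not_le] at hx
    exact hx.le
  · rintro _ ⟨x, hx, rfl⟩
    refine ⟨g.symm (x + -c), ⟨g.symm (x + -c) + c, ?_, by simp⟩, g.apply_symm_apply _⟩
    change radialMap (plMap 0 R' δ (R' + 1)) (x + -c) + c ∈ T
    rcases hA x hx with h | ⟨s, hs, rfl⟩
    · refine hεT ?_
      have h1 : ‖x + -c‖ ≤ R' := by
        rw [← sub_eq_add_neg, ← dist_eq_norm]
        exact (hR h).trans (le_max_left _ _)
      rw [mem_ball, dist_eq_norm, add_sub_cancel_right,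
        norm_radialMap (h0 _ _) (hnn hR' hR'' hδ hδ' _ (norm_nonneg _))]
      have := plMap_mono hR' hR'' hδ hδ' h1
      rw [plMap_self hR'] at this
      exact this.trans_lt (half_lt_self hε)
    · rw [add_comm c, add_neg_cancel_right, radialMap, smul_smul, add_comm]
      refine hc _ (mul_nonneg (div_nonneg (hnn hR' hR'' hδ hδ' _ (norm_nonneg _))
        (norm_nonneg _)) hs)

theorem tendsto_val_Iic_atBot (M : ℝ) :
    Tendsto (Subtype.val : Iic M → ℝ) (coclosedCompact (Iic M)) atBot := by
  rw [coclosedCompact_eq_cocompact, tendsto_atBot]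
  intro b
  refine mem_of_superset (IsCompact.compl_mem_cocompact
    ((isClosed_Iic (a := M)).isClosedEmbedding_subtypeVal.isCompact_preimage
      (isCompact_Icc (a := b) (b := M)))) fun x hx => ?_
  by_contra h
  exact hx ⟨(not_le.1 h).le, x.2⟩

theorem IsProperTube.homeomorph_comp {E F F' : Type*} [NormedAddCommGroup E] [TopologicalSpace F]
    [TopologicalSpace F'] {τ : E × ℝ → F} (hτ : IsProperTube τ) (N : F ≃ₜ F') :
    IsProperTube (N ∘ τ) := by
  refine ⟨N.isOpenEmbedding.comp hτ.isOpenEmbedding, fun K hK ρ => ?_⟩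
  obtain ⟨a, ha⟩ := hτ.exists_notMem (N.symm '' K) (hK.image N.symm.continuous) ρ
  exact ⟨a, fun x hx hxa h => ha x hx hxa ⟨_, h, N.symm_apply_apply _⟩⟩

section
variable {E : Type} [NormedAddCommGroup E] [NormedSpace ℝ E] [FiniteDimensional ℝ E]

/-- A tube avoiding the origin engulfs the pieces of its core, if the latter is in general position
with respect to the vertical direction, as seen from the origin. -/
theorem IsProperTube.canEngulf_core {τ : E × ℝ → E × ℝ} (hτ : IsProperTube τ)
    (hτi : Function.Injective fun t => (inversion₀ (τ (0, t))).1)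
    (hτ0 : ∀ t, (inversion₀ (τ (0, t))).1 ≠ 0) {B : Set (E × ℝ)} (hB : IsCompact B) (M : ℝ) :
    CanEngulf (range τ) (B ∪ (fun t => τ (0, t)) '' Iic M) := by
  have : ProperSpace E := FiniteDimensional.proper ℝ E
  have : LocallyCompactSpace (Iic M) :=
    (isClosed_Iic (a := M)).isClosedEmbedding_subtypeVal.locallyCompactSpace
  have hr0 : ∀ t, τ (0, t) ≠ 0 := fun t h => hτ0 t (by rw [h, inversion₀_zero]; rfl)
  have hr : Continuous fun t : ℝ => τ (0, t) := hτ.isOpenEmbedding.continuous.comp (by fun_prop)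
  have hα : Continuous fun t => inversion₀ (τ (0, t)) := continuous_iff_continuousAt.2 fun t =>
    ContinuousAt.comp (f := fun t => τ (0, t)) (continuousAt_inversion₀ (hr0 t)) hr.continuousAt
  have hαt : Tendsto (fun t => inversion₀ (τ (0, t))) atBot (𝓝 0) := by
    refine tendsto_inversion₀_cobounded.comp ?_
    rw [cobounded_eq_cocompact]
    refine hasBasis_cocompact.tendsto_right_iff.2 fun K hK => ?_
    obtain ⟨a, ha⟩ := hτ.exists_notMem K hK 0
    filter_upwards [Iic_mem_atBot a] with t ht using ha _ (by simp) ht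
  have hw : Continuous fun t : Iic M => (inversion₀ (τ (0, t))).1 :=
    continuous_fst.comp (hα.comp continuous_subtype_val)
  have hαt' := hαt.comp (tendsto_val_Iic_atBot M)
  have hwt : Tendsto (fun t : Iic M => (inversion₀ (τ (0, t))).1) (coclosedCompact _) (𝓝 0) :=
    (continuous_fst.tendsto _).comp hαt'
  have hvt : Tendsto (fun t : Iic M => (inversion₀ (τ (0, t))).2) (coclosedCompact _) (𝓝 0) :=
    (continuous_snd.tendsto _).comp hαt'
  have hjt : Tendsto (fun t : Iic M => Real.exp t) (coclosedCompact _) (𝓝 0) :=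
    Real.tendsto_exp_atBot.comp (tendsto_val_Iic_atBot M)
  have hwi : Function.Injective fun t : Iic M => (inversion₀ (τ (0, t))).1 :=
    hτi.comp Subtype.val_injective
  obtain ⟨φ, hφ, hφ0, hφw⟩ := exists_continuous_extension_of_tendsto_zero hw hwi
    (fun t => hτ0 t) hwt (δ := fun t : Iic M => (inversion₀ (τ (0, t))).2 - Real.exp t)
    ((continuous_snd.comp (hα.comp continuous_subtype_val)).sub (by fun_prop))
    (by simpa using hvt.sub hjt)
  have : TietzeExtension.{0, 0} E := TietzeExtension.of_tvs ℝ
  obtain ⟨p, hp, hp0, hpw⟩ := exists_continuous_extension_of_tendsto_zero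
    (w := fun t : Iic M => Real.exp t) (by fun_prop)
    (Real.exp_injective.comp Subtype.val_injective) (fun t => (Real.exp_pos _).ne') hjt hw hwt
  obtain ⟨Ψ, hΨ⟩ := exists_homeomorph_inversion₀ (shearHomeomorph hp hφ).symm (by
    change ((0 : E × ℝ).1 - p ((0 : E × ℝ).2 - φ (0 : E × ℝ).1), (0 : E × ℝ).2 - φ (0 : E × ℝ).1) = 0
    simp [hφ0, hp0])
  have key : ∀ t ≤ M, Ψ (τ (0, t)) = (0, Real.exp (-t)) := by
    intro t ht
    have h1 : (shearHomeomorph hp hφ).symm (inversion₀ (τ (0, t))) = (0, Real.exp t) := by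
      have h2 := hφw ⟨t, ht⟩
      have h3 := hpw ⟨t, ht⟩
      simp only at h2 h3
      change ((inversion₀ (τ (0, t))).1 - p ((inversion₀ (τ (0, t))).2 -
        φ (inversion₀ (τ (0, t))).1), (inversion₀ (τ (0, t))).2 - φ (inversion₀ (τ (0, t))).1) = _
      rw [h2, sub_sub_cancel, h3, sub_self]
    rw [hΨ, h1, inversion₀, Prod.norm_def, norm_zero, max_eq_right (norm_nonneg _),
      Real.norm_of_nonneg (Real.exp_pos _).le, Prod.smul_mk, smul_zero, smul_eq_mul, Real.exp_neg]
    have := Real.exp_pos t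
    congr 1
    field_simp
  refine CanEngulf.of_conj Ψ (canEngulf_of_ray (c := (0, Real.exp (-M))) (v := (0, 1))
    (B := Ψ '' B) (Ψ.isOpenMap _ hτ.isOpenEmbedding.isOpen_range) (fun s hs => ?_)
    (hB.image Ψ.continuous) ?_)
  · have h1 : 0 < Real.exp (-M) + s := add_pos_of_pos_of_nonneg (Real.exp_pos _) hs
    refine ⟨_, ⟨(0, -Real.log (Real.exp (-M) + s)), rfl⟩, ?_⟩
    rw [key, neg_neg, Real.exp_log h1]
    · simp
    · rw [neg_le, Real.le_log_iff_exp_le h1]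
      linarith
  · rintro _ ⟨x, hx | ⟨t, ht, rfl⟩, rfl⟩
    · exact Or.inl ⟨x, hx, rfl⟩
    · refine Or.inr ⟨Real.exp (-t) - Real.exp (-M), sub_nonneg.2 (Real.exp_le_exp.2 ?_), ?_⟩
      · exact neg_le_neg ht
      · simp only [key t ht]
        simp

theorem tendsto_inv_one_add_sq : Tendsto (fun t : ℝ => (1 + t ^ 2)⁻¹) (cocompact ℝ) (𝓝 0) := by
  refine tendsto_inv_atTop_zero.comp (tendsto_atTop_add_const_left _ _ ?_)
  have := (tendsto_pow_atTop (α := ℝ) two_ne_zero).comp (tendsto_norm_cocompact_atTop (E := ℝ))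
  refine this.congr fun t => ?_
  simp

theorem exists_homeomorph_perturbedLine {u : BoundedContinuousFunction ℝ (E × ℝ)}
    (hu : Function.Injective fun t => (perturbedLine u t).1) (hu0 : ∀ t, (perturbedLine u t).1 ≠ 0) :
    ∃ k : E × ℝ ≃ₜ E × ℝ, (∀ t, k (0, t) = perturbedLine u t) ∧
      (∀ ρ : ℝ, ∃ C, ∀ x, ‖x.1‖ ≤ ρ → ‖(k x).1‖ ≤ C ∧ (k x).2 ≤ x.2 + C) ∧
      ∀ ρ : ℝ, ∃ C, ∀ x, ‖x.1‖ ≤ ρ → ‖(k.symm x).1‖ ≤ C ∧ (k.symm x).2 ≤ x.2 + C := by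
  have : ProperSpace E := FiniteDimensional.proper ℝ E
  have hy : Continuous (perturbedLine u) :=
    continuous_perturbedLine.comp (continuous_const.prodMk continuous_id)
  have hle : ∀ t, ‖(1 + t ^ 2)⁻¹ • u t‖ ≤ (1 + t ^ 2)⁻¹ * ‖u‖ := fun t => by
    rw [norm_smul, Real.norm_of_nonneg (by positivity)]
    exact mul_le_mul_of_nonneg_left (u.norm_coe_le_norm t) (by positivity)
  have ht : Tendsto (fun t => (1 + t ^ 2)⁻¹ • u t) (coclosedCompact ℝ) (𝓝 0) := by
    rw [coclosedCompact_eq_cocompact]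
    exact squeeze_zero_norm hle (by simpa using tendsto_inv_one_add_sq.mul_const ‖u‖)
  have h1 : ∀ t, (perturbedLine u t).1 = ((1 + t ^ 2)⁻¹ • u t).1 := fun t => by
    simp [perturbedLine]
  have h2 : ∀ t, (perturbedLine u t).2 - t = ((1 + t ^ 2)⁻¹ • u t).2 := fun t => by
    simp [perturbedLine]
  have hw := continuous_fst.comp hy
  obtain ⟨φ, hφ, -, hφw⟩ := exists_continuous_extension_of_tendsto_zero hw hu hu0
    (((continuous_fst.tendsto _).comp ht).congr fun t => (h1 t).symm)
    (δ := fun t => (perturbedLine u t).2 - t) ((continuous_snd.comp hy).sub continuous_id)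
    (((continuous_snd.tendsto _).comp ht).congr fun t => (h2 t).symm)
  have hwb : ∀ t, ‖(perturbedLine u t).1‖ ≤ ‖u‖ := fun t => by
    rw [h1]
    refine (norm_fst_le _).trans ((hle t).trans (mul_le_of_le_one_left (norm_nonneg _) ?_))
    exact inv_le_one_of_one_le₀ (by nlinarith [sq_nonneg t])
  have hφb : ∀ ρ : ℝ, ∃ C, ∀ x : E, ‖x‖ ≤ ρ → ‖φ x‖ ≤ C := fun ρ => by
    obtain ⟨C, hC⟩ := ((isCompact_closedBall (0 : E) ρ).image hφ.norm).bddAbove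
    exact ⟨C, fun x hx => hC ⟨x, by simpa using hx, rfl⟩⟩
  refine ⟨shearHomeomorph hw hφ, fun t => ?_, fun ρ => ?_, fun ρ => ?_⟩
  · change (0 + (perturbedLine u t).1, t + φ (0 + (perturbedLine u t).1)) = _
    have := hφw t
    simp only [Function.comp_apply] at this
    rw [zero_add, this, add_sub_cancel]
  · obtain ⟨C, hC⟩ := hφb (ρ + ‖u‖)
    refine ⟨max C (ρ + ‖u‖), fun x hx => ?_⟩
    have h3 : ‖x.1 + (perturbedLine u x.2).1‖ ≤ ρ + ‖u‖ :=
      (norm_add_le _ _).trans (add_le_add hx (hwb _))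
    exact ⟨h3.trans (le_max_right _ _), add_le_add_right ((Real.le_norm_self _).trans
      ((hC _ h3).trans (le_max_left _ _))) _⟩
  · obtain ⟨C, hC⟩ := hφb ρ
    refine ⟨max C (ρ + ‖u‖), fun x hx => ?_⟩
    refine ⟨((norm_sub_le _ _).trans (add_le_add hx (hwb _))).trans (le_max_right _ _), ?_⟩
    change x.2 - φ x.1 ≤ _
    have := (neg_le_abs (φ x.1)).trans ((hC _ hx).trans (le_max_left C (ρ + ‖u‖)))
    linarith

theorem IsProperTube.exists_engulf {τ : E × ℝ → E × ℝ} (hE : 2 < Module.finrank ℝ E)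
    (hτ : IsProperTube τ) (h0 : ∀ x, τ x ≠ 0) {B : Set (E × ℝ)} (hB : IsCompact B) (ρ : ℝ) :
    CanEngulf (range τ) (B ∪ τ '' {x | ‖x.1‖ ≤ ρ ∧ x.2 ≤ ρ}) := by
  obtain ⟨u, hu⟩ := exists_perturbedLine hE (ι := Bool)
    (θ := fun i => if i then id else fun x => inversion₀ (τ x)) (fun i => by
      cases i
      · simpa using hτ.isOpenEmbedding.inversion₀_comp h0
      · simpa using IsOpenEmbedding.id)
  obtain ⟨k, hk, hkC, hkC'⟩ := exists_homeomorph_perturbedLine (u := u)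
    (by simpa using (hu true).1) (by simpa using (hu true).2)
  have hτk : IsProperTube (τ ∘ k) := by
    refine ⟨hτ.isOpenEmbedding.comp k.isOpenEmbedding, fun K hK ρ => ?_⟩
    obtain ⟨C, hC⟩ := hkC ρ
    obtain ⟨a, ha⟩ := hτ.exists_notMem K hK C
    refine ⟨a - C, fun x hx hxa => ha _ (hC x hx).1 ?_⟩
    linarith [(hC x hx).2]
  have hrange : range (τ ∘ k) = range τ := k.surjective.range_comp τ
  obtain ⟨C, hC⟩ := hkC' ρ
  obtain ⟨g, hg, hgB, hgτ⟩ := hτk.exists_engulf_of_core (fun B hB M => by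
    obtain ⟨g, hg, hgA⟩ := hτk.canEngulf_core (by simpa [hk] using (hu false).1)
      (by simpa [hk] using (hu false).2) hB M
    exact ⟨g, hg, fun x hx => hgA (Or.inl hx), fun t ht => hgA (Or.inr ⟨t, ht, rfl⟩)⟩) hB
    (ρ := max C 1) (M := ρ + C) (by positivity)
  rw [hrange] at hgB hgτ
  refine ⟨g, hg, union_subset hgB ?_⟩
  rintro _ ⟨x, hx, rfl⟩
  have := hgτ (k.symm x) ((hC x hx.1).1.trans (le_max_left _ _)) (by linarith [(hC x hx.1).2, hx.2])
  simpa using this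

theorem engulfsTubes_of_two_lt_finrank (hE : 2 < Module.finrank ℝ E) : EngulfsTubes E := by
  intro τ hτ B hB ρ
  suffices CanEngulf (range τ) (B ∪ τ '' {x | ‖x.1‖ ≤ ρ ∧ x.2 ≤ ρ}) by
    obtain ⟨g, hg, hA⟩ := this
    exact ⟨g, hg, fun x hx => hA (Or.inl hx), fun x hx hx' => hA (Or.inr ⟨x, ⟨hx, hx'⟩, rfl⟩)⟩
  by_cases h : range τ = univ
  · exact ⟨Homeomorph.refl _, ⟨∅, isCompact_empty, fun _ _ => rfl⟩, by simp [h]⟩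
  · obtain ⟨p, hp⟩ := (ne_univ_iff_exists_notMem _).1 h
    refine CanEngulf.of_conj (Homeomorph.addRight (-p)) ?_
    rw [← range_comp, image_union, ← image_comp]
    refine (hτ.homeomorph_comp (Homeomorph.addRight (-p))).exists_engulf hE (fun x hx => hp ⟨x, ?_⟩)
      (hB.image (Homeomorph.continuous _)) ρ
    simpa [add_neg_eq_zero] using hx
end

/-- Some compactly supported homeomorphism fixing `D` pointwise makes `U` swallow `A`. -/
def RelEngulf {X : Type*} [TopologicalSpace X] (D U A : Set X) : Prop :=
  ∃ g : X ≃ₜ X, (∃ Q, IsCompact Q ∧ ∀ x, x ∉ Q → g x = x) ∧ (∀ x ∈ D, g x = x) ∧ A ⊆ g '' U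

/-- Every open neighbourhood of `N` swallows `B`, fixing any given closed set that meets `B` only
in `N`. -/
def Expandable {X : Type*} [TopologicalSpace X] (N B : Set X) : Prop :=
  N ⊆ B ∧ ∀ U, IsOpen U → N ⊆ U → ∀ C, IsClosed C → C ∩ B ⊆ N → RelEngulf C U B

section
variable {X : Type*} [TopologicalSpace X] {D U A A' N B : Set X}

theorem RelEngulf.mono (h : RelEngulf D U A) (hA : A' ⊆ A) : RelEngulf D U A' := by
  obtain ⟨g, h1, h2, h3⟩ := h
  exact ⟨g, h1, h2, hA.trans h3⟩

theorem relEngulf_of_subset (h : A ⊆ U) : RelEngulf D U A :=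
  ⟨Homeomorph.refl X, ⟨∅, isCompact_empty, fun _ _ => rfl⟩, fun _ _ => rfl, fun x hx => ⟨x, h hx, rfl⟩⟩

theorem RelEngulf.union (h : RelEngulf D U A) (hN : Expandable N B) (hU : IsOpen U)
    (hD : IsClosed D) (hA : IsClosed A) (hNA : N ⊆ A) (hB : (A ∪ D) ∩ B ⊆ N) :
    RelEngulf D U (A ∪ B) := by
  obtain ⟨g, ⟨Q, hQ, hgQ⟩, hgD, hgA⟩ := h
  obtain ⟨f, ⟨R, hR, hfR⟩, hfC, hfB⟩ := hN.2 (g '' U) (g.isOpenMap U hU) (hNA.trans hgA) (A ∪ D)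
    (hA.union hD) hB
  refine ⟨g.trans f, ⟨Q ∪ R, hQ.union hR, fun x hx => ?_⟩, fun x hx => ?_, ?_⟩
  · rw [Homeomorph.trans_apply, hgQ x fun h => hx (Or.inl h), hfR x fun h => hx (Or.inr h)]
  · rw [Homeomorph.trans_apply, hgD x hx, hfC x (Or.inr hx)]
  · rintro x (hx | hx)
    · obtain ⟨y, hy, rfl⟩ := hgA hx
      exact ⟨y, hy, hfC _ (Or.inl hx)⟩
    · obtain ⟨_, ⟨y, hy, rfl⟩, rfl⟩ := hfB hx
      exact ⟨y, hy, rfl⟩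

theorem Expandable.preimage {Y : Type*} [TopologicalSpace Y] (φ : Y ≃ₜ X) (h : Expandable N B) :
    Expandable (φ ⁻¹' N) (φ ⁻¹' B) := by
  refine ⟨preimage_mono h.1, fun U hU hNU C hC hCB => ?_⟩
  obtain ⟨g, ⟨Q, hQ, hgQ⟩, hgC, hgB⟩ := h.2 (φ '' U) (φ.isOpenMap U hU)
    (fun x hx => ⟨φ.symm x, hNU (by simpa using hx), by simp⟩) (φ '' C) (φ.isClosedMap C hC) (by
      rintro _ ⟨⟨x, hx, rfl⟩, hx'⟩
      exact hCB ⟨hx, hx'⟩)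
  refine ⟨(φ.trans g).trans φ.symm, ⟨φ.symm '' Q, hQ.image φ.symm.continuous, fun x hx => ?_⟩,
    fun x hx => ?_, fun x hx => ?_⟩
  · rw [Homeomorph.trans_apply, Homeomorph.trans_apply, hgQ, φ.symm_apply_apply]
    exact fun h => hx ⟨_, h, φ.symm_apply_apply x⟩
  · rw [Homeomorph.trans_apply, Homeomorph.trans_apply, hgC _ (mem_image_of_mem _ hx),
      φ.symm_apply_apply]
  · obtain ⟨_, ⟨y, hy, rfl⟩, hyx⟩ := hgB hx
    refine ⟨y, hy, ?_⟩
    rw [Homeomorph.trans_apply, Homeomorph.trans_apply, hyx, φ.symm_apply_apply]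

end

theorem plMap_le_self {a b b' c : ℝ} (hab : a < b) (hbc : b < c) (hb : b' ≤ b) (t : ℝ) :
    plMap a b b' c t ≤ t := by
  rcases le_or_gt t a with h1 | h1
  · rw [plMap_of_le h1]
  rcases le_or_gt c t with h2 | h2
  · rw [plMap_of_ge hab hbc h2]
  rcases le_or_gt t b with h3 | h3
  · have h4 : 0 < b - a := by linarith
    rw [plMap_mem_lower h1.le h3]
    have h5 : (b' - a) / (b - a) ≤ 1 := (div_le_one h4).2 (by linarith)
    linarith [mul_le_mul_of_nonneg_left h5 (by linarith : 0 ≤ t - a)]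
  · have h4 : 0 < c - b := by linarith
    rw [plMap_mem_upper hab hbc h3.le h2.le]
    have h5 : 1 ≤ (c - b') / (c - b) := (one_le_div h4).2 (by linarith)
    linarith [mul_le_mul_of_nonneg_left h5 (by linarith : 0 ≤ c - t)]

theorem exists_push {X0 X1 : Set ℝ} (hX0 : IsCompact X0) (hX1 : IsCompact X1)
    (h01 : X0 ⊆ interior X1) {a b : ℝ} (ha : 0 < a) (hab : a < b) (hb : b < 1) {C : Set (ℝ × ℝ)}
    (hC : IsClosed C) (hCX : ∀ x ∈ X1, ∀ t ∈ Icc a 1, (x, t) ∉ C) :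
    ∃ g : ℝ × ℝ ≃ₜ ℝ × ℝ, (∃ Q, IsCompact Q ∧ ∀ x, x ∉ Q → g x = x) ∧ (∀ x ∈ C, g x = x) ∧
      ∀ x t, 0 ≤ t → t ≤ 1 → ∃ s, g (x, s) = (x, t) ∧ 0 ≤ s ∧ s ≤ t ∧ (x ∈ X0 → s ≤ b) := by
  obtain ⟨u, v, -, hv, hu', hv', huv⟩ := generalized_tube_lemma hX1 (isCompact_Icc (a := a) (b := 1))
    hC.isOpen_compl (fun x hx => hCX x.1 hx.1 x.2 hx.2)
  obtain ⟨δ, hδ, hδv⟩ := Metric.isOpen_iff.1 hv 1 (hv' ⟨by linarith, le_rfl⟩)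
  obtain ⟨f, hf1, hf0, -, hf⟩ := exists_continuous_one_zero_of_isCompact hX0
    (isOpen_interior (s := X1)).isClosed_compl (disjoint_compl_right_iff_subset.2 h01)
  set c := 1 + δ / 2 with hc
  set β' : ℝ → ℝ := fun x => b + f x * (1 + δ / 4 - b) with hβ'
  have hbc : b < c := by linarith
  have hbβ : ∀ x, b ≤ β' x := fun x => by
    have := mul_nonneg (hf x).1 (by linarith : 0 ≤ 1 + δ / 4 - b)
    simp only [hβ']; linarith
  have hβc : ∀ x, β' x < c := fun x => by
    have := mul_le_mul_of_nonneg_right (hf x).2 (by linarith : 0 ≤ 1 + δ / 4 - b)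
    simp only [hβ']; linarith
  have haβ : ∀ x, a < β' x := fun x => hab.trans_le (hbβ x)
  have hfix : ∀ x : ℝ × ℝ, x ∉ X1 ×ˢ Icc a c → plMap a b (β' x.1) c x.2 = x.2 := by
    intro x hx
    rcases le_or_gt x.2 a with h | h
    · exact plMap_of_le h
    rcases le_or_gt c x.2 with h' | h'
    · exact plMap_of_ge hab hbc h'
    have h1 : x.1 ∉ X1 := fun h1 => hx ⟨h1, h.le, h'.le⟩
    have h2 : β' x.1 = b := by
      have : f x.1 = 0 := hf0 fun h2 => h1 (interior_subset h2)
      simp [hβ', this]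
    rw [h2, plMap_eq_self hab hbc]
  refine ⟨plHomeomorph (S := ℝ) a c (β := fun _ => b) (β' := β') continuous_const
    (by fun_prop) (fun _ => hab) (fun _ => hbc) haβ hβc, ⟨X1 ×ˢ Icc a c, hX1.prod isCompact_Icc,
    fun x hx => Prod.ext rfl (hfix x hx)⟩, fun x hx => Prod.ext rfl (hfix x ?_), fun x t h0 h1 => ?_⟩
  · rintro ⟨h1, h2, h3⟩
    have : x.2 ∈ v := by
      rcases le_or_gt x.2 1 with h | h
      · exact hv' ⟨h2, h⟩
      · refine hδv ?_
        rw [Metric.mem_ball, Real.dist_eq, abs_lt]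
        constructor <;> linarith
    exact huv (a := x) ⟨hu' h1, this⟩ hx
  · refine ⟨plMap a (β' x) b c t, Prod.ext rfl (plMap_inv (haβ x) (hβc x) hab hbc t), ?_,
      plMap_le_self (haβ x) (hβc x) (hbβ x) t, fun hx => ?_⟩
    · rcases le_or_gt t a with h | h
      · rwa [plMap_of_le h]
      · have := plMap_mono (haβ x) (hβc x) hab hbc h.le
        rw [plMap_of_le le_rfl] at this
        exact ha.le.trans this
    · have h2 : f x = 1 := hf1 hx
      have := plMap_mono (haβ x) (hβc x) hab hbc (s := t) (t := β' x)
        (by simp only [hβ', h2]; linarith)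
      rwa [plMap_self (haβ x)] at this

theorem expandable_model_edge : Expandable ({(0, 0)} : Set (ℝ × ℝ)) ({0} ×ˢ Icc 0 1) := by
  refine ⟨by simp, fun U hU hNU C hC hCB => ?_⟩
  obtain ⟨b, hb, hbU⟩ := Metric.isOpen_iff.1 hU (0, 0) (hNU rfl)
  set b' := min b 1 with hb'
  have hb'0 : 0 < b' := lt_min hb one_pos
  obtain ⟨u, v, hu, -, hu', hv', huv⟩ := generalized_tube_lemma (isCompact_singleton (x := (0 : ℝ)))
    (isCompact_Icc (a := b' / 4) (b := 1)) hC.isOpen_compl (by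
      rintro ⟨x, t⟩ ⟨rfl, ht⟩ hx
      have := congrArg Prod.snd (hCB ⟨hx, rfl, by linarith [ht.1], ht.2⟩)
      simp only at this
      linarith [ht.1])
  obtain ⟨ε, hε, hεu⟩ := Metric.isOpen_iff.1 hu 0 (hu' rfl)
  obtain ⟨g, hg, hgC, h⟩ := exists_push (X0 := {0}) (X1 := closedBall 0 (ε / 2)) isCompact_singleton
    (isCompact_closedBall _ _) (by
      rintro _ rfl
      exact ball_subset_interior_closedBall (mem_ball_self (half_pos hε)))
    (a := b' / 4) (b := b' / 2) (by linarith) (by linarith) (by linarith [min_le_right b 1]) hC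
    (fun x hx t ht => huv (a := (x, t)) ⟨hεu (closedBall_subset_ball (half_lt_self hε) hx), hv' ht⟩)
  refine ⟨g, hg, hgC, ?_⟩
  rintro ⟨x, t⟩ ⟨rfl, ht⟩
  obtain ⟨s, hs, hs0, -, hsb⟩ := h _ t ht.1 ht.2
  refine ⟨_, hbU ?_, hs⟩
  rw [mem_ball, Prod.dist_eq, max_lt_iff]
  have := hsb rfl
  simp only at *
  rw [dist_self, Real.dist_eq, sub_zero, abs_of_nonneg hs0]
  exact ⟨hb, by linarith [min_le_left b 1]⟩

theorem expandable_model_square :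
    Expandable (Icc 0 1 ×ˢ {0} ∪ {0} ×ˢ Icc 0 1 ∪ {1} ×ˢ Icc 0 1 : Set (ℝ × ℝ))
      (Icc 0 1 ×ˢ Icc 0 1) := by
  refine ⟨?_, fun U hU hNU C hC hCB => ?_⟩
  · rintro ⟨x, t⟩ ((⟨hx, rfl⟩ | ⟨rfl, ht⟩) | ⟨rfl, ht⟩)
    · exact ⟨hx, by simp⟩
    · exact ⟨by simp, ht⟩
    · exact ⟨by simp, ht⟩
  obtain ⟨ε, hε, hεU⟩ := (((isCompact_Icc (a := (0 : ℝ)) (b := 1)).prod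
    (isCompact_singleton (x := (0 : ℝ)))).union ((isCompact_singleton (x := (0 : ℝ))).prod
    (isCompact_Icc (a := (0 : ℝ)) (b := 1))) |>.union ((isCompact_singleton (x := (1 : ℝ))).prod
    (isCompact_Icc (a := (0 : ℝ)) (b := 1)))).exists_thickening_subset_open hU hNU
  set e := min (ε / 2) (1 / 4) with he
  have he0 : 0 < e := lt_min (by linarith) (by norm_num)
  have he1 : e ≤ 1 / 4 := min_le_right _ _
  have he2 : e < ε := (min_le_left _ _).trans_lt (by linarith)
  obtain ⟨g, hg, hgC, h⟩ := exists_push (X0 := Icc e (1 - e)) (X1 := Icc (e / 2) (1 - e / 2))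
    isCompact_Icc isCompact_Icc (by
      rw [interior_Icc]
      exact fun x hx => ⟨by linarith [hx.1], by linarith [hx.2]⟩)
    (a := e / 2) (b := e) (by linarith) (by linarith) (by linarith) hC
    (fun x hx t ht hxC => by
      have := hCB ⟨hxC, ⟨by linarith [hx.1], by linarith [hx.2]⟩, by linarith [ht.1], ht.2⟩
      rcases this with (⟨-, h⟩ | ⟨h, -⟩) | ⟨h, -⟩ <;> simp only [mem_singleton_iff] at h <;>
        linarith [hx.1, hx.2, ht.1])
  refine ⟨g, hg, hgC, ?_⟩
  rintro ⟨x, t⟩ ⟨hx, ht⟩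
  simp only at hx ht
  obtain ⟨s, hs, hs0, hst, hsb⟩ := h x t ht.1 ht.2
  refine ⟨_, hεU ?_, hs⟩
  rw [mem_thickening_iff]
  have hs1 : s ≤ 1 := hst.trans ht.2
  rcases lt_or_ge x e with hxe | hxe
  · refine ⟨(0, s), Or.inl (Or.inr ⟨rfl, hs0, hs1⟩), ?_⟩
    rw [Prod.dist_eq, max_lt_iff, dist_self, Real.dist_eq, sub_zero, abs_of_nonneg hx.1]
    exact ⟨by linarith, hε⟩
  rcases lt_or_ge (1 - e) x with hxe' | hxe'
  · refine ⟨(1, s), Or.inr ⟨rfl, hs0, hs1⟩, ?_⟩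
    rw [Prod.dist_eq, max_lt_iff, dist_self, Real.dist_eq, abs_sub_comm,
      abs_of_nonneg (by linarith [hx.2])]
    exact ⟨by simp only; linarith, hε⟩
  · refine ⟨(x, 0), Or.inl (Or.inl ⟨hx, rfl⟩), ?_⟩
    rw [Prod.dist_eq, max_lt_iff, dist_self, Real.dist_eq, sub_zero, abs_of_nonneg hs0]
    exact ⟨hε, by linarith [hsb ⟨hxe, hxe'⟩]⟩

/-- The unit square of the integer grid with lower left corner `p`. -/
def gridSquare (p : ℤ × ℤ) : Set (ℝ × ℝ) := Icc (p.1 : ℝ) (p.1 + 1) ×ˢ Icc (p.2 : ℝ) (p.2 + 1)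

/-- The vertex of the integer grid with coordinates `p`. -/
def gridVertex (p : ℤ × ℤ) : ℝ × ℝ := (p.1, p.2)

/-- The horizontal unit edge of the integer grid with left endpoint `p`. -/
def gridH (p : ℤ × ℤ) : Set (ℝ × ℝ) := Icc (p.1 : ℝ) (p.1 + 1) ×ˢ {(p.2 : ℝ)}

/-- The vertical unit edge of the integer grid with lower endpoint `p`. -/
def gridV (p : ℤ × ℤ) : Set (ℝ × ℝ) := {(p.1 : ℝ)} ×ˢ Icc (p.2 : ℝ) (p.2 + 1)

theorem Expandable.of_homeomorph {X Y : Type*} [TopologicalSpace X] [TopologicalSpace Y]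
    {N B : Set X} {N' B' : Set Y} (h : Expandable N B) (φ : Y ≃ₜ X) (hN : ∀ y, y ∈ N' ↔ φ y ∈ N)
    (hB : ∀ y, y ∈ B' ↔ φ y ∈ B) : Expandable N' B' := by
  have h1 : N' = φ ⁻¹' N := Set.ext hN
  have h2 : B' = φ ⁻¹' B := Set.ext hB
  rw [h1, h2]; exact h.preimage φ

theorem expandable_gridV (p : ℤ × ℤ) : Expandable {gridVertex p} (gridV p) := by
  refine expandable_model_edge.of_homeomorph
    ((Homeomorph.subRight (p.1 : ℝ)).prodCongr (Homeomorph.subRight (p.2 : ℝ))) ?_ ?_ <;>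
  · rintro ⟨x, y⟩
    simp [gridVertex, gridV, sub_eq_zero, add_comm]

theorem expandable_gridV_up (p : ℤ × ℤ) : Expandable {gridVertex (p.1, p.2 + 1)} (gridV p) := by
  refine expandable_model_edge.of_homeomorph
    ((Homeomorph.subRight (p.1 : ℝ)).prodCongr (Homeomorph.subLeft (p.2 + 1 : ℝ))) ?_ ?_
  · rintro ⟨x, y⟩
    have h : y = p.2 + 1 ↔ 0 = p.2 + 1 - y := by constructor <;> intro h <;> linarith
    simpa [gridVertex, sub_eq_zero, eq_comm] using fun _ => h
  · rintro ⟨x, y⟩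
    simp [gridV, sub_eq_zero, add_comm, and_comm]

theorem expandable_gridH (p : ℤ × ℤ) : Expandable {gridVertex p} (gridH p) := by
  refine expandable_model_edge.of_homeomorph ((Homeomorph.prodComm ℝ ℝ).trans
    ((Homeomorph.subRight (p.2 : ℝ)).prodCongr (Homeomorph.subRight (p.1 : ℝ)))) ?_ ?_ <;>
  · rintro ⟨x, y⟩
    simp [gridVertex, gridH, sub_eq_zero, add_comm, and_comm]

theorem expandable_gridH_right (p : ℤ × ℤ) :
    Expandable {gridVertex (p.1 + 1, p.2)} (gridH p) := by
  refine expandable_model_edge.of_homeomorph ((Homeomorph.prodComm ℝ ℝ).trans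
    ((Homeomorph.subRight (p.2 : ℝ)).prodCongr (Homeomorph.subLeft (p.1 + 1 : ℝ)))) ?_ ?_
  · rintro ⟨x, y⟩
    have h : x = p.1 + 1 ↔ 0 = p.1 + 1 - x := by constructor <;> intro h <;> linarith
    simpa [gridVertex, sub_eq_zero, eq_comm, and_comm] using fun _ => h
  · rintro ⟨x, y⟩
    simp [gridH, sub_eq_zero, add_comm, and_comm]

theorem expandable_gridSquare_right (p : ℤ × ℤ) :
    Expandable (gridV p ∪ gridH p ∪ gridH (p.1, p.2 + 1)) (gridSquare p) := by
  refine expandable_model_square.of_homeomorph ((Homeomorph.prodComm ℝ ℝ).trans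
    ((Homeomorph.subRight (p.2 : ℝ)).prodCongr (Homeomorph.subRight (p.1 : ℝ)))) ?_ ?_
  · rintro ⟨x, y⟩
    simp [gridV, gridH, sub_eq_iff_eq_add, add_comm, and_comm]
  · rintro ⟨x, y⟩
    simp [gridSquare, add_comm, and_comm]

theorem expandable_gridSquare_left (p : ℤ × ℤ) :
    Expandable (gridV (p.1 + 1, p.2) ∪ gridH p ∪ gridH (p.1, p.2 + 1)) (gridSquare p) := by
  refine expandable_model_square.of_homeomorph ((Homeomorph.prodComm ℝ ℝ).trans
    ((Homeomorph.subRight (p.2 : ℝ)).prodCongr (Homeomorph.subLeft (p.1 + 1 : ℝ)))) ?_ ?_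
  · rintro ⟨x, y⟩
    have h : x = p.1 + 1 ↔ p.1 + 1 - x = 0 := by constructor <;> intro h <;> linarith
    simp [gridV, gridH, sub_eq_iff_eq_add, add_comm, and_comm, h]
  · rintro ⟨x, y⟩
    simp only [gridSquare, mem_prod, mem_Icc, Homeomorph.trans_apply, Homeomorph.coe_prodComm,
      Prod.swap_prod_mk, Homeomorph.coe_prodCongr, Prod.map_apply, Homeomorph.subRight_apply,
      Homeomorph.subLeft_apply]
    constructor <;> rintro ⟨⟨h1, h2⟩, h3, h4⟩ <;> refine ⟨⟨?_, ?_⟩, ?_, ?_⟩ <;> linarith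

section GridGraph

/-- The upper or right endpoint of an edge of the integer grid; an edge is given by its direction
(`true` for vertical) and its lower or left endpoint. -/
def edgeEnd (e : Bool × ℤ × ℤ) : ℤ × ℤ := if e.1 then (e.2.1, e.2.2 + 1) else (e.2.1 + 1, e.2.2)

/-- The edges of the squares in `F`. -/
def squareEdges (F : Set (ℤ × ℤ)) : Set (Bool × ℤ × ℤ) :=
  {e | e.2 ∈ F ∨ (if e.1 then (e.2.1 - 1, e.2.2) else (e.2.1, e.2.2 - 1)) ∈ F}

/-- The central block of squares of side `2 * k`. -/
def gridBlock (k : ℤ) : Set (ℤ × ℤ) := {p | (-k ≤ p.1 ∧ p.1 < k) ∧ -k ≤ p.2 ∧ p.2 < k}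

/-- The edges left when every square of `F` outside the central block is collapsed away from the
axis. -/
def collapsedEdges (k : ℤ) (F : Set (ℤ × ℤ)) : Set (Bool × ℤ × ℤ) :=
  {e | e ∈ squareEdges F ∧ (e.1 = true →
    ¬ (1 ≤ e.2.1 ∧ (e.2.1 - 1, e.2.2) ∈ F ∧ (e.2.1 - 1, e.2.2) ∉ gridBlock k) ∧
    ¬ (e.2.1 < 0 ∧ e.2 ∈ F ∧ e.2 ∉ gridBlock k))}

/-- The endpoints of the edges in `E`. -/
def edgeVertices (E : Set (Bool × ℤ × ℤ)) : Set (ℤ × ℤ) := {p | ∃ e ∈ E, p = e.2 ∨ p = edgeEnd e}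

/-- `W` is a union of connected components of the graph `E`. -/
def EdgeClosed (E : Set (Bool × ℤ × ℤ)) (W : Set (ℤ × ℤ)) : Prop :=
  ∀ e ∈ E, e.2 ∈ W ↔ edgeEnd e ∈ W

/-- All edges of `E` lie in the connected component of the origin. -/
def EdgeConnected (E : Set (Bool × ℤ × ℤ)) : Prop :=
  ∀ W, EdgeClosed E W → (0, 0) ∈ W → edgeVertices E ⊆ W

variable {k : ℤ} {F : Set (ℤ × ℤ)} {E : Set (Bool × ℤ × ℤ)}

@[simp] theorem edgeEnd_false (p : ℤ × ℤ) : edgeEnd (false, p) = (p.1 + 1, p.2) := rfl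

@[simp] theorem edgeEnd_true (p : ℤ × ℤ) : edgeEnd (true, p) = (p.1, p.2 + 1) := rfl

@[simp] theorem mem_squareEdges_false {i j : ℤ} :
    (false, i, j) ∈ squareEdges F ↔ (i, j) ∈ F ∨ (i, j - 1) ∈ F := Iff.rfl

@[simp] theorem mem_squareEdges_true {i j : ℤ} :
    (true, i, j) ∈ squareEdges F ↔ (i, j) ∈ F ∨ (i - 1, j) ∈ F := Iff.rfl

@[simp] theorem mem_gridBlock {i j : ℤ} :
    (i, j) ∈ gridBlock k ↔ (-k ≤ i ∧ i < k) ∧ -k ≤ j ∧ j < k := Iff.rfl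

theorem mem_collapsedEdges_false {i j : ℤ} :
    (false, i, j) ∈ collapsedEdges k F ↔ (i, j) ∈ F ∨ (i, j - 1) ∈ F := by
  simp [collapsedEdges]

theorem mem_collapsedEdges_true {i j : ℤ} :
    (true, i, j) ∈ collapsedEdges k F ↔ ((i, j) ∈ F ∨ (i - 1, j) ∈ F) ∧
      ¬ (1 ≤ i ∧ (i - 1, j) ∈ F ∧ (i - 1, j) ∉ gridBlock k) ∧
      ¬ (i < 0 ∧ (i, j) ∈ F ∧ (i, j) ∉ gridBlock k) :=
  ⟨fun h => ⟨h.1, h.2 rfl⟩, fun h => ⟨h.1, fun _ => h.2⟩⟩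

theorem squareEdges_gridBlock_subset (hSF : gridBlock k ⊆ F) :
    squareEdges (gridBlock k) ⊆ collapsedEdges k F := by
  rintro ⟨_ | _, i, j⟩ h
  · exact mem_collapsedEdges_false.2 (h.imp (@hSF _) (@hSF _))
  · refine mem_collapsedEdges_true.2 ⟨h.imp (@hSF _) (@hSF _), ?_⟩
    rw [mem_squareEdges_true, mem_gridBlock, mem_gridBlock] at h
    rw [mem_gridBlock, mem_gridBlock]
    constructor <;> rintro ⟨h1, -, h2⟩ <;> omega

theorem Int.iff_of_iff_succ {p : ℤ → Prop} {a b : ℤ}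
    (h : ∀ i, a ≤ i → i < b → (p i ↔ p (i + 1))) {i : ℤ} (hi : a ≤ i) (hib : i ≤ b) :
    p a ↔ p i := by
  induction i, hi using Int.leInduction with
  | base => exact Iff.rfl
  | succ i hi ih => exact (ih (by omega)).trans (h i hi (by omega))

theorem edgeConnected_gridBlock (hk : 0 < k) : EdgeConnected (squareEdges (gridBlock k)) := by
  intro W hW h0
  have hrow : ∀ i, -k ≤ i → i ≤ k → ((-k, 0) ∈ W ↔ (i, (0 : ℤ)) ∈ W) := fun i h1 h2 =>
    Int.iff_of_iff_succ (p := fun i => (i, (0 : ℤ)) ∈ W) (fun i h1 h2 => hW (false, i, 0) (by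
      rw [mem_squareEdges_false, mem_gridBlock, mem_gridBlock]; omega)) h1 h2
  have hcol : ∀ i, -k ≤ i → i ≤ k → ∀ j, -k ≤ j → j ≤ k → ((i, -k) ∈ W ↔ (i, j) ∈ W) :=
    fun i h3 h4 j h1 h2 =>
    Int.iff_of_iff_succ (p := fun j => (i, j) ∈ W) (fun j h1 h2 => hW (true, i, j) (by
      rw [mem_squareEdges_true, mem_gridBlock, mem_gridBlock]; omega)) h1 h2
  have hall : ∀ i, -k ≤ i → i ≤ k → ∀ j, -k ≤ j → j ≤ k → (i, j) ∈ W := fun i h1 h2 j h3 h4 =>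
    (hcol i h1 h2 j h3 h4).1 ((hcol i h1 h2 0 (by omega) (by omega)).2
      ((hrow i h1 h2).1 ((hrow 0 (by omega) (by omega)).2 h0)))
  rintro ⟨i, j⟩ ⟨⟨_ | _, i', j'⟩, he, h⟩
  · rw [mem_squareEdges_false, mem_gridBlock, mem_gridBlock] at he
    simp only [edgeEnd_false, Prod.mk.injEq] at h
    refine hall _ ?_ ?_ _ ?_ ?_ <;> omega
  · rw [mem_squareEdges_true, mem_gridBlock, mem_gridBlock] at he
    simp only [edgeEnd_true, Prod.mk.injEq] at h
    refine hall _ ?_ ?_ _ ?_ ?_ <;> omega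

theorem EdgeClosed.of_collapsedEdges {W : Set (ℤ × ℤ)} (hW : EdgeClosed (collapsedEdges k F) W) :
    EdgeClosed (squareEdges F) W := by
  have hH : ∀ i j, ((i, j) ∈ F ∨ (i, j - 1) ∈ F) → ((i, j) ∈ W ↔ (i + 1, j) ∈ W) :=
    fun i j h => hW (false, i, j) (mem_collapsedEdges_false.2 h)
  have hV : ∀ n : ℕ, ∀ i j : ℤ, i.natAbs = n → ((i, j) ∈ F ∨ (i - 1, j) ∈ F) →
      ((i, j) ∈ W ↔ (i, j + 1) ∈ W) := by
    intro n
    induction n with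
    | zero =>
      intro i j hi h
      exact hW (true, i, j) (mem_collapsedEdges_true.2 ⟨h, by omega, by omega⟩)
    | succ n ih =>
      intro i j hi h
      by_cases hR : (true, i, j) ∈ collapsedEdges k F
      · exact hW (true, i, j) hR
      rw [mem_collapsedEdges_true, not_and, not_and_or, not_not, not_not] at hR
      rcases hR h with ⟨h1, h2, -⟩ | ⟨h1, h2, -⟩
      · have h3 := ih (i - 1) j (by omega) (Or.inl h2)
        have h4 := hH (i - 1) j (Or.inl h2)
        have h5 := hH (i - 1) (j + 1) (Or.inr (by simpa using h2))
        rw [sub_add_cancel] at h4 h5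
        rw [← h4, h3, h5]
      · have h3 := ih (i + 1) j (by omega) (Or.inr (by simpa using h2))
        have h4 := hH i j (Or.inl h2)
        have h5 := hH i (j + 1) (Or.inr (by simpa using h2))
        rw [h4, h3, h5]
  rintro ⟨_ | _, i, j⟩ he
  · exact hH i j he
  · exact hV _ i j rfl he

/-- The boundary of a one-dimensional chain mod 2 on the integer grid. -/
def gridBoundary (y : Bool × ℤ × ℤ → ZMod 2) (p : ℤ × ℤ) : ZMod 2 :=
  y (false, p) + y (false, p.1 - 1, p.2) + y (true, p) + y (true, p.1, p.2 - 1)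

theorem gridBoundary_add (y z : Bool × ℤ × ℤ → ZMod 2) :
    gridBoundary (y + z) = gridBoundary y + gridBoundary z := by
  ext p; simp only [gridBoundary, Pi.add_apply]; ring

theorem gridBoundary_single (e : Bool × ℤ × ℤ) :
    gridBoundary (Pi.single e 1) = Pi.single e.2 1 + Pi.single (edgeEnd e) 1 := by
  ext ⟨i, j⟩
  obtain ⟨_ | _, i', j'⟩ := e
  · simp only [gridBoundary, Pi.single_apply, Pi.add_apply, edgeEnd_false, Prod.mk.injEq,
      sub_eq_iff_eq_add]
    simp
  · simp only [gridBoundary, Pi.single_apply, Pi.add_apply, edgeEnd_true, Prod.mk.injEq,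
      sub_eq_iff_eq_add]
    simp

theorem EdgeConnected.exists_chain (hE : EdgeConnected E) {p : ℤ × ℤ} (hp : p ∈ edgeVertices E) :
    ∃ y : Bool × ℤ × ℤ → ZMod 2, (∀ e, e ∉ E → y e = 0) ∧
      gridBoundary y = Pi.single (0, 0) 1 + Pi.single p 1 := by
  refine hE {p | ∃ y : Bool × ℤ × ℤ → ZMod 2, (∀ e, e ∉ E → y e = 0) ∧
    gridBoundary y = Pi.single (0, 0) 1 + Pi.single p 1} (fun e he => ?_)
    ⟨0, fun _ _ => rfl, ?_⟩ hp
  · have h2 : ∀ f : ℤ × ℤ → ZMod 2, f + f = 0 := fun f => by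
      ext p; exact CharTwo.add_self_eq_zero _
    have h3 : ∀ f g h : ℤ × ℤ → ZMod 2, f + g + (g + h) = f + h := fun f g h => by
      rw [add_assoc, ← add_assoc g, h2, zero_add]
    have h1 : ∀ y : Bool × ℤ × ℤ → ZMod 2, (∀ e, e ∉ E → y e = 0) →
        ∀ e', e' ∉ E → (y + Pi.single e 1 : Bool × ℤ × ℤ → ZMod 2) e' = 0 := fun y hy e' he' => by
      have : e' ≠ e := fun h => he' (h ▸ he)
      rw [Pi.add_apply, hy e' he', Pi.single_apply, if_neg this, add_zero]
    constructor <;> rintro ⟨y, hy, hyb⟩ <;>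
      refine ⟨y + Pi.single e 1, h1 y hy, ?_⟩ <;>
      rw [gridBoundary_add, hyb, gridBoundary_single]
    · exact h3 _ _ _
    · rw [add_comm (Pi.single e.2 1)]
      exact h3 _ _ _
  · ext p
    simp [gridBoundary, CharTwo.add_self_eq_zero]

/-- A cycle mod 2 with bounded support on the integer grid bounds. -/
theorem exists_eq_boundary {z : Bool × ℤ × ℤ → ZMod 2} (hz : gridBoundary z = 0) {N : ℤ}
    (hN : ∀ e, N ≤ e.2.1 → z e = 0) :
    ∃ c : ℤ × ℤ → ZMod 2, (∀ p, N ≤ p.1 → c p = 0) ∧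
      (∀ i j, c (i - 1, j) + c (i, j) = z (true, i, j)) ∧
      ∀ i j, c (i, j) + c (i, j - 1) = z (false, i, j) := by
  have key : ∀ a b c d e f g h : ZMod 2, e + f + g + h = 0 → a + b = g → c + d = h →
      b + d = e → a + c = f := by decide
  obtain ⟨c, h1, h2⟩ : ∃ c : ℤ × ℤ → ZMod 2, (∀ p, N ≤ p.1 → c p = 0) ∧
      ∀ i j, c (i - 1, j) + c (i, j) = z (true, i, j) := by
    refine ⟨fun p => ∑ i ∈ Finset.Ioc p.1 N, z (true, i, p.2), fun p hp => ?_, fun i j => ?_⟩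
    · simp [Finset.Ioc_eq_empty_of_le hp]
    rcases le_or_gt i N with h | h
    · have : Finset.Ioc (i - 1) N = insert i (Finset.Ioc i N) := by
        ext x; simp only [Finset.mem_Ioc, Finset.mem_insert]; omega
      simp only
      rw [this, Finset.sum_insert (by simp), add_assoc, CharTwo.add_self_eq_zero, add_zero]
    · rw [hN (true, i, j) h.le]
      simp [Finset.Ioc_eq_empty_of_le h.le, Finset.Ioc_eq_empty_of_le (by omega : N ≤ i - 1)]
  refine ⟨c, h1, h2, fun i j => ?_⟩
  have h3 : ∀ i, N ≤ i → c (i, j) + c (i, j - 1) = z (false, i, j) := fun i hi => by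
    rw [h1 _ hi, h1 _ hi, hN _ hi, add_zero]
  have h4 : ∀ i, c (i, j) + c (i, j - 1) = z (false, i, j) →
      c (i - 1, j) + c (i - 1, j - 1) = z (false, i - 1, j) := fun i hi =>
    key _ _ _ _ _ _ _ _ (congrFun hz (i, j)) (h2 i j) (h2 i (j - 1)) hi
  rcases le_total N i with hi | hi
  · exact h3 i hi
  · exact Int.leInductionDown (h3 N le_rfl) (fun n _ => h4 n) i hi

/-- The squares which cannot be left without entering `F`, and from which one cannot escape to
the right, belong to `F`. -/
def HoleFree (F : Set (ℤ × ℤ)) : Prop :=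
  ∀ Y : Set (ℤ × ℤ), (∃ N, ∀ p ∈ Y, p.1 < N) → (∀ i j, (i, j) ∈ Y → (i, j) ∉ F →
    ((i + 1, j) ∉ F → (i + 1, j) ∈ Y) ∧ ((i - 1, j) ∉ F → (i - 1, j) ∈ Y) ∧
    ((i, j + 1) ∉ F → (i, j + 1) ∈ Y) ∧ ((i, j - 1) ∉ F → (i, j - 1) ∈ Y)) → Y ⊆ F

theorem mem_squareEdges_of_cycle (hF : F.Finite) (hh : HoleFree F)
    {z : Bool × ℤ × ℤ → ZMod 2} (hz : gridBoundary z = 0)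
    (hzR : ∀ e, e ∉ collapsedEdges k F → z e = 0) {e : Bool × ℤ × ℤ} (he : z e ≠ 0) :
    e ∈ squareEdges (gridBlock k) := by
  obtain ⟨N, hN⟩ : ∃ N : ℤ, ∀ p ∈ F, p.1 < N := by
    obtain ⟨N, hN⟩ := (hF.image Prod.fst).bddAbove
    exact ⟨N + 1, fun p hp => Int.lt_add_one_of_le (hN ⟨p, hp, rfl⟩)⟩
  obtain ⟨M, hM⟩ : ∃ M : ℤ, ∀ p ∈ F, M < p.1 := by
    obtain ⟨N, hN⟩ := (hF.image Prod.fst).bddBelow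
    exact ⟨N - 1, fun p hp => Int.sub_one_lt_of_le (hN ⟨p, hp, rfl⟩)⟩
  have hzF : ∀ e, e ∉ squareEdges F → z e = 0 := fun e h => hzR e fun h1 => h h1.1
  have key : ∀ a b : ZMod 2, a + b = 0 → (a ≠ 0 ↔ b ≠ 0) := by decide
  have key' : ∀ a b : ZMod 2, a + b ≠ 0 → a ≠ 0 ∨ b ≠ 0 := by decide
  obtain ⟨c, hc, hcV, hcH⟩ := exists_eq_boundary hz (N := N + 1) (by
    rintro ⟨_ | _, i, j⟩ h <;> refine hzF _ fun h1 => ?_ <;>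
      rcases h1 with h1 | h1 <;> have := hN _ h1 <;> simp at this h <;> omega)
  have hcV' : ∀ i j, (i, j) ∉ F → (i - 1, j) ∉ F → (c (i - 1, j) ≠ 0 ↔ c (i, j) ≠ 0) :=
    fun i j h1 h2 => key _ _ ((hcV i j).trans (hzF _ (not_or.2 ⟨h1, h2⟩)))
  have hcH' : ∀ i j, (i, j) ∉ F → (i, j - 1) ∉ F → (c (i, j) ≠ 0 ↔ c (i, j - 1) ≠ 0) :=
    fun i j h1 h2 => key _ _ ((hcH i j).trans (hzF _ (not_or.2 ⟨h1, h2⟩)))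
  have hcF : ∀ p, c p ≠ 0 → p ∈ F := by
    refine hh {p | c p ≠ 0} ⟨N + 1, fun p hp => ?_⟩ fun i j hp hpF => ⟨fun h => ?_, fun h => ?_,
      fun h => ?_, fun h => ?_⟩
    · by_contra! h
      exact hp (hc p h)
    · exact (hcV' (i + 1) j h (by simpa using hpF)).1 (by simpa using hp)
    · exact (hcV' i j hpF h).2 hp
    · exact (hcH' i (j + 1) h (by simpa using hpF)).2 (by simpa using hp)
    · exact (hcH' i j hpF h).1 hp
  have hcR : ∀ i j : ℤ, 0 ≤ i → c (i, j) ≠ 0 → (i, j) ∉ gridBlock k → False := by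
    have : ∀ n : ℕ, ∀ i j : ℤ, (N - i).toNat = n → 0 ≤ i → c (i, j) ≠ 0 →
        (i, j) ∉ gridBlock k → False := by
      intro n
      induction n with
      | zero =>
        intro i j hn hi h1 h2
        have := hN _ (hcF _ h1)
        simp only at this
        omega
      | succ n ih =>
        intro i j hn hi h1 h2
        refine ih (i + 1) j (by omega) (by omega) ((key _ _ ?_).1 h1) ?_
        · have := hcV (i + 1) j
          rw [add_sub_cancel_right] at this
          rw [this]
          refine hzR _ fun h => ?_
          have h3 := (mem_collapsedEdges_true.1 h).2.1
          rw [add_sub_cancel_right] at h3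
          exact h3 ⟨by omega, hcF _ h1, h2⟩
        · rw [mem_gridBlock] at h2 ⊢; omega
    exact fun i j => this _ i j rfl
  have hcL : ∀ i j : ℤ, i < 0 → c (i, j) ≠ 0 → (i, j) ∉ gridBlock k → False := by
    have : ∀ n : ℕ, ∀ i j : ℤ, (i - M).toNat = n → i < 0 → c (i, j) ≠ 0 →
        (i, j) ∉ gridBlock k → False := by
      intro n
      induction n with
      | zero =>
        intro i j hn hi h1 h2
        have := hM _ (hcF _ h1)
        simp only at this
        omega
      | succ n ih =>
        intro i j hn hi h1 h2
        refine ih (i - 1) j (by omega) (by omega) ((key _ _ ?_).2 h1) ?_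
        · rw [hcV]
          exact hzR _ fun h => (mem_collapsedEdges_true.1 h).2.2 ⟨hi, hcF _ h1, h2⟩
        · rw [mem_gridBlock] at h2 ⊢; omega
    exact fun i j => this _ i j rfl
  have hcS : ∀ i j, c (i, j) ≠ 0 → (i, j) ∈ gridBlock k := fun i j h => by
    by_contra h1
    rcases le_or_gt 0 i with hi | hi
    · exact hcR i j hi h h1
    · exact hcL i j hi h h1
  obtain ⟨_ | _, i, j⟩ := e
  · rw [← hcH] at he
    exact (key' _ _ he).imp (hcS _ _) (hcS _ _)
  · rw [← hcV] at he
    exact (key' _ _ he).symm.imp (hcS _ _) (hcS _ _)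

theorem finite_squareEdges (hF : F.Finite) : (squareEdges F).Finite := by
  refine ((finite_univ (α := Bool)).prod (hF.union ((hF.image fun p => (p.1 + 1, p.2)).union
    (hF.image fun p => (p.1, p.2 + 1))))).subset ?_
  rintro ⟨_ | _, i, j⟩ (h | h)
  · exact ⟨mem_univ _, Or.inl h⟩
  · exact ⟨mem_univ _, Or.inr (Or.inr ⟨_, h, by simp⟩)⟩
  · exact ⟨mem_univ _, Or.inl h⟩
  · exact ⟨mem_univ _, Or.inr (Or.inl ⟨_, h, by simp⟩)⟩

/-- The collapsed graph is built up from the edges of the central block by successively attaching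
edges at one endpoint. -/
theorem collapsedEdges_induction (hk : 0 < k) (hF : F.Finite) (hSF : gridBlock k ⊆ F)
    (hh : HoleFree F) (hc : EdgeConnected (squareEdges F)) {Good : Set (Bool × ℤ × ℤ) → Prop}
    (h0 : Good (squareEdges (gridBlock k)))
    (hstep : ∀ E, squareEdges (gridBlock k) ⊆ E → Good E → ∀ e ∈ collapsedEdges k F,
      (e.2 ∈ edgeVertices E ∧ edgeEnd e ∉ edgeVertices E ∨
        e.2 ∉ edgeVertices E ∧ edgeEnd e ∈ edgeVertices E) → Good (insert e E)) :
    Good (collapsedEdges k F) := by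
  have hSR := squareEdges_gridBlock_subset (k := k) hSF
  have hRf : (collapsedEdges k F).Finite := (finite_squareEdges hF).subset fun e he => he.1
  have hfin : {E | squareEdges (gridBlock k) ⊆ E ∧ E ⊆ collapsedEdges k F ∧ EdgeConnected E ∧
      Good E}.Finite := hRf.finite_subsets.subset fun E hE => hE.2.1
  obtain ⟨E, ⟨hSE, hER, hEc, hEg⟩, hmax⟩ := hfin.exists_maximal
    ⟨_, Subset.rfl, hSR, edgeConnected_gridBlock hk, h0⟩
  have hins : ∀ e ∈ collapsedEdges k F, (e.2 ∈ edgeVertices E ∧ edgeEnd e ∉ edgeVertices E ∨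
      e.2 ∉ edgeVertices E ∧ edgeEnd e ∈ edgeVertices E) → False := by
    intro e he h
    have heE : e ∈ E := by
      refine hmax ⟨hSE.trans (subset_insert _ _), insert_subset he hER, ?_,
        hstep E hSE hEg e he h⟩ (subset_insert _ _) (mem_insert _ _)
      intro W hW hW0
      have h1 : edgeVertices E ⊆ W := hEc W (fun e he => hW e (mem_insert_of_mem _ he)) hW0
      have h2 : e.2 ∈ W ∧ edgeEnd e ∈ W := by
        have := hW e (mem_insert _ _)
        rcases h with h | h
        · exact ⟨h1 h.1, this.1 (h1 h.1)⟩
        · exact ⟨this.2 (h1 h.2), h1 h.2⟩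
      rintro p ⟨e', he' | he', hp⟩
      · rw [he'] at hp
        rcases hp with rfl | rfl
        exacts [h2.1, h2.2]
      · exact h1 ⟨e', he', hp⟩
    rcases h with h | h
    · exact h.2 ⟨e, heE, Or.inr rfl⟩
    · exact h.1 ⟨e, heE, Or.inl rfl⟩
  have hcl : EdgeClosed (collapsedEdges k F) (edgeVertices E) := fun e he => by
    have := hins e he
    tauto
  have hV : edgeVertices (squareEdges F) ⊆ edgeVertices E := by
    refine hc _ hcl.of_collapsedEdges ⟨(false, 0, 0), hSE ?_, Or.inl rfl⟩
    rw [mem_squareEdges_false, mem_gridBlock]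
    omega
  have hEq : E = collapsedEdges k F := by
    refine hER.antisymm fun e he => ?_
    by_contra heE
    obtain ⟨y, hy, hyb⟩ := hEc.exists_chain (hV ⟨e, he.1, Or.inl rfl⟩)
    obtain ⟨w, hw, hwb⟩ := hEc.exists_chain (hV ⟨e, he.1, Or.inr rfl⟩)
    refine heE (hSE (mem_squareEdges_of_cycle hF hh (z := y + w + Pi.single e 1) ?_ ?_ ?_))
    · have h2 : ∀ f : ℤ × ℤ → ZMod 2, f + f = 0 := fun f => by
        ext p; exact CharTwo.add_self_eq_zero _
      rw [gridBoundary_add, gridBoundary_add, hyb, hwb, gridBoundary_single]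
      have h3 : ∀ f g h : ℤ × ℤ → ZMod 2, f + g + (f + h) + (g + h) = 0 := fun f g h => by
        rw [add_assoc, add_assoc f h, add_left_comm h, ← add_assoc f g, ← add_assoc, h2, h2,
          add_zero]
      exact h3 _ _ _
    · intro e' he'
      have h1 : e' ≠ e := fun h => he' (h ▸ he)
      simp [hy e' fun h => he' (hER h), hw e' fun h => he' (hER h), h1]
    · simp [hy e heE, hw e heE]
  exact hEq ▸ hEg

/-- `F` is built up from the central block by attaching squares one by one, in order of their
distance from the axis. -/
theorem square_induction (hF : F.Finite) (hSF : gridBlock k ⊆ F) {Good : Set (ℤ × ℤ) → Prop}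
    (h0 : Good (gridBlock k))
    (hstep : ∀ G, gridBlock k ⊆ G → G ⊆ F → Good G → ∀ i j, (i, j) ∈ F → (i, j) ∉ G →
      (0 ≤ i → (i + 1, j) ∉ G) → (i < 0 → (i - 1, j) ∉ G) →
      (1 ≤ i → (i - 1, j) ∈ F → (i - 1, j) ∈ G) →
      (i + 1 < 0 → (i + 1, j) ∈ F → (i + 1, j) ∈ G) → Good (insert (i, j) G)) : Good F := by
  let key : ℤ × ℤ → ℤ := fun p => if 0 ≤ p.1 then p.1 else -1 - p.1
  have hfin : {G | gridBlock k ⊆ G ∧ G ⊆ F ∧ (∀ p ∈ G, p ∉ gridBlock k → ∀ q ∈ F,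
      key q < key p → q ∈ G) ∧ Good G}.Finite := hF.finite_subsets.subset fun G hG => hG.2.1
  obtain ⟨G, ⟨hSG, hGF, hGk, hG⟩, hmax⟩ := hfin.exists_maximal
    ⟨_, Subset.rfl, hSF, fun p hp hp' => absurd hp hp', h0⟩
  have hEq : G = F := by
    refine hGF.antisymm fun p hp => ?_
    by_contra hpG
    obtain ⟨⟨i, j⟩, ⟨hqF, hqG⟩, hq⟩ := (hF.subset (sdiff_subset (t := G))).exists_minimalFor key _
      ⟨p, hp, hpG⟩
    have hq' : ∀ p ∈ F, key p < key (i, j) → p ∈ G := fun p hp h => by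
      by_contra h1
      exact absurd (hq ⟨hp, h1⟩ h.le) (not_le.2 h)
    have hqS : (i, j) ∉ gridBlock k := fun h => hqG (hSG h)
    refine hqG (hmax ⟨hSG.trans (subset_insert _ _), insert_subset hqF hGF, ?_,
      hstep G hSG hGF hG i j hqF hqG (fun hi h => ?_) (fun hi h => ?_) (fun hi h => hq' _ h ?_)
      (fun hi h => hq' _ h ?_)⟩ (subset_insert _ _)
      (mem_insert _ _))
    · rintro p (rfl | hp) hpS q hqF hqp
      · exact mem_insert_of_mem _ (hq' _ hqF hqp)
      · exact mem_insert_of_mem _ (hGk p hp hpS q hqF hqp)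
    · refine hqG (hGk _ h ?_ _ hqF ?_)
      · rw [mem_gridBlock] at hqS ⊢; omega
      · simp only [key]; split_ifs <;> omega
    · refine hqG (hGk _ h ?_ _ hqF ?_)
      · rw [mem_gridBlock] at hqS ⊢; omega
      · simp only [key]; split_ifs <;> omega
    · simp only [key]; split_ifs <;> omega
    · simp only [key]; split_ifs <;> omega
  exact hEq ▸ hG

end GridGraph

section GridEngulf

/-- The unit edge of the integer grid as a set of points. -/
def gridEdge (e : Bool × ℤ × ℤ) : Set (ℝ × ℝ) := if e.1 then gridV e.2 else gridH e.2

@[simp] theorem gridEdge_false (p : ℤ × ℤ) : gridEdge (false, p) = gridH p := rfl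

@[simp] theorem gridEdge_true (p : ℤ × ℤ) : gridEdge (true, p) = gridV p := rfl

/-- The union of the squares in `F`. -/
def gridUnion (F : Set (ℤ × ℤ)) : Set (ℝ × ℝ) := ⋃ p ∈ F, gridSquare p

variable {F : Set (ℤ × ℤ)} {k : ℤ} {p v : ℤ × ℤ} {e e' : Bool × ℤ × ℤ} {q : ℝ × ℝ}

theorem mem_gridUnion : q ∈ gridUnion F ↔ ∃ p ∈ F, q ∈ gridSquare p := by
  simp [gridUnion]

theorem gridUnion_mono {F F' : Set (ℤ × ℤ)} (h : F ⊆ F') : gridUnion F ⊆ gridUnion F' :=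
  biUnion_subset_biUnion_left h

theorem isCompact_gridSquare (p : ℤ × ℤ) : IsCompact (gridSquare p) :=
  isCompact_Icc.prod isCompact_Icc

theorem isClosed_gridEdge (e : Bool × ℤ × ℤ) : IsClosed (gridEdge e) := by
  obtain ⟨_ | _, p⟩ := e
  · exact isClosed_Icc.prod isClosed_singleton
  · exact isClosed_singleton.prod isClosed_Icc

theorem Int.eq_of_mem_Ioo_of_mem_Icc {i i' : ℤ} {x : ℝ} (h1 : i < x) (h2 : x < i + 1)
    (h3 : i' ≤ x) (h4 : x ≤ i' + 1) : i' = i := by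
  have h5 : i < i' + 1 := by exact_mod_cast h1.trans_le h4
  have h6 : i' < i + 1 := by exact_mod_cast h3.trans_lt h2
  omega

theorem Int.eq_or_eq_of_cast_mem_Icc {i i' : ℤ} (h1 : (i : ℝ) ≤ i') (h2 : (i' : ℝ) ≤ i + 1) :
    i' = i ∨ i' = i + 1 := by
  have h3 : i ≤ i' := by exact_mod_cast h1
  have h4 : i' ≤ i + 1 := by exact_mod_cast h2
  omega

theorem gridEdge_subset_gridUnion (h : e ∈ squareEdges F) : gridEdge e ⊆ gridUnion F := by
  rintro ⟨x, y⟩ hq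
  rw [mem_gridUnion]
  obtain ⟨_ | _, i, j⟩ := e
  · obtain ⟨hx, hy⟩ := hq
    simp only [mem_singleton_iff] at hx hy
    rcases h with h | h
    · exact ⟨_, h, hx, by simp [hy]⟩
    · exact ⟨_, h, hx, by simp [hy]⟩
  · obtain ⟨hx, hy⟩ := hq
    simp only [mem_singleton_iff] at hx hy
    rcases h with h | h
    · exact ⟨_, h, by simp [hx], hy⟩
    · exact ⟨_, h, by simp [hx], hy⟩

theorem eq_or_eq_of_gridVertex_mem (h : gridVertex v ∈ gridEdge e) : v = e.2 ∨ v = edgeEnd e := by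
  obtain ⟨a, b⟩ := v
  obtain ⟨_ | _, i, j⟩ := e
  · obtain ⟨hx, hy⟩ := h
    have hy : b = j := Int.cast_injective (α := ℝ) hy
    have hx := Int.eq_or_eq_of_cast_mem_Icc hx.1 hx.2
    simpa [hy] using hx
  · obtain ⟨hx, hy⟩ := h
    have hx : a = i := Int.cast_injective (α := ℝ) hx
    have hy := Int.eq_or_eq_of_cast_mem_Icc hy.1 hy.2
    simpa [hx] using hy

theorem mem_edgeVertices_of_gridVertex_mem (h : gridVertex v ∈ gridSquare p) (hp : p ∈ F) :
    v ∈ edgeVertices (squareEdges F) := by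
  obtain ⟨a, b⟩ := v
  obtain ⟨i, j⟩ := p
  have hx := Int.eq_or_eq_of_cast_mem_Icc h.1.1 h.1.2
  rcases Int.eq_or_eq_of_cast_mem_Icc h.2.1 h.2.2 with hy | hy
  · exact ⟨(false, i, j), Or.inl hp, hx.imp (fun h => Prod.ext h hy) fun h => Prod.ext h hy⟩
  · exact ⟨(false, i, j + 1), Or.inr (by simpa using hp), hx.imp (fun h => Prod.ext h hy)
      fun h => Prod.ext h hy⟩

theorem mem_Ioo_of_mem_Icc {a b x : ℝ} (h : x ∈ Icc a b) (h1 : x ≠ a) (h2 : x ≠ b) : x ∈ Ioo a b :=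
  ⟨lt_of_le_of_ne h.1 h1.symm, lt_of_le_of_ne h.2 h2⟩

theorem eq_of_mem_gridEdge (h : q ∈ gridEdge e) (h1 : q ≠ gridVertex e.2)
    (h2 : q ≠ gridVertex (edgeEnd e)) (h' : q ∈ gridEdge e') : e' = e := by
  obtain ⟨x, y⟩ := q
  obtain ⟨_ | _, i, j⟩ := e
  · obtain ⟨hx, hy⟩ := h
    simp only [mem_singleton_iff] at hx hy
    subst hy
    have hx' := mem_Ioo_of_mem_Icc hx (fun h => h1 (by rw [h]; rfl))
      (fun h => h2 (by rw [h]; simp [gridVertex]))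
    obtain ⟨_ | _, i', j'⟩ := e' <;> obtain ⟨hx2, hy2⟩ := h' <;>
      simp only [mem_singleton_iff] at hx2 hy2
    · have h3 : j = j' := by exact_mod_cast hy2
      rw [h3, Int.eq_of_mem_Ioo_of_mem_Icc hx'.1 hx'.2 hx2.1 hx2.2]
    · subst hx2
      rcases Int.eq_or_eq_of_cast_mem_Icc hx.1 hx.2 with rfl | rfl <;> simp at hx'
  · obtain ⟨hx, hy⟩ := h
    simp only [mem_singleton_iff] at hx hy
    subst hx
    have hy' := mem_Ioo_of_mem_Icc hy (fun h => h1 (by rw [h]; rfl))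
      (fun h => h2 (by rw [h]; simp [gridVertex]))
    obtain ⟨_ | _, i', j'⟩ := e' <;> obtain ⟨hx2, hy2⟩ := h' <;>
      simp only [mem_singleton_iff] at hx2 hy2
    · subst hy2
      rcases Int.eq_or_eq_of_cast_mem_Icc hy.1 hy.2 with rfl | rfl <;> simp at hy'
    · have h3 : i = i' := by exact_mod_cast hx2
      rw [h3, Int.eq_of_mem_Ioo_of_mem_Icc hy'.1 hy'.2 hy2.1 hy2.2]

theorem mem_squareEdges_of_mem_gridSquare (h : q ∈ gridEdge e) (h1 : q ≠ gridVertex e.2)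
    (h2 : q ≠ gridVertex (edgeEnd e)) (h' : q ∈ gridSquare p) (hp : p ∈ F) :
    e ∈ squareEdges F := by
  obtain ⟨x, y⟩ := q
  obtain ⟨a, b⟩ := p
  obtain ⟨hx2, hy2⟩ := h'
  obtain ⟨_ | _, i, j⟩ := e
  · obtain ⟨hx, hy⟩ := h
    simp only [mem_singleton_iff] at hx hy
    subst hy
    have hx' := mem_Ioo_of_mem_Icc hx (fun h => h1 (by rw [h]; rfl))
      (fun h => h2 (by rw [h]; simp [gridVertex]))
    have h3 : a = i := Int.eq_of_mem_Ioo_of_mem_Icc hx'.1 hx'.2 hx2.1 hx2.2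
    rw [mem_squareEdges_false, ← h3]
    rcases Int.eq_or_eq_of_cast_mem_Icc hy2.1 hy2.2 with rfl | rfl
    · exact Or.inl hp
    · exact Or.inr (by simpa using hp)
  · obtain ⟨hx, hy⟩ := h
    simp only [mem_singleton_iff] at hx hy
    subst hx
    have hy' := mem_Ioo_of_mem_Icc hy (fun h => h1 (by rw [h]; rfl))
      (fun h => h2 (by rw [h]; simp [gridVertex]))
    have h3 : b = j := Int.eq_of_mem_Ioo_of_mem_Icc hy'.1 hy'.2 hy2.1 hy2.2
    rw [mem_squareEdges_true, ← h3]
    rcases Int.eq_or_eq_of_cast_mem_Icc hx2.1 hx2.2 with rfl | rfl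
    · exact Or.inl hp
    · exact Or.inr (by simpa using hp)

theorem expandable_gridEdge (e : Bool × ℤ × ℤ) : Expandable {gridVertex e.2} (gridEdge e) := by
  obtain ⟨_ | _, p⟩ := e
  · exact expandable_gridH p
  · exact expandable_gridV p

theorem expandable_gridEdge_edgeEnd (e : Bool × ℤ × ℤ) :
    Expandable {gridVertex (edgeEnd e)} (gridEdge e) := by
  obtain ⟨_ | _, p⟩ := e
  · exact expandable_gridH_right p
  · exact expandable_gridV_up p

theorem gridVertex_mem_gridEdge (h : v = e.2 ∨ v = edgeEnd e) : gridVertex v ∈ gridEdge e := by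
  rcases h with rfl | rfl
  · exact (expandable_gridEdge e).1 rfl
  · exact (expandable_gridEdge_edgeEnd e).1 rfl

theorem relEngulf_collapsedEdges (hk : 0 < k) (hF : F.Finite) (hSF : gridBlock k ⊆ F)
    (hh : HoleFree F) (hc : EdgeConnected (squareEdges F)) {D U : Set (ℝ × ℝ)} (hD : IsClosed D)
    (hDF : D ∩ gridUnion F ⊆ gridUnion (gridBlock k)) (hU : IsOpen U)
    (hSU : gridUnion (gridBlock k) ⊆ U) :
    RelEngulf D U (gridUnion (gridBlock k) ∪ ⋃ e ∈ collapsedEdges k F, gridEdge e) := by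
  refine (collapsedEdges_induction hk hF hSF hh hc (Good := fun E => E.Finite ∧
    RelEngulf D U (gridUnion (gridBlock k) ∪ ⋃ e ∈ E, gridEdge e))
    ⟨finite_squareEdges (hF.subset hSF), relEngulf_of_subset ?_⟩ ?_).2
  · exact union_subset hSU (iUnion₂_subset fun e he => (gridEdge_subset_gridUnion he).trans hSU)
  rintro E hSE ⟨hEf, hE⟩ e he hv
  have heE : e ∉ E := fun heE => by
    have h1 : e.2 ∈ edgeVertices E := ⟨e, heE, Or.inl rfl⟩
    have h2 : edgeEnd e ∈ edgeVertices E := ⟨e, heE, Or.inr rfl⟩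
    tauto
  refine ⟨hEf.insert e, ?_⟩
  have hcl : IsClosed (gridUnion (gridBlock k) ∪ ⋃ e ∈ E, gridEdge e) :=
    ((hF.subset hSF).isCompact_biUnion fun p _ => isCompact_gridSquare p).isClosed.union
      (hEf.isClosed_biUnion fun e _ => isClosed_gridEdge e)
  have hmeet : ∀ q ∈ ((gridUnion (gridBlock k) ∪ ⋃ e ∈ E, gridEdge e) ∪ D) ∩ gridEdge e,
      ∃ v ∈ edgeVertices E, q = gridVertex v ∧ (v = e.2 ∨ v = edgeEnd e) := by
    rintro q ⟨hq, hqe⟩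
    have hq' : (∃ p ∈ gridBlock k, q ∈ gridSquare p) ∨ ∃ e' ∈ E, q ∈ gridEdge e' := by
      rcases hq with (hq | hq) | hq
      · exact Or.inl (mem_gridUnion.1 hq)
      · simpa using Or.inr hq
      · exact Or.inl (mem_gridUnion.1 (hDF ⟨hq, gridEdge_subset_gridUnion he.1 hqe⟩))
    have h1 : ∃ v, q = gridVertex v ∧ (v = e.2 ∨ v = edgeEnd e) := by
      by_contra! h
      have h1 : q ≠ gridVertex e.2 := fun h' => (h _ h').1 rfl
      have h2 : q ≠ gridVertex (edgeEnd e) := fun h' => (h _ h').2 rfl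
      rcases hq' with ⟨p, hp, hqp⟩ | ⟨e', he', hqe'⟩
      · exact heE (hSE (mem_squareEdges_of_mem_gridSquare hqe h1 h2 hqp hp))
      · exact heE (eq_of_mem_gridEdge hqe h1 h2 hqe' ▸ he')
    obtain ⟨v, rfl, hv⟩ := h1
    refine ⟨v, ?_, rfl, hv⟩
    rcases hq' with ⟨p, hp, hqp⟩ | ⟨e', he', hqe'⟩
    · obtain ⟨e', he', h⟩ := mem_edgeVertices_of_gridVertex_mem hqp hp
      exact ⟨e', hSE he', h⟩
    · exact ⟨e', he', eq_or_eq_of_gridVertex_mem hqe'⟩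
  have hmem : ∀ v ∈ edgeVertices E, {gridVertex v} ⊆ gridUnion (gridBlock k) ∪
      ⋃ e ∈ E, gridEdge e := by
    rintro v ⟨e', he', hv⟩ _ rfl
    exact Or.inr (mem_biUnion he' (gridVertex_mem_gridEdge hv))
  have hsub : gridUnion (gridBlock k) ∪ ⋃ e' ∈ insert e E, gridEdge e' ⊆
      (gridUnion (gridBlock k) ∪ ⋃ e ∈ E, gridEdge e) ∪ gridEdge e := by
    rw [biUnion_insert]
    intro q hq
    simp only [mem_union] at hq ⊢
    tauto
  refine RelEngulf.mono ?_ hsub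
  rcases hv with ⟨hv1, hv2⟩ | ⟨hv1, hv2⟩
  · refine hE.union (expandable_gridEdge e) hU hD hcl (hmem _ hv1) fun q hq => ?_
    obtain ⟨v, hv, rfl, rfl | rfl⟩ := hmeet q hq
    · rfl
    · exact absurd hv hv2
  · refine hE.union (expandable_gridEdge_edgeEnd e) hU hD hcl (hmem _ hv2) fun q hq => ?_
    obtain ⟨v, hv, rfl, rfl | rfl⟩ := hmeet q hq
    · exact absurd hv hv1
    · rfl

/-- A finite connected union of grid squares without holes can be engulfed from a central block,
keeping fixed a closed set which only meets it in the block. -/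
theorem relEngulf_gridUnion (hk : 0 < k) (hF : F.Finite) (hSF : gridBlock k ⊆ F)
    (hh : HoleFree F) (hc : EdgeConnected (squareEdges F)) {D U : Set (ℝ × ℝ)} (hD : IsClosed D)
    (hDF : D ∩ gridUnion F ⊆ gridUnion (gridBlock k)) (hU : IsOpen U)
    (hSU : gridUnion (gridBlock k) ⊆ U) : RelEngulf D U (gridUnion F) := by
  have h0 := relEngulf_collapsedEdges hk hF hSF hh hc hD hDF hU hSU
  have hRf : (collapsedEdges k F).Finite := (finite_squareEdges hF).subset fun e he => he.1
  refine RelEngulf.mono (A := gridUnion F ∪ ⋃ e ∈ collapsedEdges k F, gridEdge e) ?_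
    subset_union_left
  refine square_induction hF hSF (Good := fun G =>
    RelEngulf D U (gridUnion G ∪ ⋃ e ∈ collapsedEdges k F, gridEdge e)) h0 ?_
  intro G hSG hGF hG i j hF' hG' hR hL hR' hL'
  have hcl : IsClosed (gridUnion G ∪ ⋃ e ∈ collapsedEdges k F, gridEdge e) :=
    ((hF.subset hGF).isCompact_biUnion fun p _ => isCompact_gridSquare p).isClosed.union
      (hRf.isClosed_biUnion fun e _ => isClosed_gridEdge e)
  have hsub : gridUnion (insert (i, j) G) ∪ ⋃ e ∈ collapsedEdges k F, gridEdge e ⊆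
      (gridUnion G ∪ ⋃ e ∈ collapsedEdges k F, gridEdge e) ∪ gridSquare (i, j) := by
    rw [gridUnion, biUnion_insert]
    intro q hq
    simp only [mem_union] at hq ⊢
    unfold gridUnion
    tauto
  refine RelEngulf.mono ?_ hsub
  have hS : (i, j) ∉ gridBlock k := fun h => hG' (hSG h)
  have hedge : ∀ e ∈ collapsedEdges k F, gridEdge e ⊆
      gridUnion G ∪ ⋃ e ∈ collapsedEdges k F, gridEdge e := fun e he q hq =>
    Or.inr (mem_biUnion he hq)
  have hH0 := hedge (false, i, j) (mem_collapsedEdges_false.2 (Or.inl hF'))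
  have hH1 := hedge (false, i, j + 1) (mem_collapsedEdges_false.2 (Or.inr (by simpa using hF')))
  have hcases : ∀ q ∈ ((gridUnion G ∪ ⋃ e ∈ collapsedEdges k F, gridEdge e) ∪ D) ∩
      gridSquare (i, j), (∃ p ∈ G, q ∈ gridSquare p) ∨
        ∃ e ∈ collapsedEdges k F, q ∈ gridEdge e := by
    rintro q ⟨(hq | hq) | hq, hqs⟩
    · exact Or.inl (mem_gridUnion.1 hq)
    · simpa using Or.inr hq
    · exact Or.inl (mem_gridUnion.1 (gridUnion_mono hSG (hDF ⟨hq, mem_gridUnion.2 ⟨_, hF', hqs⟩⟩)))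
  rcases le_or_gt 0 i with hi | hi
  · refine hG.union (expandable_gridSquare_right (i, j)) hU hD hcl
      (union_subset (union_subset ?_ hH0) hH1) ?_
    · by_cases hV : (true, i, j) ∈ collapsedEdges k F
      · exact hedge _ hV
      · have h1 : 1 ≤ i ∧ (i - 1, j) ∈ F := by
          by_contra h
          exact hV (mem_collapsedEdges_true.2 ⟨Or.inl hF', fun h' => h ⟨h'.1, h'.2.1⟩,
            fun h' => absurd h'.1 (not_lt.2 hi)⟩)
        exact (gridEdge_subset_gridUnion (e := (true, i, j)) (F := G) (Or.inr (hR' h1.1 h1.2))).trans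
          subset_union_left
    · intro q hq
      by_contra hqN
      obtain ⟨x, y⟩ := q
      have hqs := hq.2
      simp only [gridSquare, gridV, gridH, mem_union, mem_prod, mem_singleton_iff] at hqs hqN
      push Not at hqN
      have hy := mem_Ioo_of_mem_Icc hqs.2 (fun h => hqN.1.2 hqs.1 h) (fun h => hqN.2 hqs.1
        (by push_cast; exact h))
      have hx : (i : ℝ) < x := lt_of_le_of_ne hqs.1.1 fun h => hqN.1.1 h.symm hqs.2
      have hx1 := hqs.1.2
      rcases hcases _ hq with ⟨⟨i', j'⟩, hp, hqp⟩ | ⟨⟨_ | _, i', j'⟩, he, hqe⟩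
      · have h1 : j' = j := Int.eq_of_mem_Ioo_of_mem_Icc hy.1 hy.2 hqp.2.1 hqp.2.2
        have h2 : i < i' + 1 := by exact_mod_cast hx.trans_le hqp.1.2
        have h3 : i' ≤ i + 1 := by exact_mod_cast hqp.1.1.trans hx1
        have h4 : i' = i ∨ i' = i + 1 := by omega
        rcases h4 with rfl | rfl
        · exact hG' (h1 ▸ hp)
        · exact hR hi (h1 ▸ hp)
      · have h1 : y = j' := hqe.2
        rw [h1] at hy
        have h2 : j < j' := by exact_mod_cast hy.1
        have h3 : j' < j + 1 := by exact_mod_cast hy.2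
        omega
      · have h1 : j' = j := Int.eq_of_mem_Ioo_of_mem_Icc hy.1 hy.2 hqe.2.1 hqe.2.2
        have h2 : x = i' := hqe.1
        rw [h2] at hx hx1
        have h3 : i < i' := by exact_mod_cast hx
        have h4 : i' ≤ i + 1 := by exact_mod_cast hx1
        have h5 : i' = i + 1 := by omega
        rw [h5, h1] at he
        have h6 := (mem_collapsedEdges_true.1 he).2.1
        rw [add_sub_cancel_right] at h6
        exact h6 ⟨by omega, hF', hS⟩
  · refine hG.union (expandable_gridSquare_left (i, j)) hU hD hcl
      (union_subset (union_subset ?_ hH0) hH1) ?_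
    · by_cases hV : (true, i + 1, j) ∈ collapsedEdges k F
      · exact hedge _ hV
      · have h1 : i + 1 < 0 ∧ (i + 1, j) ∈ F := by
          by_contra h
          exact hV (mem_collapsedEdges_true.2 ⟨Or.inr (by simpa using hF'), fun h' => by omega,
            fun h' => h ⟨h'.1, h'.2.1⟩⟩)
        exact (gridEdge_subset_gridUnion (e := (true, i + 1, j)) (F := G)
          (Or.inl (hL' h1.1 h1.2))).trans subset_union_left
    · intro q hq
      by_contra hqN
      obtain ⟨x, y⟩ := q
      have hqs := hq.2
      simp only [gridSquare, gridV, gridH, mem_union, mem_prod, mem_singleton_iff] at hqs hqN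
      push Not at hqN
      have hy := mem_Ioo_of_mem_Icc hqs.2 (fun h => hqN.1.2 hqs.1 h) (fun h => hqN.2 hqs.1
        (by push_cast; exact h))
      have hx : x < i + 1 := lt_of_le_of_ne hqs.1.2 fun h => hqN.1.1 (by push_cast; exact h) hqs.2
      have hx1 := hqs.1.1
      rcases hcases _ hq with ⟨⟨i', j'⟩, hp, hqp⟩ | ⟨⟨_ | _, i', j'⟩, he, hqe⟩
      · have h1 : j' = j := Int.eq_of_mem_Ioo_of_mem_Icc hy.1 hy.2 hqp.2.1 hqp.2.2
        have h2 : i ≤ i' + 1 := by exact_mod_cast hx1.trans hqp.1.2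
        have h3 : i' < i + 1 := by exact_mod_cast hqp.1.1.trans_lt hx
        have h4 : i' = i ∨ i' = i - 1 := by omega
        rcases h4 with rfl | rfl
        · exact hG' (h1 ▸ hp)
        · exact hL hi (h1 ▸ hp)
      · have h1 : y = j' := hqe.2
        rw [h1] at hy
        have h2 : j < j' := by exact_mod_cast hy.1
        have h3 : j' < j + 1 := by exact_mod_cast hy.2
        omega
      · have h1 : j' = j := Int.eq_of_mem_Ioo_of_mem_Icc hy.1 hy.2 hqe.2.1 hqe.2.2
        have h2 : x = i' := hqe.1
        rw [h2] at hx hx1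
        have h3 : i' < i + 1 := by exact_mod_cast hx
        have h4 : i ≤ i' := by exact_mod_cast hx1
        have h5 : i' = i := by omega
        rw [h5, h1] at he
        exact (mem_collapsedEdges_true.1 he).2.2 ⟨hi, hF', hS⟩

end GridEngulf

section GridHull

/-- No square of `Y` outside `X` is next to a square outside `X ∪ Y`. -/
def HoleSet (X Y : Set (ℤ × ℤ)) : Prop :=
  (∃ N, ∀ p ∈ Y, p.1 < N) ∧ ∀ i j, (i, j) ∈ Y → (i, j) ∉ X →
    ((i + 1, j) ∉ X → (i + 1, j) ∈ Y) ∧ ((i - 1, j) ∉ X → (i - 1, j) ∈ Y) ∧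
    ((i, j + 1) ∉ X → (i, j + 1) ∈ Y) ∧ ((i, j - 1) ∉ X → (i, j - 1) ∈ Y)

/-- The set of squares `X` with its holes filled in. -/
def gridHull (X : Set (ℤ × ℤ)) : Set (ℤ × ℤ) := X ∪ ⋃₀ {Y | HoleSet X Y}

variable {X : Set (ℤ × ℤ)} {N : ℤ}

theorem subset_gridHull : X ⊆ gridHull X := subset_union_left

theorem gridHull_adj {i j : ℤ} (h : (i, j) ∈ gridHull X) (hX : (i, j) ∉ X) :
    (i + 1, j) ∈ gridHull X ∧ (i - 1, j) ∈ gridHull X ∧ (i, j + 1) ∈ gridHull X ∧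
      (i, j - 1) ∈ gridHull X := by
  obtain ⟨Y, hY, hp⟩ := h.resolve_left hX
  have h1 : ∀ p, (p ∉ X → p ∈ Y) → p ∈ gridHull X := fun p hp => by
    by_cases hpX : p ∈ X
    · exact Or.inl hpX
    · exact Or.inr ⟨Y, hY, hp hpX⟩
  obtain ⟨h2, h3, h4, h5⟩ := hY.2 i j hp hX
  exact ⟨h1 _ h2, h1 _ h3, h1 _ h4, h1 _ h5⟩

theorem exists_mem_of_mem_gridHull {i j : ℤ} (h : (i, j) ∈ gridHull X) :
    ∃ n : ℕ, (i + n, j) ∈ X := by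
  by_contra! hn
  obtain ⟨Y, hY, hp⟩ := h.resolve_left (by simpa using hn 0)
  obtain ⟨N, hN⟩ := hY.1
  have h1 : ∀ n : ℕ, (i + n, j) ∈ Y := by
    intro n
    induction n with
    | zero => simpa using hp
    | succ n ih =>
      have := (hY.2 _ _ ih (hn n)).1
      rw [add_assoc, ← Nat.cast_succ] at this
      exact this (hn _)
  have h2 := hN _ (h1 (N - i).toNat)
  simp only at h2
  omega

theorem gridHull_subset_box (hX : ∀ p ∈ X, (-N < p.1 ∧ p.1 < N) ∧ -N < p.2 ∧ p.2 < N) :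
    ∀ p ∈ gridHull X, (-N < p.1 ∧ p.1 < N) ∧ -N < p.2 ∧ p.2 < N := by
  have h1 : ∀ p ∈ gridHull X, p.1 < N ∧ -N < p.2 ∧ p.2 < N := by
    rintro ⟨i, j⟩ hp
    obtain ⟨n, hn⟩ := exists_mem_of_mem_gridHull hp
    have := hX _ hn
    simp only at this ⊢
    omega
  rintro ⟨i, j⟩ hp
  refine ⟨⟨?_, (h1 _ hp).1⟩, (h1 _ hp).2⟩
  by_contra! hi
  simp only at hi
  have h2 : ∀ n : ℕ, (i, j + n) ∈ gridHull X := by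
    intro n
    induction n with
    | zero => simpa using hp
    | succ n ih =>
      have h3 := (gridHull_adj ih fun h => by have := (hX _ h).1.1; simp only at this; omega).2.2.1
      rwa [add_assoc, ← Nat.cast_succ] at h3
  have h3 := (h1 _ (h2 (N - j).toNat)).2.2
  simp only at h3
  omega

theorem finite_box (N : ℤ) : {p : ℤ × ℤ | (-N < p.1 ∧ p.1 < N) ∧ -N < p.2 ∧ p.2 < N}.Finite :=
  (finite_Ioo (-N) N).prod (finite_Ioo (-N) N)

theorem holeFree_gridHull (hX : ∀ p ∈ X, (-N < p.1 ∧ p.1 < N) ∧ -N < p.2 ∧ p.2 < N) :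
    HoleFree (gridHull X) := by
  rintro Y ⟨M, hM⟩ hY
  have h1 : HoleSet X (Y ∪ gridHull X) := by
    refine ⟨⟨max M N, ?_⟩, fun i j hp hpX => ?_⟩
    · rintro p (hp | hp)
      · exact (hM p hp).trans_le (le_max_left _ _)
      · exact (gridHull_subset_box hX p hp).1.2.trans_le (le_max_right _ _)
    · by_cases hF : (i, j) ∈ gridHull X
      · obtain ⟨h1, h2, h3, h4⟩ := gridHull_adj hF hpX
        exact ⟨fun _ => Or.inr h1, fun _ => Or.inr h2, fun _ => Or.inr h3, fun _ => Or.inr h4⟩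
      · obtain ⟨h1, h2, h3, h4⟩ := hY i j (hp.resolve_right hF) hF
        have h5 : ∀ p, (p ∉ gridHull X → p ∈ Y) → p ∉ X → p ∈ Y ∪ gridHull X := fun p h _ => by
          by_cases hp : p ∈ gridHull X
          · exact Or.inr hp
          · exact Or.inl (h hp)
        exact ⟨h5 _ h1, h5 _ h2, h5 _ h3, h5 _ h4⟩
  exact fun p hp => Or.inr ⟨_, h1, Or.inl hp⟩

theorem gridHull_of_adj {i j i' : ℤ} (hi : i' ≤ i + 1) (hi' : i ≤ i' + 1)
    (h : (i, j) ∈ gridHull X) (hX : (i, j) ∉ X) : (i', j) ∈ gridHull X := by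
  have : i' = i ∨ i' = i + 1 ∨ i' = i - 1 := by omega
  rcases this with rfl | rfl | rfl
  exacts [h, (gridHull_adj h hX).1, (gridHull_adj h hX).2.1]

theorem gridHull_of_adj' {i j j' : ℤ} (hj : j' ≤ j + 1) (hj' : j ≤ j' + 1)
    (h : (i, j) ∈ gridHull X) (hX : (i, j) ∉ X) : (i, j') ∈ gridHull X := by
  have : j' = j ∨ j' = j + 1 ∨ j' = j - 1 := by omega
  rcases this with rfl | rfl | rfl
  exacts [h, (gridHull_adj h hX).2.2.1, (gridHull_adj h hX).2.2.2]

theorem adj_of_mem_gridSquare {p p' : ℤ × ℤ} {q : ℝ × ℝ} (h : q ∈ gridSquare p)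
    (h' : q ∈ gridSquare p') : (p'.1 ≤ p.1 + 1 ∧ p.1 ≤ p'.1 + 1) ∧
      p'.2 ≤ p.2 + 1 ∧ p.2 ≤ p'.2 + 1 := by
  obtain ⟨⟨h1, h2⟩, h3, h4⟩ := h
  obtain ⟨⟨h1', h2'⟩, h3', h4'⟩ := h'
  refine ⟨⟨?_, ?_⟩, ?_, ?_⟩
  · exact_mod_cast h1'.trans h2
  · exact_mod_cast h1.trans h2'
  · exact_mod_cast h3'.trans h4
  · exact_mod_cast h3.trans h4'

/-- A point where the hull touches its complement lies on a square of the original set. -/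
theorem mem_gridUnion_of_frontier {p p' : ℤ × ℤ} {q : ℝ × ℝ} (hp : p ∈ gridHull X)
    (hp' : p' ∉ gridHull X) (h : q ∈ gridSquare p) (h' : q ∈ gridSquare p') :
    q ∈ gridUnion X := by
  by_contra hq
  have hqX : ∀ p, q ∈ gridSquare p → p ∉ X := fun p hqp hp => hq (mem_gridUnion.2 ⟨p, hp, hqp⟩)
  obtain ⟨⟨h1, h2⟩, h3, h4⟩ := adj_of_mem_gridSquare h h'
  have h5 : (p'.1, p.2) ∈ gridHull X := gridHull_of_adj h1 h2 hp (hqX _ h)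
  exact hp' (gridHull_of_adj' h3 h4 h5 (hqX (p'.1, p.2) ⟨h'.1, h.2⟩))

theorem EdgeClosed.corner_iff {F W : Set (ℤ × ℤ)} (hW : EdgeClosed (squareEdges F) W) {i j a b : ℤ}
    (hp : (i, j) ∈ F) (ha : a = i ∨ a = i + 1) (hb : b = j ∨ b = j + 1) :
    (i, j) ∈ W ↔ (a, b) ∈ W := by
  have h1 := hW (false, i, j) (Or.inl hp)
  have h2 := hW (true, i, j) (Or.inl hp)
  have h3 := hW (true, i + 1, j) (Or.inr (by simpa using hp))
  simp only [edgeEnd_false, edgeEnd_true] at h1 h2 h3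
  rcases ha with rfl | rfl <;> rcases hb with rfl | rfl <;> tauto

theorem EdgeClosed.corner_iff_corner {F W : Set (ℤ × ℤ)} (hW : EdgeClosed (squareEdges F) W)
    {p p' : ℤ × ℤ} {q : ℝ × ℝ} (hp : p ∈ F) (hp' : p' ∈ F) (h : q ∈ gridSquare p)
    (h' : q ∈ gridSquare p') : p ∈ W ↔ p' ∈ W := by
  obtain ⟨⟨h1, h2⟩, h3, h4⟩ := adj_of_mem_gridSquare h h'
  refine (hW.corner_iff hp (a := max p.1 p'.1) (b := max p.2 p'.2) ?_ ?_).trans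
    (hW.corner_iff hp' ?_ ?_).symm <;> omega

theorem mem_gridSquare_floor (q : ℝ × ℝ) : q ∈ gridSquare (⌊q.1⌋, ⌊q.2⌋) :=
  ⟨⟨Int.floor_le _, (Int.lt_floor_add_one _).le⟩, Int.floor_le _, (Int.lt_floor_add_one _).le⟩

theorem edgeConnected_gridHull {k : ℤ} (hk : 0 < k) {C : Set (ℝ × ℝ)} (hC : IsPreconnected C)
    (h0 : (0, 0) ∈ C)
    (hX : ∀ p ∈ {p | (gridSquare p ∩ C).Nonempty} ∪ gridBlock k,
      (-N < p.1 ∧ p.1 < N) ∧ -N < p.2 ∧ p.2 < N) :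
    EdgeConnected (squareEdges (gridHull ({p | (gridSquare p ∩ C).Nonempty} ∪ gridBlock k))) := by
  set Z := {p | (gridSquare p ∩ C).Nonempty}
  set F := gridHull (Z ∪ gridBlock k)
  intro W hW hW0
  have hZF : Z ⊆ F := subset_union_left.trans subset_gridHull
  have hSF : gridBlock k ⊆ F := subset_union_right.trans subset_gridHull
  have hS : ∀ p ∈ gridBlock k, p ∈ W := fun p hp =>
    edgeConnected_gridBlock hk W (fun e he => hW e (squareEdges_gridBlock_subset hSF he).1) hW0
      ⟨(false, p), Or.inl hp, Or.inl rfl⟩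
  have hZ : ∀ p ∈ Z, p ∈ W := by
    intro p hp
    by_contra hpW
    have hfin : Z.Finite := (finite_box N).subset fun p hp => hX p (Or.inl hp)
    have hcl : ∀ A ⊆ Z, IsClosed (gridUnion A) := fun A hA =>
      ((hfin.subset hA).isCompact_biUnion fun p _ => isCompact_gridSquare p).isClosed
    obtain ⟨q, hqC, hq1, hq2⟩ := isPreconnected_closed_iff.1 hC (gridUnion (Z ∩ W))
      (gridUnion (Z \ W)) (hcl _ inter_subset_left) (hcl _ sdiff_subset) (fun q hq => by
        have h1 : (⌊q.1⌋, ⌊q.2⌋) ∈ Z := ⟨q, mem_gridSquare_floor q, hq⟩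
        by_cases h2 : (⌊q.1⌋, ⌊q.2⌋) ∈ W
        · exact Or.inl (mem_gridUnion.2 ⟨_, ⟨h1, h2⟩, mem_gridSquare_floor q⟩)
        · exact Or.inr (mem_gridUnion.2 ⟨_, ⟨h1, h2⟩, mem_gridSquare_floor q⟩))
      ⟨(0, 0), h0, mem_gridUnion.2 ⟨(0, 0), ⟨⟨(0, 0), by simp [gridSquare], h0⟩, hW0⟩,
        by simp [gridSquare]⟩⟩
      (by
        obtain ⟨q, hq, hqC⟩ := hp
        exact ⟨q, hqC, mem_gridUnion.2 ⟨p, ⟨⟨q, hq, hqC⟩, hpW⟩, hq⟩⟩)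
    obtain ⟨p1, hp1, h1⟩ := mem_gridUnion.1 hq1
    obtain ⟨p2, hp2, h2⟩ := mem_gridUnion.1 hq2
    exact hp2.2 ((hW.corner_iff_corner (hZF hp1.1) (hZF hp2.1) h1 h2).1 hp1.2)
  have hFW : ∀ n : ℕ, ∀ i j : ℤ, (N - i).toNat = n → (i, j) ∈ F → (i, j) ∈ W := by
    intro n
    induction n with
    | zero =>
      intro i j hn hp
      have := (gridHull_subset_box hX _ hp).1.2
      simp only at this
      omega
    | succ n ih =>
      intro i j hn hp
      by_cases hpX : (i, j) ∈ Z ∪ gridBlock k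
      · exact hpX.elim (hZ _) (hS _)
      · exact (hW.corner_iff hp (Or.inr rfl) (Or.inl rfl)).2
          (ih (i + 1) j (by omega) (gridHull_adj hp hpX).1)
  rintro p ⟨⟨_ | _, i, j⟩, he | he, hp⟩
  · have := hFW _ i j rfl he
    rcases hp with rfl | rfl
    · exact this
    · exact (hW.corner_iff he (Or.inr rfl) (Or.inl rfl)).1 this
  · have := hFW _ _ _ rfl he
    rcases hp with rfl | rfl
    · exact (hW.corner_iff he (Or.inl rfl) (Or.inr (by simp))).1 this
    · exact (hW.corner_iff he (Or.inr rfl) (Or.inr (by simp))).1 this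
  · have := hFW _ i j rfl he
    rcases hp with rfl | rfl
    · exact this
    · exact (hW.corner_iff he (Or.inl rfl) (Or.inr rfl)).1 this
  · have := hFW _ _ _ rfl he
    rcases hp with rfl | rfl
    · exact (hW.corner_iff he (Or.inr (by simp)) (Or.inl rfl)).1 this
    · exact (hW.corner_iff he (Or.inr (by simp)) (Or.inr rfl)).1 this

theorem locallyFinite_gridSquare : LocallyFinite gridSquare := by
  intro q
  refine ⟨ball q 1, ball_mem_nhds q one_pos, ((finite_Icc (⌊q.1⌋ - 2) (⌊q.1⌋ + 2)).prod
    (finite_Icc (⌊q.2⌋ - 2) (⌊q.2⌋ + 2))).subset ?_⟩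
  rintro ⟨i, j⟩ ⟨x, hx, hxq⟩
  rw [mem_ball, Prod.dist_eq, max_lt_iff, Real.dist_eq, Real.dist_eq, abs_lt, abs_lt] at hxq
  have key : ∀ (i : ℤ) (x q : ℝ), i ≤ x → x ≤ i + 1 → -1 < x - q → x - q < 1 →
      i ∈ Icc (⌊q⌋ - 2) (⌊q⌋ + 2) := by
    intro i x q h1 h2 h3 h4
    have h5 := Int.floor_le q
    have h6 := Int.lt_floor_add_one q
    constructor
    · have : (⌊q⌋ : ℝ) < i + 2 := by linarith
      have : ⌊q⌋ < i + 2 := by exact_mod_cast this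
      omega
    · have : (i : ℝ) < ⌊q⌋ + 2 := by linarith
      exact_mod_cast this.le
  exact ⟨key i x.1 q.1 hx.1.1 hx.1.2 hxq.1.1 hxq.1.2, key j x.2 q.2 hx.2.1 hx.2.2 hxq.2.1 hxq.2.2⟩

theorem canEngulf_of_grid {T C L : Set (ℝ × ℝ)} (hT : IsOpen T) (hC : IsCompact C)
    (hCc : IsPreconnected C) (h0 : (0, 0) ∈ C) (hL : IsClosed L) (hLT : L ⊆ T) {k : ℤ} (hk : 0 < k)
    (hkT : closedBall (0, 0) (k : ℝ) ⊆ T)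
    (hLC : ∀ q ∈ L, ∀ c ∈ C, dist q c ≤ 1 → q ∈ ball ((0, 0) : ℝ × ℝ) k) :
    CanEngulf T (C ∪ L) := by
  set Z := {p | (gridSquare p ∩ C).Nonempty}
  obtain ⟨N, hX⟩ : ∃ N : ℤ, ∀ p ∈ Z ∪ gridBlock k, (-N < p.1 ∧ p.1 < N) ∧ -N < p.2 ∧ p.2 < N := by
    obtain ⟨M, hM⟩ := hC.isBounded.subset_closedBall (0, 0)
    refine ⟨max (⌈M⌉ + 2) (k + 1), ?_⟩
    rintro ⟨i, j⟩ (⟨q, hq, hqC⟩ | hp)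
    · have h1 := hM hqC
      rw [mem_closedBall, Prod.dist_eq, max_le_iff, Real.dist_eq, Real.dist_eq, sub_zero, sub_zero,
        abs_le, abs_le] at h1
      have key : ∀ (i : ℤ) (x : ℝ), i ≤ x → x ≤ i + 1 → -M ≤ x → x ≤ M →
          -(⌈M⌉ + 2) < i ∧ i < ⌈M⌉ + 2 := by
        intro i x h1 h2 h3 h4
        have h5 := Int.le_ceil M
        constructor
        · have : -(⌈M⌉ + 2 : ℝ) < i := by linarith
          exact_mod_cast this
        · have : (i : ℝ) < ⌈M⌉ + 2 := by linarith
          exact_mod_cast this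
      have h2 := key i q.1 hq.1.1 hq.1.2 h1.1.1 h1.1.2
      have h3 := key j q.2 hq.2.1 hq.2.2 h1.2.1 h1.2.2
      simp only
      omega
    · rw [mem_gridBlock] at hp
      simp only
      omega
  set F := gridHull (Z ∪ gridBlock k)
  have hZF : Z ⊆ F := subset_union_left.trans subset_gridHull
  have hSF : gridBlock k ⊆ F := subset_union_right.trans subset_gridHull
  have hF : F.Finite := (finite_box N).subset (gridHull_subset_box hX)
  have hball : ∀ q ∈ ball ((0, 0) : ℝ × ℝ) k, q ∈ gridUnion (gridBlock k) := by
    intro q hq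
    rw [mem_ball, Prod.dist_eq, max_lt_iff, Real.dist_eq, Real.dist_eq, sub_zero, sub_zero,
        abs_lt, abs_lt] at hq
    refine mem_gridUnion.2 ⟨_, ?_, mem_gridSquare_floor q⟩
    rw [mem_gridBlock]
    refine ⟨⟨Int.le_floor.2 ?_, Int.floor_lt.2 hq.1.2⟩, Int.le_floor.2 ?_, Int.floor_lt.2 hq.2.2⟩ <;>
      push_cast <;> linarith [hq.1.1, hq.2.1]
  have hblock : gridUnion (gridBlock k) ⊆ closedBall (0, 0) (k : ℝ) := by
    intro q hq
    obtain ⟨⟨i, j⟩, hp, hq⟩ := mem_gridUnion.1 hq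
    rw [mem_gridBlock] at hp
    have key : ∀ (i : ℤ) (x : ℝ), i ≤ x → x ≤ i + 1 → -k ≤ i → i < k → |x - 0| ≤ k := by
      intro i x h1 h2 h3 h4
      have h5 : (-k : ℝ) ≤ i := by exact_mod_cast h3
      have h6 : (i + 1 : ℝ) ≤ k := by exact_mod_cast h4
      rw [sub_zero, abs_le]
      constructor <;> linarith
    rw [mem_closedBall, Prod.dist_eq, max_le_iff, Real.dist_eq, Real.dist_eq]
    exact ⟨key i q.1 hq.1.1 hq.1.2 hp.1.1 hp.1.2, key j q.2 hq.2.1 hq.2.2 hp.2.1 hp.2.2⟩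
  set O := ⋃ p : (Fᶜ : Set (ℤ × ℤ)), gridSquare p
  have hO : IsClosed O := (locallyFinite_gridSquare.comp_injective
    (Subtype.val_injective (p := fun p => p ∈ Fᶜ))).isClosed_iUnion
    fun p => (isCompact_gridSquare p.1).isClosed
  obtain ⟨g, hg, hgD, hgF⟩ := relEngulf_gridUnion hk hF hSF (holeFree_gridHull hX)
    (edgeConnected_gridHull hk hCc h0 hX) (hL.inter hO) (U := T) (by
      rintro q ⟨⟨hqL, hqO⟩, hqF⟩
      obtain ⟨⟨p', hp'⟩, hqp'⟩ := mem_iUnion.1 hqO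
      obtain ⟨p, hp, hqp⟩ := mem_gridUnion.1 hqF
      obtain ⟨s, hs, hqs⟩ := mem_gridUnion.1 (mem_gridUnion_of_frontier hp hp' hqp hqp')
      rcases hs with ⟨c, hcs, hcC⟩ | hs
      · refine hball q (hLC q hqL c hcC ?_)
        rw [Prod.dist_eq, max_le_iff, Real.dist_eq, Real.dist_eq, abs_le, abs_le]
        obtain ⟨⟨h1, h2⟩, h3, h4⟩ := hqs
        obtain ⟨⟨h5, h6⟩, h7, h8⟩ := hcs
        refine ⟨⟨?_, ?_⟩, ?_, ?_⟩ <;> linarith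
      · exact mem_gridUnion.2 ⟨s, hs, hqs⟩) hT (hblock.trans hkT)
  refine ⟨g, hg, ?_⟩
  rintro q (hq | hq)
  · exact hgF (mem_gridUnion.2 ⟨_, hZF ⟨q, mem_gridSquare_floor q, hq⟩, mem_gridSquare_floor q⟩)
  · by_cases hqF : q ∈ gridUnion F
    · exact hgF hqF
    · refine ⟨q, hLT hq, hgD q ⟨hq, mem_iUnion.2 ⟨⟨(⌊q.1⌋, ⌊q.2⌋), fun h => hqF
        (mem_gridUnion.2 ⟨_, h, mem_gridSquare_floor q⟩)⟩, mem_gridSquare_floor q⟩⟩⟩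

end GridHull

theorem canEngulf_of_arc {T B : Set (ℝ × ℝ)} (hT : IsOpen T) {r : ℝ → ℝ × ℝ} (hr : Continuous r)
    (hrinj : Function.Injective r) (hrT : ∀ t, r t ∈ T)
    (hprop : ∀ K, IsCompact K → ∃ a : ℝ, ∀ t ≤ a, r t ∉ K) (hB : IsCompact B) (M : ℝ) :
    CanEngulf T (B ∪ r '' Iic M) := by
  obtain ⟨R, hR⟩ := (hB.insert (r M)).isBounded.subset_closedBall (0 : ℝ × ℝ)
  obtain ⟨a, ha⟩ := hprop (closedBall 0 R) (isCompact_closedBall _ _)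
  have hMR : r M ∈ closedBall (0 : ℝ × ℝ) R := hR (mem_insert _ _)
  have haM : a < M := by
    by_contra! h
    exact ha M h hMR
  set C := closedBall (0 : ℝ × ℝ) R ∪ r '' Icc a M with hCdef
  set L := r '' Iic a with hLdef
  have hC : IsCompact C := (isCompact_closedBall _ _).union (isCompact_Icc.image hr)
  have hCc : IsPreconnected C :=
    IsPreconnected.union (r M) hMR ⟨M, right_mem_Icc.2 haM.le, rfl⟩
      (convex_closedBall _ _).isPreconnected (isPreconnected_Icc.image r hr.continuousOn)
  have hL : IsClosed L := by
    refine isClosed_of_closure_subset fun q hq => ?_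
    obtain ⟨c, hc⟩ := hprop (closedBall q 1) (isCompact_closedBall _ _)
    have h1 : L ⊆ r '' Icc c a ∪ (ball q 1)ᶜ := by
      rintro _ ⟨t, ht, rfl⟩
      rcases le_total c t with h | h
      · exact Or.inl ⟨t, ⟨h, ht⟩, rfl⟩
      · exact Or.inr fun h' => hc t h (ball_subset_closedBall h')
    have h2 : IsClosed (r '' Icc c a ∪ (ball q 1)ᶜ) :=
      (isCompact_Icc.image hr).isClosed.union isOpen_ball.isClosed_compl
    rcases closure_minimal h1 h2 hq with ⟨t, ht, rfl⟩ | h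
    · exact ⟨t, ht.2, rfl⟩
    · exact absurd (mem_ball_self one_pos) h
  set p := r a with hpdef
  obtain ⟨ε, hε, hεT⟩ := nhds_basis_closedBall.mem_iff.1 (hT.mem_nhds (hrT a))
  have hdisj : Disjoint C (L \ ball p ε) := by
    rw [Set.disjoint_left]
    rintro _ (h | ⟨s, hs, rfl⟩) ⟨⟨t, ht, hts⟩, hp⟩
    · exact ha t ht (hts ▸ h)
    · obtain rfl := hrinj hts
      obtain rfl : t = a := le_antisymm ht hs.1
      exact hp (mem_ball_self hε)
  obtain ⟨η, hη, hηd⟩ := Metric.exists_pos_forall_lt_edist hC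
    (hL.sdiff isOpen_ball) hdisj
  obtain ⟨k, hk⟩ := exists_nat_gt (max 1 (ε / η))
  have hk1 : (1 : ℝ) < k := (le_max_left _ _).trans_lt hk
  have hk2 : ε / η < k := (le_max_right _ _).trans_lt hk
  have hk0 : (0 : ℝ) < k := by linarith
  have hη' : (0 : ℝ) < η := hη
  set s : ℝ := k / ε with hs
  have hs0 : 0 < s := by positivity
  let φ : ℝ × ℝ ≃ₜ ℝ × ℝ :=
    (Homeomorph.addRight (-p)).trans (Homeomorph.smulOfNeZero s hs0.ne')
  have hφ : ∀ x, φ x = s • (x + -p) := fun x => rfl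
  have hφd : ∀ x y, dist (φ x) (φ y) = s * dist x y := by
    intro x y
    rw [hφ, hφ, dist_smul₀, dist_add_right, Real.norm_of_nonneg hs0.le]
  have hφp : φ p = (0, 0) := by rw [hφ, add_neg_cancel, smul_zero]; rfl
  have hpC : p ∈ C := Or.inr ⟨a, left_mem_Icc.2 haM.le, rfl⟩
  have hsε : s * ε = k := by rw [hs]; field_simp
  refine (CanEngulf.of_conj φ (A := C ∪ L) ?_).mono ?_
  · rw [image_union]
    refine canEngulf_of_grid (k := k) (φ.isOpenMap _ hT) (hC.image φ.continuous)
      (hCc.image _ φ.continuous.continuousOn) ⟨p, hpC, hφp⟩ (φ.isClosedMap _ hL)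
      (image_mono ?_) (by exact_mod_cast hk0) ?_ ?_
    · rintro _ ⟨t, -, rfl⟩
      exact hrT t
    · intro y hy
      obtain ⟨x, rfl⟩ := φ.surjective y
      refine mem_image_of_mem _ (hεT ?_)
      rw [mem_closedBall, ← hφp, hφd, Int.cast_natCast, ← hsε] at hy
      exact le_of_mul_le_mul_left hy hs0
    · rintro _ ⟨q, hq, rfl⟩ _ ⟨c, hc, rfl⟩ hqc
      rw [mem_ball, ← hφp, hφd, Int.cast_natCast, ← hsε]
      refine mul_lt_mul_of_pos_left ?_ hs0
      by_contra! h
      have h1 := hηd c hc q ⟨hq, fun h' => absurd (mem_ball.1 h') (not_lt.2 h)⟩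
      rw [edist_nndist, ENNReal.coe_lt_coe, ← NNReal.coe_lt_coe, coe_nndist, dist_comm] at h1
      rw [hφd] at hqc
      have h2 : s * η < 1 := (mul_lt_mul_of_pos_left h1 hs0).trans_le hqc
      rw [div_lt_iff₀ hη'] at hk2
      rw [hs, div_mul_eq_mul_div, div_lt_one hε] at h2
      linarith
  · rintro x (hx | ⟨t, ht, rfl⟩)
    · exact Or.inl (Or.inl (hR (mem_insert_of_mem _ hx)))
    · rcases le_total t a with h | h
      · exact Or.inr ⟨t, h, rfl⟩
      · exact Or.inl (Or.inr ⟨t, ⟨h, ht⟩, rfl⟩)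

theorem engulfsTubes_of_homeomorph_real {E : Type*} [NormedAddCommGroup E] [NormedSpace ℝ E]
    [FiniteDimensional ℝ E] (e : E ≃ₜ ℝ) : EngulfsTubes E := by
  intro τ hτ B hB ρ
  let N : E × ℝ ≃ₜ ℝ × ℝ := e.prodCongr (Homeomorph.refl ℝ)
  have hcont : Continuous fun t : ℝ => N (τ (0, t)) :=
    N.continuous.comp (hτ.isOpenEmbedding.continuous.comp (by fun_prop))
  have hcore : ∀ B : Set (E × ℝ), IsCompact B → ∀ M : ℝ, ∃ g : E × ℝ ≃ₜ E × ℝ,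
      (∃ Q, IsCompact Q ∧ ∀ x, x ∉ Q → g x = x) ∧ B ⊆ g '' range τ ∧
      ∀ t ≤ M, τ (0, t) ∈ g '' range τ := by
    intro B hB M
    have h : CanEngulf (range τ) (B ∪ (fun t : ℝ => τ (0, t)) '' Iic M) := by
      refine CanEngulf.of_conj N ?_
      rw [image_union, image_image]
      refine canEngulf_of_arc (N.isOpenMap _ hτ.isOpenEmbedding.isOpen_range) hcont
        (fun s t hst => ?_) (fun t => mem_image_of_mem _ (mem_range_self _)) (fun K hK => ?_)
        (hB.image N.continuous) M
      · exact congrArg Prod.snd (hτ.isOpenEmbedding.injective (N.injective hst))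
      · obtain ⟨a, ha⟩ := hτ.exists_notMem (N.symm '' K) (hK.image N.symm.continuous) 0
        exact ⟨a, fun t ht h => ha (0, t) (by simp) ht ⟨_, h, N.symm_apply_apply _⟩⟩
    obtain ⟨g, hg, hA⟩ := h
    exact ⟨g, hg, fun x hx => hA (Or.inl hx), fun t ht => hA (Or.inr ⟨t, ht, rfl⟩)⟩
  obtain ⟨g, hg, hgB, hgρ⟩ := hτ.exists_engulf_of_core hcore hB (ρ := max ρ 1) (M := ρ)
    (lt_max_of_lt_right one_pos)
  exact ⟨g, hg, hgB, fun x hx => hgρ x (hx.trans (le_max_left _ _))⟩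

theorem engulfsTubes_euclideanSpace {m : ℕ} (hm : m ≠ 2) :
    EngulfsTubes (EuclideanSpace ℝ (Fin m)) := by
  rcases lt_trichotomy m 1 with h | rfl | h
  · obtain rfl : m = 0 := by omega
    exact engulfsTubes_of_subsingleton
  · exact engulfsTubes_of_homeomorph_real
      ((EuclideanSpace.equiv (Fin 1) ℝ).toHomeomorph.trans (Homeomorph.funUnique (Fin 1) ℝ))
  · refine engulfsTubes_of_two_lt_finrank ?_
    rw [finrank_euclideanSpace_fin]
    omega

/-- **Doyle's theorem.** Let `n ≥ 1` with `n ≠ 3`, and let `P` be a second-countable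
Hausdorff topological `n`-manifold with boundary (a space locally modeled on the closed
half-space `ℝⁿ⁻¹ × [0,∞)`). If the manifold interior of `P` is homeomorphic to `ℝⁿ` and
the manifold boundary of `P` is homeomorphic to `ℝⁿ⁻¹`, then `P` is homeomorphic to
`ℝⁿ⁻¹ × [0,∞)`. -/
theorem doyle_theorem (n : ℕ) [NeZero n] (hn3 : n ≠ 3)
    (P : Type) [TopologicalSpace P] [T2Space P] [SecondCountableTopology P]
    [ChartedSpace (EuclideanHalfSpace n) P]
    (hint : Nonempty (↥((modelWithCornersEuclideanHalfSpace n).interior P) ≃ₜ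
      EuclideanSpace ℝ (Fin n)))
    (hbd : Nonempty (↥((modelWithCornersEuclideanHalfSpace n).boundary P) ≃ₜ
      EuclideanSpace ℝ (Fin (n - 1)))) :
    Nonempty (P ≃ₜ EuclideanSpace ℝ (Fin (n - 1)) × Set.Ici (0 : ℝ)) := by
  obtain ⟨m, rfl⟩ := Nat.exists_eq_succ_of_ne_zero (NeZero.ne n)
  simp only [Nat.succ_eq_add_one] at hint hbd hn3 ⊢
  obtain ⟨hι⟩ := hint
  obtain ⟨hb⟩ := hbd
  set D := (modelWithCornersEuclideanHalfSpace (m + 1)).boundary P with hDdef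
  have hchart : ∀ p : P, ∃ e : OpenPartialHomeomorph P (EuclideanSpace ℝ (Fin m) × Ici (0 : ℝ)),
      p ∈ e.source ∧ ∀ q ∈ e.source, (q ∈ D ↔ (e q).2.1 = 0) := exists_chart_boundary
  have hD : IsClosed D := isClosed_of_exists_chart hchart
  have hDc : (modelWithCornersEuclideanHalfSpace (m + 1)).interior P = Dᶜ := by
    rw [hDdef, ModelWithCorners.compl_boundary]
  have : LocallyCompactSpace (Ici (0 : ℝ)) :=
    isClosed_Ici.isClosedEmbedding_subtypeVal.locallyCompactSpace
  have : LocallyCompactSpace (EuclideanHalfSpace (m + 1)) :=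
    (euclideanHalfSplit m).isClosedEmbedding.locallyCompactSpace
  have : LocallyCompactSpace P := ChartedSpace.locallyCompactSpace (EuclideanHalfSpace (m + 1)) P
  have : Nonempty P := ⟨(hb.symm 0).1⟩
  set b : EuclideanSpace ℝ (Fin m) → P := fun x => (hb.symm x).1 with hbdef
  have hbe : IsClosedEmbedding b := hD.isClosedEmbedding_subtypeVal.comp hb.symm.isClosedEmbedding
  have hbr : range b = D := by
    rw [hbdef]
    ext p
    exact ⟨fun ⟨x, hx⟩ => hx ▸ (hb.symm x).2, fun hp => ⟨hb ⟨p, hp⟩, by simp⟩⟩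
  let ι : EuclideanSpace ℝ (Fin m) × ℝ → P := fun x => (hι.symm ((euclideanSplit m).symm x)).1
  have hιo : IsOpenEmbedding ι := by
    refine IsOpenEmbedding.comp ?_
      (hι.symm.isOpenEmbedding.comp (euclideanSplit m).symm.isOpenEmbedding)
    exact (hDc ▸ hD.isOpen_compl :
      IsOpen ((modelWithCornersEuclideanHalfSpace (m + 1)).interior P)).isOpenEmbedding_subtypeVal
  have hιr : range ι = (range b)ᶜ := by
    rw [hbr, ← hDc]
    ext p
    exact ⟨fun ⟨x, hx⟩ => hx ▸ (hι.symm _).2,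
      fun hp => ⟨euclideanSplit m (hι ⟨p, hp⟩), by simp [ι]⟩⟩
  refine nonempty_homeomorph_halfSpace (D := D) fun K hK => ?_
  rw [← hbr] at hchart ⊢
  exact exists_patch_of_engulfsTubes (engulfsTubes_euclideanSpace (by omega)) hbe
    (fun p _ => hchart p) hιo hιr hK
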